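/- Let d ≥ 6 be an integer. For a very general homogeneous polynomial F of degree d in the variables x₀,…,x₄ over ℂ, every morphism of ℂ-schemes from the projective line ℙ¹_ℂ to the hypersurface V₊(F) ⊂ ℙ⁴_ℂ is constant. In particular, a very general sextic threefold in ℙ⁴ contains no rational curves. -/

import Mathlib

open AlgebraicGeometry MvPolynomial CategoryTheory

attribute [local instance] MvPolynomial.gradedAlgebra

/-- Projective `n`-space over `ℂ`, as `Proj` of the polynomial ring in `n+1`
variables with its standard grading. -/
noncomputable abbrev ProjSpace (n : ℕ) : Scheme :=
  Proj (homogeneousSubmodule (Fin (n + 1)) ℂ)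

/-- The structure morphism `ℙⁿ_ℂ ⟶ Spec ℂ`. -/
noncomputable def ProjSpace.structMap (n : ℕ) :
    ProjSpace n ⟶ Spec (CommRingCat.of ℂ) :=
  Proj.toSpecZero (homogeneousSubmodule (Fin (n + 1)) ℂ) ≫
    Spec.map (CommRingCat.ofHom
      (algebraMap ℂ (homogeneousSubmodule (Fin (n + 1)) ℂ 0)))

/-- Evaluation of a polynomial function on the space `𝓛_d` of degree-`d` forms in
`x₀, …, x₄`: a polynomial `P` in the monomial coefficients, evaluated at the
coefficients of `F`. -/
noncomputable def coeffPolyEval (d : ℕ) (P : MvPolynomial (Fin 5 →₀ ℕ) ℂ)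
    (F : ↥(homogeneousSubmodule (Fin 5) ℂ d)) : ℂ :=
  MvPolynomial.eval (fun s => MvPolynomial.coeff s (F : MvPolynomial (Fin 5) ℂ)) P

section CoeffDerivation

variable {σ L : Type*} [CommRing L]

/-- The coefficientwise action of a derivation of `L` on polynomials over `L`. -/
noncomputable def coeffDer (δ : Derivation ℤ L L) (P : MvPolynomial σ L) : MvPolynomial σ L :=
  ∑ s ∈ P.support, monomial s (δ (coeff s P))

theorem coeff_coeffDer (δ : Derivation ℤ L L) (P : MvPolynomial σ L) (s : σ →₀ ℕ) :
    coeff s (coeffDer δ P) = δ (coeff s P) := by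
  classical
  simp only [coeffDer, coeff_sum, coeff_monomial]
  rw [Finset.sum_ite_eq']
  split_ifs with h
  · rfl
  · rw [notMem_support_iff.mp h, map_zero]

theorem coeffDer_add (δ : Derivation ℤ L L) (P Q : MvPolynomial σ L) :
    coeffDer δ (P + Q) = coeffDer δ P + coeffDer δ Q := by
  ext s; simp [coeff_coeffDer]

theorem coeffDer_neg (δ : Derivation ℤ L L) (P : MvPolynomial σ L) :
    coeffDer δ (-P) = -coeffDer δ P := by
  ext s; simp [coeff_coeffDer]

theorem coeffDer_sum {ι : Type*} (δ : Derivation ℤ L L) (t : Finset ι) (P : ι → MvPolynomial σ L) :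
    coeffDer δ (∑ i ∈ t, P i) = ∑ i ∈ t, coeffDer δ (P i) := by
  ext s; simp [coeff_coeffDer, coeff_sum]

theorem coeffDer_mul (δ : Derivation ℤ L L) (P Q : MvPolynomial σ L) :
    coeffDer δ (P * Q) = coeffDer δ P * Q + P * coeffDer δ Q := by
  classical
  ext s
  simp only [coeff_coeffDer, coeff_mul, coeff_add, map_sum, Derivation.leibniz, smul_eq_mul,
    ← Finset.sum_add_distrib]
  refine Finset.sum_congr rfl fun x _ => ?_
  ring

@[simp] theorem coeffDer_C (δ : Derivation ℤ L L) (a : L) :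
    coeffDer δ (C a : MvPolynomial σ L) = C (δ a) := by
  classical
  ext s; simp only [coeff_coeffDer, coeff_C]; split_ifs <;> simp

@[simp] theorem coeffDer_X (δ : Derivation ℤ L L) (i : σ) :
    coeffDer δ (X i : MvPolynomial σ L) = 0 := by
  classical
  ext s; simp only [coeff_coeffDer, coeff_X]; split_ifs <;> simp

theorem coeffDer_smul (δ : Derivation ℤ L L) (a : L) (P : MvPolynomial σ L) :
    coeffDer δ (a • P) = δ a • P + a • coeffDer δ P := by
  rw [smul_eq_C_mul, coeffDer_mul, coeffDer_C, smul_eq_C_mul, smul_eq_C_mul]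

theorem coeffDer_lie (δ₁ δ₂ : Derivation ℤ L L) (P : MvPolynomial σ L) :
    coeffDer ⁅δ₁, δ₂⁆ P = coeffDer δ₁ (coeffDer δ₂ P) - coeffDer δ₂ (coeffDer δ₁ P) := by
  ext s; simp [coeff_coeffDer, Derivation.commutator_apply]

theorem coeffDer_add_left (δ₁ δ₂ : Derivation ℤ L L) (P : MvPolynomial σ L) :
    coeffDer (δ₁ + δ₂) P = coeffDer δ₁ P + coeffDer δ₂ P := by
  ext s; simp [coeff_coeffDer]

theorem coeffDer_smul_left (a : L) (δ : Derivation ℤ L L) (P : MvPolynomial σ L) :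
    coeffDer (a • δ) P = a • coeffDer δ P := by
  ext s; simp [coeff_coeffDer]

theorem degree_eq_of_isHomogeneous {P : MvPolynomial σ L} {n : ℕ} (hP : P.IsHomogeneous n)
    {t : σ →₀ ℕ} (ht : coeff t P ≠ 0) : t.degree = n := by
  rw [Finsupp.degree_eq_weight_one]
  exact hP ht

theorem coeffDer_isHomogeneous (δ : Derivation ℤ L L) {P : MvPolynomial σ L} {n : ℕ}
    (h : P.IsHomogeneous n) : (coeffDer δ P).IsHomogeneous n := by
  intro s hs
  apply h
  intro h0
  rw [coeff_coeffDer, h0, map_zero] at hs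
  exact hs rfl

theorem derivation_eval [Fintype σ] (δ : Derivation ℤ L L) (v : σ → L) (P : MvPolynomial σ L) :
    δ (eval v P) = eval v (coeffDer δ P) + ∑ i, eval v (pderiv i P) * δ (v i) := by
  classical
  induction P using MvPolynomial.induction_on with
  | C a => simp
  | add p q hp hq =>
    simp only [map_add, coeffDer_add, hp, hq, add_mul, Finset.sum_add_distrib]; ring
  | mul_X p j hp =>
    simp only [map_mul, eval_X, Derivation.leibniz, coeffDer_mul, hp, coeffDer_X, smul_eq_mul,
      map_add, pderiv_X, add_mul, Finset.sum_add_distrib, mul_zero, add_zero]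
    have h1 : ∀ i, eval v (Pi.single (M := fun _ => MvPolynomial σ L) i 1 j) =
      if i = j then 1 else 0 := by
      intro i
      by_cases h : i = j
      · subst h; simp
      · simp [h, Ne.symm h]
    simp only [h1, mul_add, Finset.mul_sum, mul_ite, mul_one, mul_zero, ite_mul,
      Finset.sum_ite_eq', Finset.mem_univ, if_true, zero_mul]
    have h2 : ∀ i, v j * eval v (pderiv i p) * δ (v i) = v j * (eval v (pderiv i p) * δ (v i)) :=
      fun i => mul_assoc _ _ _
    simp only [h2]
    ring

/-- The linear form with a given coefficient vector. -/
noncomputable def linForm [Fintype σ] (w : σ → L) : MvPolynomial σ L := ∑ i, C (w i) * X i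

/-- The derivative in the direction of a vector. -/
noncomputable def dirDeriv (v : σ → L) : Derivation L (MvPolynomial σ L) (MvPolynomial σ L) :=
  mkDerivation L (fun i => C (v i))

theorem dirDeriv_apply [Fintype σ] (v : σ → L) (P : MvPolynomial σ L) :
    dirDeriv v P = ∑ i, C (v i) * pderiv i P := by
  classical
  induction P using MvPolynomial.induction_on with
  | C a => simp [dirDeriv]
  | add p q hp hq => simp [hp, hq, mul_add, Finset.sum_add_distrib]
  | mul_X p j hp =>
    have h1 : dirDeriv v (X j : MvPolynomial σ L) = C (v j) := mkDerivation_X _ _ _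
    simp only [Derivation.leibniz, smul_eq_mul, hp, h1, pderiv_X, mul_add, Finset.sum_add_distrib,
      Pi.single_apply, mul_ite, mul_one, mul_zero, Finset.sum_ite_eq, Finset.mem_univ, if_true,
      Finset.mul_sum]
    congr 1
    · exact mul_comm _ _
    · exact Finset.sum_congr rfl fun i _ => by ring

theorem eval_dirDeriv [Fintype σ] (v z : σ → L) (P : MvPolynomial σ L) :
    eval z (dirDeriv v P) = ∑ i, eval z (pderiv i P) * v i := by
  simp [dirDeriv_apply, mul_comm]

theorem dirDeriv_isHomogeneous [Fintype σ] (v : σ → L) {P : MvPolynomial σ L} {n : ℕ}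
    (h : P.IsHomogeneous n) : (dirDeriv v P).IsHomogeneous (n - 1) := by
  rw [dirDeriv_apply]
  apply IsHomogeneous.sum
  intro i _
  simpa using (isHomogeneous_C σ (v i)).mul h.pderiv

theorem linForm_isHomogeneous [Fintype σ] (w : σ → L) : (linForm w).IsHomogeneous 1 := by
  apply IsHomogeneous.sum
  intro i _
  simpa using (isHomogeneous_C σ (w i)).mul (isHomogeneous_X L i)

@[simp] theorem eval_linForm [Fintype σ] (w z : σ → L) : eval z (linForm w) = w ⬝ᵥ z := by
  simp [linForm, dotProduct]

theorem dirDeriv_linForm [Fintype σ] (v w : σ → L) : dirDeriv v (linForm w) = C (w ⬝ᵥ v) := by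
  simp [linForm, dirDeriv, dotProduct, mkDerivation_X, Derivation.leibniz]

theorem linForm_add [Fintype σ] (v w : σ → L) : linForm (v + w) = linForm v + linForm w := by
  simp [linForm, add_mul, Finset.sum_add_distrib]

theorem linForm_smul [Fintype σ] (a : L) (w : σ → L) : linForm (a • w) = a • linForm w := by
  simp [linForm, Finset.smul_sum, smul_eq_C_mul, mul_assoc]

theorem linForm_single [Fintype σ] [DecidableEq σ] (i : σ) :
    linForm (Pi.single i (1 : L)) = X i := by
  simp [linForm, Pi.single_apply]

theorem coeffDer_linForm [Fintype σ] (δ : Derivation ℤ L L) (w : σ → L) :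
    coeffDer δ (linForm w) = linForm (fun i => δ (w i)) := by
  simp [linForm, coeffDer_sum, coeffDer_mul]

theorem coeffDer_pderiv (δ : Derivation ℤ L L) (i : σ) (P : MvPolynomial σ L) :
    coeffDer δ (pderiv i P) = pderiv i (coeffDer δ P) := by
  classical
  induction P using MvPolynomial.induction_on with
  | C a => simp [(by rw [← C_0, coeffDer_C]; simp : coeffDer δ (0 : MvPolynomial σ L) = 0)]
  | add p q hp hq => simp [coeffDer_add, hp, hq]
  | mul_X p j hp =>
    simp only [Derivation.leibniz, smul_eq_mul, coeffDer_add, coeffDer_mul, hp, coeffDer_X,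
      pderiv_X, mul_zero, zero_mul, zero_add, add_zero]
    by_cases h : i = j
    · subst h
      have : coeffDer δ (1 : MvPolynomial σ L) = 0 := by
        rw [← C_1, coeffDer_C]; simp
      simp [this]
    · have : coeffDer δ (0 : MvPolynomial σ L) = 0 := by
        rw [← C_0, coeffDer_C]; simp
      simp [Ne.symm h, this]

theorem coeffDer_dirDeriv [Fintype σ] (δ : Derivation ℤ L L) (v : σ → L) (P : MvPolynomial σ L) :
    coeffDer δ (dirDeriv v P) =
      dirDeriv (fun i => δ (v i)) P + dirDeriv v (coeffDer δ P) := by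
  simp [dirDeriv_apply, coeffDer_sum, coeffDer_mul, coeffDer_pderiv, Finset.sum_add_distrib]

theorem derivation_dotProduct [Fintype σ] (δ : Derivation ℤ L L) (v w : σ → L) :
    δ (v ⬝ᵥ w) = (fun i => δ (v i)) ⬝ᵥ w + v ⬝ᵥ (fun i => δ (w i)) := by
  simp only [dotProduct, map_sum, Derivation.leibniz, smul_eq_mul, Finset.sum_add_distrib]
  rw [add_comm]
  congr 1
  exact Finset.sum_congr rfl fun i _ => mul_comm _ _

end CoeffDerivation

section PencilSystem

variable {L M : Type*} [Field L] [CharZero L] [AddCommGroup M] [Module L M]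

/-- The infinitesimal data attached to a map to a sextic, expressed through the generic point `x`
of its image, a module `𝔇` of derivations and the class `Θ` of the normal displacement. -/
structure PencilSystem (F : MvPolynomial (Fin 5) L) (x y s : Fin 5 → L)
    (𝔇 : Submodule L (Derivation ℤ L L)) (Θ : MvPolynomial (Fin 5) L →ₗ[L] M)
    (P₀ P₁ : MvPolynomial (Fin 5) L) : Prop where
  homF : F.IsHomogeneous 6
  lie_mem : ∀ δ₁ ∈ 𝔇, ∀ δ₂ ∈ 𝔇, ⁅δ₁, δ₂⁆ ∈ 𝔇
  eval_x : eval x F = 0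
  x_ne : x ≠ 0
  s_x : s ⬝ᵥ x = 0
  s_y : s ⬝ᵥ y = 1
  theta_zero : ∀ δ ∈ 𝔇, ∀ c : L, (∀ i, δ (x i) = c * x i) → Θ (coeffDer δ F) = 0
  lift : ∀ G : MvPolynomial (Fin 5) L, G.IsHomogeneous 6 → ∃ δ ∈ 𝔇, coeffDer δ F = G
  lift_zero : ∀ G : MvPolynomial (Fin 5) L, G.IsHomogeneous 6 → Θ G = 0 →
    ∃ δ ∈ 𝔇, coeffDer δ F = G ∧ ∃ c : L, ∀ i, δ (x i) = c * x i
  shear : ∀ v w : Fin 5 → L, w ⬝ᵥ x = 0 →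
    ∃ δ ∈ 𝔇, coeffDer δ F = -(linForm w * dirDeriv v F) ∧ ∀ i, δ (x i) = 0
  theta_mul : ∀ P : MvPolynomial (Fin 5) L, P.IsHomogeneous 5 → ∀ w : Fin 5 → L, w ⬝ᵥ x = 0 →
    Θ (P * linForm w) = (w ⬝ᵥ y) • Θ (P * linForm s)
  homP₀ : P₀.IsHomogeneous 5
  homP₁ : P₁.IsHomogeneous 5
  indep : LinearIndependent L ![Θ (P₀ * linForm s), Θ (P₁ * linForm s)]

namespace PencilSystem

variable {F : MvPolynomial (Fin 5) L} {x y s : Fin 5 → L}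
    {𝔇 : Submodule L (Derivation ℤ L L)} {Θ : MvPolynomial (Fin 5) L →ₗ[L] M}
    {P₀ P₁ : MvPolynomial (Fin 5) L}

theorem theta_dirDeriv (h : PencilSystem F x y s 𝔇 Θ P₀ P₁) (v : Fin 5 → L) :
    Θ (dirDeriv v F * linForm s) = 0 := by
  obtain ⟨δ, hδ, hF, hx⟩ := h.shear v s h.s_x
  have := h.theta_zero δ hδ 0 (by simpa using hx)
  rw [hF, map_neg, neg_eq_zero] at this
  rwa [mul_comm]

theorem theta_mul_eq_zero (h : PencilSystem F x y s 𝔇 Θ P₀ P₁) {P : MvPolynomial (Fin 5) L}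
    (hP : P.IsHomogeneous 5) {w : Fin 5 → L} (hx : w ⬝ᵥ x = 0) (hy : w ⬝ᵥ y = 0) :
    Θ (P * linForm w) = 0 := by
  rw [h.theta_mul P hP w hx, hy, zero_smul]

theorem dot_der {δ : Derivation ℤ L L} {c : L}
    (hδ : ∀ i, δ (x i) = c * x i) {w : Fin 5 → L} (hx : w ⬝ᵥ x = 0) :
    (fun i => δ (w i)) ⬝ᵥ x = 0 := by
  have h1 := derivation_dotProduct δ w x
  rw [hx, map_zero] at h1
  have h2 : (fun i => δ (x i)) = c • x := by ext i; simp [hδ]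
  rw [h2, dotProduct_smul, hx, smul_zero, add_zero] at h1
  exact h1.symm

theorem dot_der_y {δ : Derivation ℤ L L} {w : Fin 5 → L} (hy : w ⬝ᵥ y = 0) :
    (fun i => δ (w i)) ⬝ᵥ y = -(w ⬝ᵥ (fun i => δ (y i))) := by
  have h1 := derivation_dotProduct δ w y
  rw [hy, map_zero] at h1
  exact eq_neg_of_add_eq_zero_left h1.symm

theorem theta_coeffDer_mul (h : PencilSystem F x y s 𝔇 Θ P₀ P₁) {δ : Derivation ℤ L L} {c : L}
    (hδ : ∀ i, δ (x i) = c * x i) {P : MvPolynomial (Fin 5) L}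
    (hP : P.IsHomogeneous 5) {w : Fin 5 → L} (hx : w ⬝ᵥ x = 0) (hy : w ⬝ᵥ y = 0) :
    Θ (coeffDer δ (P * linForm w)) = -(w ⬝ᵥ fun i => δ (y i)) • Θ (P * linForm s) := by
  rw [coeffDer_mul, map_add, h.theta_mul_eq_zero (coeffDer_isHomogeneous δ hP) hx hy, zero_add,
    coeffDer_linForm, h.theta_mul P hP _ (dot_der hδ hx), dot_der_y hy]

theorem theta_coeffDer_coeffDer (h : PencilSystem F x y s 𝔇 Θ P₀ P₁) {δ₁ δ₂ : Derivation ℤ L L}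
    (hδ₁ : δ₁ ∈ 𝔇) (hδ₂ : δ₂ ∈ 𝔇) {c₁ c₂ : L}
    (hx₁ : ∀ i, δ₁ (x i) = c₁ * x i) (hx₂ : ∀ i, δ₂ (x i) = c₂ * x i)
    {P : MvPolynomial (Fin 5) L} (hP : P.IsHomogeneous 5) {w : Fin 5 → L}
    (hx : w ⬝ᵥ x = 0) (hy : w ⬝ᵥ y = 0) (hF₂ : coeffDer δ₂ F = P * linForm w) :
    Θ (coeffDer δ₂ (coeffDer δ₁ F)) = -(w ⬝ᵥ fun i => δ₁ (y i)) • Θ (P * linForm s) := by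
  have h1 := h.theta_zero _ (h.lie_mem _ hδ₁ _ hδ₂) (δ₁ c₂ - δ₂ c₁) (by
    intro i
    rw [Derivation.commutator_apply, hx₁, hx₂, Derivation.leibniz, Derivation.leibniz, hx₁, hx₂]
    simp only [smul_eq_mul]; ring)
  rw [coeffDer_lie, map_sub, sub_eq_zero, hF₂, h.theta_coeffDer_mul hx₁ hP hx hy] at h1
  exact h1.symm

theorem dot_der_y_eq_zero (h : PencilSystem F x y s 𝔇 Θ P₀ P₁) {δ : Derivation ℤ L L}
    (hδ : δ ∈ 𝔇) {c : L} (hxδ : ∀ i, δ (x i) = c * x i)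
    {P : MvPolynomial (Fin 5) L} (hP : P.IsHomogeneous 5) {w : Fin 5 → L}
    (hx : w ⬝ᵥ x = 0) (hy : w ⬝ᵥ y = 0) (hF : coeffDer δ F = P * linForm w)
    {w' : Fin 5 → L} (hx' : w' ⬝ᵥ x = 0) (hy' : w' ⬝ᵥ y = 0) :
    (w' ⬝ᵥ fun i => δ (y i)) = 0 := by
  by_contra hne
  have key : ∀ Q : MvPolynomial (Fin 5) L, Q.IsHomogeneous 5 →
      ∃ a : L, Θ (Q * linForm s) = a • Θ (P * linForm s) := by
    intro Q hQ
    obtain ⟨δ', hδ', hF', c', hx2⟩ := h.lift_zero (Q * linForm w')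
      (hQ.mul (linForm_isHomogeneous w')) (h.theta_mul_eq_zero hQ hx' hy')
    have h1 := h.theta_coeffDer_coeffDer hδ hδ' hxδ hx2 hQ hx' hy' hF'
    rw [hF, h.theta_coeffDer_mul hx2 hP hx hy] at h1
    refine ⟨(w' ⬝ᵥ fun i => δ (y i))⁻¹ * (w ⬝ᵥ fun i => δ' (y i)), ?_⟩
    rw [neg_smul, neg_smul, neg_inj] at h1
    rw [mul_smul, h1, smul_smul, inv_mul_cancel₀ hne, one_smul]
  obtain ⟨a, ha⟩ := key P₀ h.homP₀
  obtain ⟨b, hb⟩ := key P₁ h.homP₁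
  have hi := h.indep
  rw [LinearIndependent.pair_iff] at hi
  have h2 := hi b (-a) (by rw [ha, hb, smul_smul, smul_smul, ← add_smul]; ring_nf; simp)
  have h3 := hi 1 0 (by rw [ha, neg_eq_zero.mp h2.2]; simp)
  exact one_ne_zero h3.1

theorem theta_P₀_ne (h : PencilSystem F x y s 𝔇 Θ P₀ P₁) : Θ (P₀ * linForm s) ≠ 0 := by
  simpa using h.indep.ne_zero 0

theorem dot_der_y_shear (h : PencilSystem F x y s 𝔇 Θ P₀ P₁) {δ₁ δ₂ : Derivation ℤ L L}
    (hδ₁ : δ₁ ∈ 𝔇) (hδ₂ : δ₂ ∈ 𝔇) {c : L} {v w : Fin 5 → L}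
    (hx₁ : ∀ i, δ₁ (x i) = 0) (hF₁ : coeffDer δ₁ F = -(linForm s * dirDeriv v F))
    (hx₂ : ∀ i, δ₂ (x i) = c * x i) (hx : w ⬝ᵥ x = 0) (hy : w ⬝ᵥ y = 0)
    (hF₂ : coeffDer δ₂ F = P₀ * linForm w) :
    (w ⬝ᵥ fun i => δ₁ (y i)) = w ⬝ᵥ v := by
  have h1 := h.theta_coeffDer_coeffDer (c₁ := 0) hδ₁ hδ₂ (by simpa using hx₁) hx₂ h.homP₀ hx hy hF₂
  have hv : (dirDeriv v F).IsHomogeneous 5 := dirDeriv_isHomogeneous v h.homF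
  have hP : (dirDeriv v P₀).IsHomogeneous 4 := dirDeriv_isHomogeneous v h.homP₀
  have h2 : Θ (coeffDer δ₂ (coeffDer δ₁ F)) = -(w ⬝ᵥ v) • Θ (P₀ * linForm s) := by
    rw [hF₁, coeffDer_neg, coeffDer_mul, coeffDer_linForm, coeffDer_dirDeriv, hF₂, map_neg, map_add,
      mul_comm (linForm _) (dirDeriv v F), h.theta_mul _ hv _ (dot_der hx₂ h.s_x),
      h.theta_dirDeriv, smul_zero, zero_add, mul_add, map_add, mul_comm, h.theta_dirDeriv, zero_add,
      Derivation.leibniz, dirDeriv_linForm, smul_eq_mul, smul_eq_mul, mul_add, map_add]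
    have h3 : Θ (linForm s * (linForm w * dirDeriv v P₀)) = 0 := by
      rw [show linForm s * (linForm w * dirDeriv v P₀) = (dirDeriv v P₀ * linForm s) * linForm w by
        ring]
      exact h.theta_mul_eq_zero (hP.mul (linForm_isHomogeneous s)) hx hy
    rw [h3, add_zero, show linForm s * (P₀ * C (w ⬝ᵥ v)) = (w ⬝ᵥ v) • (P₀ * linForm s) by
      rw [smul_eq_C_mul]; ring, map_smul, neg_smul]
  rw [h2] at h1
  have := smul_left_injective L h.theta_P₀_ne h1
  exact (neg_inj.mp this).symm

/-- The degree `n + 1` part of the ideal of the line spanned by `x` and `y`. -/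
noncomputable def lineIdeal (x y : Fin 5 → L) (n : ℕ) : Submodule L (MvPolynomial (Fin 5) L) :=
  Submodule.span L {P | ∃ (w : Fin 5 → L) (Q : MvPolynomial (Fin 5) L),
    w ⬝ᵥ x = 0 ∧ w ⬝ᵥ y = 0 ∧ Q.IsHomogeneous n ∧ P = Q * linForm w}

theorem exists_dual (h : PencilSystem F x y s 𝔇 Θ P₀ P₁) :
    ∃ r : Fin 5 → L, r ⬝ᵥ x = 1 ∧ r ⬝ᵥ y = 0 := by
  obtain ⟨k, hk⟩ := Function.ne_iff.mp h.x_ne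
  refine ⟨Pi.single k (x k)⁻¹ - ((x k)⁻¹ * y k) • s, ?_, ?_⟩
  · rw [sub_dotProduct, smul_dotProduct, h.s_x, single_dotProduct, smul_zero, sub_zero]
    exact inv_mul_cancel₀ hk
  · rw [sub_dotProduct, smul_dotProduct, h.s_y, single_dotProduct]
    simp

theorem mem_line_of_forall (h : PencilSystem F x y s 𝔇 Θ P₀ P₁) {v : Fin 5 → L}
    (hv : ∀ w : Fin 5 → L, w ⬝ᵥ x = 0 → w ⬝ᵥ y = 0 → w ⬝ᵥ v = 0) :
    ∃ a b : L, v = a • x + b • y := by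
  obtain ⟨r, hrx, hry⟩ := h.exists_dual
  refine ⟨r ⬝ᵥ v, s ⬝ᵥ v, ?_⟩
  ext j
  have := hv (Pi.single j 1 - x j • r - y j • s)
    (by simp [sub_dotProduct, hrx, h.s_x]) (by simp [sub_dotProduct, hry, h.s_y])
  simp only [sub_dotProduct, single_dotProduct, one_mul, smul_dotProduct, smul_eq_mul] at this
  simp only [Pi.add_apply, Pi.smul_apply, smul_eq_mul]
  linear_combination this

/-- A direction in which all first derivatives vanish along the line lies in the line. -/
theorem mem_line_of_dirDeriv_mem (h : PencilSystem F x y s 𝔇 Θ P₀ P₁) {v : Fin 5 → L}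
    (hv : dirDeriv v F ∈ lineIdeal x y 4) : ∃ a b : L, v = a • x + b • y := by
  refine h.mem_line_of_forall fun w hx hy => ?_
  obtain ⟨δ₁, hδ₁, hF₁, hx₁⟩ := h.shear v s h.s_x
  obtain ⟨δ₂, hδ₂, hF₂, c, hx₂⟩ := h.lift_zero (P₀ * linForm w)
      (h.homP₀.mul (linForm_isHomogeneous w)) (h.theta_mul_eq_zero h.homP₀ hx hy)
  rw [← h.dot_der_y_shear hδ₁ hδ₂ hx₁ hF₁ hx₂ hx hy hF₂]
  have h1 := h.theta_coeffDer_coeffDer (c₁ := 0) hδ₁ hδ₂ (by simpa using hx₁) hx₂ h.homP₀ hx hy hF₂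
  have h2 : Θ (dirDeriv v F * linForm s) = 0 ∧ Θ (coeffDer δ₂ (dirDeriv v F * linForm s)) = 0 := by
    clear hF₁
    rw [lineIdeal] at hv
    generalize dirDeriv v F = R at hv
    induction hv using Submodule.span_induction with
    | mem P hP =>
      obtain ⟨w', Q, hx', hy', hQ, rfl⟩ := hP
      rw [show Q * linForm w' * linForm s = (Q * linForm s) * linForm w' by ring]
      have hQ' := hQ.mul (linForm_isHomogeneous s)
      refine ⟨h.theta_mul_eq_zero hQ' hx' hy', ?_⟩
      rw [h.theta_coeffDer_mul hx₂ hQ' hx' hy',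
        h.dot_der_y_eq_zero hδ₂ hx₂ h.homP₀ hx hy hF₂ hx' hy', neg_zero, zero_smul]
    | zero =>
      have : coeffDer δ₂ (0 : MvPolynomial (Fin 5) L) = 0 := by
        rw [← C_0, coeffDer_C]; simp
      simp [this]
    | add P Q _ _ hP hQ =>
      rw [add_mul, coeffDer_add, map_add, map_add, hP.1, hP.2, hQ.1, hQ.2]; simp
    | smul a P _ hP =>
      rw [smul_mul_assoc, coeffDer_smul, map_add, map_smul, map_smul, map_smul, hP.1, hP.2]; simp
  rw [hF₁, coeffDer_neg, map_neg, mul_comm, h2.2, neg_zero] at h1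
  have := (smul_eq_zero.mp h1.symm).resolve_right h.theta_P₀_ne
  exact neg_eq_zero.mp this

theorem linForm_mul_mem_lineIdeal {n : ℕ} {w : Fin 5 → L} (hx : w ⬝ᵥ x = 0) (hy : w ⬝ᵥ y = 0)
    {Q : MvPolynomial (Fin 5) L} (hQ : Q.IsHomogeneous n) : Q * linForm w ∈ lineIdeal x y n :=
  Submodule.subset_span ⟨w, Q, hx, hy, hQ, rfl⟩

theorem lineIdeal_mul_X {n : ℕ} {P : MvPolynomial (Fin 5) L} (hP : P ∈ lineIdeal x y n)
    (j : Fin 5) : P * X j ∈ lineIdeal x y (n + 1) := by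
  rw [lineIdeal] at hP
  induction hP using Submodule.span_induction with
  | mem P hP =>
    obtain ⟨w, Q, hx, hy, hQ, rfl⟩ := hP
    rw [show Q * linForm w * X j = (Q * X j) * linForm w by ring]
    exact linForm_mul_mem_lineIdeal hx hy (hQ.mul (isHomogeneous_X L j))
  | zero => simp
  | add P Q _ _ hP hQ => rw [add_mul]; exact add_mem hP hQ
  | smul a P _ hP => rw [smul_mul_assoc]; exact Submodule.smul_mem _ _ hP

theorem eval_of_mem_lineIdeal {n : ℕ} {P : MvPolynomial (Fin 5) L} (hP : P ∈ lineIdeal x y n)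
    (a b : L) : eval (a • x + b • y) P = 0 := by
  rw [lineIdeal] at hP
  induction hP using Submodule.span_induction with
  | mem P hP =>
    obtain ⟨w, Q, hx, hy, hQ, rfl⟩ := hP
    simp [hx, hy]
  | zero => simp
  | add P Q _ _ hP hQ => rw [map_add, hP, hQ, add_zero]
  | smul a P _ hP => rw [smul_eval, hP, mul_zero]

/-- Binary forms in two fixed linear forms. -/
noncomputable def binarySpan (r s : Fin 5 → L) (n : ℕ) : Submodule L (MvPolynomial (Fin 5) L) :=
  Submodule.span L (Set.range fun i : Fin (n + 1) => linForm r ^ (n - i : ℕ) * linForm s ^ (i : ℕ))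

theorem monomial_mem_lineIdeal_sup {r : Fin 5 → L} (hrx : r ⬝ᵥ x = 1) (hry : r ⬝ᵥ y = 0)
    (hsx : s ⬝ᵥ x = 0) (hsy : s ⬝ᵥ y = 1) (n : ℕ) :
    homogeneousSubmodule (Fin 5) L (n + 1) ≤ lineIdeal x y n ⊔ binarySpan r s (n + 1) := by
  have hw : ∀ j, ∃ w : Fin 5 → L, w ⬝ᵥ x = 0 ∧ w ⬝ᵥ y = 0 ∧
      (X j : MvPolynomial (Fin 5) L) = x j • linForm r + y j • linForm s + linForm w := by
    intro j
    refine ⟨Pi.single j 1 - x j • r - y j • s, by simp [sub_dotProduct, hrx, hsx],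
      by simp [sub_dotProduct, hry, hsy], ?_⟩
    rw [← linForm_smul, ← linForm_smul, ← linForm_add, ← linForm_add, ← linForm_single]
    congr 1; abel
  have hr : ∀ m, ∀ P ∈ binarySpan r s m, P * linForm r ∈ binarySpan r s (m + 1) := by
    intro m P hP
    rw [binarySpan] at hP
    induction hP using Submodule.span_induction with
    | mem P hP =>
      obtain ⟨i, rfl⟩ := hP
      refine Submodule.subset_span ⟨i.castSucc, ?_⟩
      have := i.2
      simp only [Fin.val_castSucc]
      rw [show m + 1 - (i : ℕ) = (m - i) + 1 by omega, pow_succ]; ring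
    | zero => simp
    | add P Q _ _ hP hQ => rw [add_mul]; exact add_mem hP hQ
    | smul a P _ hP => rw [smul_mul_assoc]; exact Submodule.smul_mem _ _ hP
  have hs : ∀ m, ∀ P ∈ binarySpan r s m, P * linForm s ∈ binarySpan r s (m + 1) := by
    intro m P hP
    rw [binarySpan] at hP
    induction hP using Submodule.span_induction with
    | mem P hP =>
      obtain ⟨i, rfl⟩ := hP
      refine Submodule.subset_span ⟨i.succ, ?_⟩
      simp only [Fin.val_succ]
      rw [show m + 1 - ((i : ℕ) + 1) = (m - i) by omega, pow_succ]; ring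
    | zero => simp
    | add P Q _ _ hP hQ => rw [add_mul]; exact add_mem hP hQ
    | smul a P _ hP => rw [smul_mul_assoc]; exact Submodule.smul_mem _ _ hP
  have hhom : ∀ m, ∀ P ∈ binarySpan r s m, P.IsHomogeneous m := by
    intro m P hP
    have : binarySpan r s m ≤ homogeneousSubmodule (Fin 5) L m := by
      rw [binarySpan, Submodule.span_le]
      rintro _ ⟨i, rfl⟩
      have h1 := ((linForm_isHomogeneous r).pow (m - i)).mul ((linForm_isHomogeneous s).pow (i : ℕ))
      rwa [one_mul, one_mul, show m - (i : ℕ) + i = m by omega] at h1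
    exact this hP
  have hbX : ∀ m, ∀ P ∈ binarySpan r s m, ∀ j,
      P * X j ∈ lineIdeal x y m ⊔ binarySpan r s (m + 1) := by
    intro m P hP j
    obtain ⟨w, hwx, hwy, hX⟩ := hw j
    rw [hX, mul_add, mul_add, mul_smul_comm, mul_smul_comm]
    refine add_mem (add_mem ?_ ?_) ?_
    · exact Submodule.mem_sup_right (Submodule.smul_mem _ _ (hr m P hP))
    · exact Submodule.mem_sup_right (Submodule.smul_mem _ _ (hs m P hP))
    · exact Submodule.mem_sup_left (linForm_mul_mem_lineIdeal hwx hwy (hhom m P hP))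
  have hmono : ∀ n (t : Fin 5 →₀ ℕ), t.degree = n + 1 →
      (monomial t (1 : L)) ∈ lineIdeal x y n ⊔ binarySpan r s (n + 1) := by
    intro n
    induction n with
    | zero =>
      intro t ht
      obtain ⟨j, rfl⟩ : ∃ j, t = Finsupp.single j 1 := by
        obtain ⟨j, hj⟩ : ∃ j, t j ≠ 0 := by
          by_contra! hcon
          have : t = 0 := by ext j; exact hcon j
          subst this; simp at ht
        have hle : Finsupp.single j 1 ≤ t := by
          rw [Finsupp.single_le_iff]; omega
        have h1 : (t - Finsupp.single j 1 + Finsupp.single j 1).degree = 0 + 1 := by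
          rw [tsub_add_cancel_of_le hle, ht]
        rw [map_add, Finsupp.degree_single, add_left_inj, Finsupp.degree_eq_zero_iff] at h1
        refine ⟨j, ?_⟩
        rw [← tsub_add_cancel_of_le hle, h1, zero_add]
      have := hbX 0 1 (Submodule.subset_span ⟨0, by simp⟩) j
      rw [one_mul] at this
      exact this
    | succ n ih =>
      intro t ht
      obtain ⟨j, hj⟩ : ∃ j, t j ≠ 0 := by
        by_contra! hcon
        have : t = 0 := by ext j; exact hcon j
        subst this; simp at ht
      have hle : Finsupp.single j 1 ≤ t := by
        rw [Finsupp.single_le_iff]; omega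
      have hdeg : (t - Finsupp.single j 1).degree = n + 1 := by
        have h1 : (t - Finsupp.single j 1 + Finsupp.single j 1).degree = n + 1 + 1 := by
          rw [tsub_add_cancel_of_le hle, ht]
        rw [map_add, Finsupp.degree_single] at h1
        omega
      have h2 := ih _ hdeg
      have h3 : monomial t (1 : L) = monomial (t - Finsupp.single j 1) 1 * X j := by
        rw [X, monomial_mul, tsub_add_cancel_of_le hle, one_mul]
      rw [h3]
      obtain ⟨P, hP, Q, hQ, hPQ⟩ := Submodule.mem_sup.mp h2
      rw [← hPQ, add_mul]
      exact add_mem (Submodule.mem_sup_left (lineIdeal_mul_X hP j)) (hbX _ Q hQ j)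
  intro P hP
  rw [P.as_sum]
  refine Submodule.sum_mem _ fun t ht => ?_
  have h1 : monomial t (coeff t P) = coeff t P • monomial t 1 := by
    rw [smul_monomial, smul_eq_mul, mul_one]
  rw [h1]
  refine Submodule.smul_mem _ _ (hmono n t ?_)
  exact degree_eq_of_isHomogeneous hP (mem_support_iff.mp ht)

theorem exists_dirDeriv_mem (h : PencilSystem F x y s 𝔇 Θ P₀ P₁) :
    ∃ v : Fin 5 → L, v ≠ 0 ∧ dirDeriv v F ∈ lineIdeal x y 4 := by
  obtain ⟨r, hrx, hry⟩ := h.exists_dual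
  let q := (lineIdeal x y 4).mkQ
  let u : Fin 5 ⊕ Fin 2 → MvPolynomial (Fin 5) L :=
    Sum.elim (fun i => pderiv i F) ![P₀, P₁]
  have hu : ∀ i, (u i).IsHomogeneous 5 := by
    rintro (i | i)
    · exact h.homF.pderiv
    · fin_cases i
      · exact h.homP₀
      · exact h.homP₁
  let g : Fin 6 → MvPolynomial (Fin 5) L ⧸ lineIdeal x y 4 :=
    fun i => q (linForm r ^ (5 - i : ℕ) * linForm s ^ (i : ℕ))
  have hq : ∀ i, q (u i) ∈ Submodule.span L (Set.range g) := by
    intro i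
    have h1 := monomial_mem_lineIdeal_sup hrx hry h.s_x h.s_y 4 (hu i)
    obtain ⟨A, hA, B, hB, hAB⟩ := Submodule.mem_sup.mp h1
    rw [← hAB, map_add, (Submodule.Quotient.mk_eq_zero _).mpr hA |> fun e => (show q A = 0 from e),
      zero_add]
    have : Submodule.span L (Set.range g) = (binarySpan r s 5).map q := by
      rw [binarySpan, Submodule.map_span, ← Set.range_comp]; rfl
    rw [this]
    exact Submodule.mem_map_of_mem hB
  have hdep : ¬ LinearIndependent L (fun i => q (u i)) := by
    classical
    intro hli
    have := linearIndependent_le_span' (fun i => q (u i)) hli (Set.range g)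
      (by rintro _ ⟨i, rfl⟩; exact hq i)
    have h2 : (Set.range g).ncard ≤ 6 := by
      rw [← Set.image_univ]
      refine (Set.ncard_image_le (Set.toFinite _)).trans ?_
      simp
    rw [← Nat.card_coe_set_eq, Nat.card_eq_fintype_card] at h2
    have h3 : ((7 : ℕ) : Cardinal) ≤ ((Fintype.card (Set.range g) : ℕ) : Cardinal) := by
      refine le_trans ?_ this
      norm_num
    have h4 := Nat.cast_le.mp h3
    omega
  rw [Fintype.not_linearIndependent_iff] at hdep
  obtain ⟨c, hc, hne⟩ := hdep
  set v : Fin 5 → L := fun i => c (Sum.inl i) with hv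
  have hmem : dirDeriv v F + (c (Sum.inr 0) • P₀ + c (Sum.inr 1) • P₁) ∈ lineIdeal x y 4 := by
    rw [← Submodule.Quotient.mk_eq_zero]
    change q _ = 0
    rw [← hc, Fintype.sum_sum_type]
    simp [u, dirDeriv_apply, map_sum, ← smul_eq_C_mul, v]
  have hzero : ∀ P ∈ lineIdeal x y 4, Θ (P * linForm s) = 0 := by
    intro P hP
    rw [lineIdeal] at hP
    induction hP using Submodule.span_induction with
    | mem P hP =>
      obtain ⟨w', Q, hx', hy', hQ, rfl⟩ := hP
      rw [show Q * linForm w' * linForm s = (Q * linForm s) * linForm w' by ring]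
      exact h.theta_mul_eq_zero (hQ.mul (linForm_isHomogeneous s)) hx' hy'
    | zero => simp
    | add P Q _ _ hP hQ => rw [add_mul, map_add, hP, hQ, add_zero]
    | smul a P _ hP => rw [smul_mul_assoc, map_smul, hP, smul_zero]
  have h1 := hzero _ hmem
  rw [add_mul, add_mul, map_add, map_add, h.theta_dirDeriv, zero_add, smul_mul_assoc,
    smul_mul_assoc, map_smul, map_smul] at h1
  obtain ⟨h2, h3⟩ := (LinearIndependent.pair_iff.mp h.indep) _ _ h1
  rw [h2, h3, zero_smul, zero_smul, add_zero, add_zero] at hmem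
  refine ⟨v, ?_, hmem⟩
  rintro hv0
  obtain ⟨i, hi⟩ := hne
  apply hi
  rcases i with i | i
  · exact congrFun hv0 i
  · fin_cases i
    · exact h2
    · exact h3

/-- The restriction of a polynomial to the affine line `z + t v`. -/
noncomputable def restrictLine (z v : Fin 5 → L) : MvPolynomial (Fin 5) L →ₐ[L] Polynomial L :=
  aeval fun i => Polynomial.C (z i) + Polynomial.C (v i) * Polynomial.X

theorem eval_restrictLine (z v : Fin 5 → L) (P : MvPolynomial (Fin 5) L) (t : L) :
    (restrictLine z v P).eval t = eval (z + t • v) P := by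
  induction P using MvPolynomial.induction_on with
  | C a => simp [restrictLine]
  | add p q hp hq => simp [hp, hq]
  | mul_X p j hp => rw [map_mul, Polynomial.eval_mul, hp]; simp [restrictLine, mul_comm t]

theorem derivative_restrictLine (z v : Fin 5 → L) (P : MvPolynomial (Fin 5) L) :
    Polynomial.derivative (restrictLine z v P) = restrictLine z v (dirDeriv v P) := by
  induction P using MvPolynomial.induction_on with
  | C a => simp [restrictLine]
  | add p q hp hq => simp [hp, hq]
  | mul_X p j hp =>
    have h1 : dirDeriv v (X j : MvPolynomial (Fin 5) L) = C (v j) := mkDerivation_X _ _ _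
    rw [map_mul, Polynomial.derivative_mul, hp, Derivation.leibniz, h1, map_add, smul_eq_mul,
      smul_eq_mul, map_mul, map_mul]
    simp [restrictLine]; ring

theorem eval_add_smul_eq {z v : Fin 5 → L} {P : MvPolynomial (Fin 5) L}
    (h : ∀ t : L, eval (z + t • v) (dirDeriv v P) = 0) (t : L) :
    eval (z + t • v) P = eval z P := by
  have h1 : Polynomial.derivative (restrictLine z v P) = 0 := by
    rw [derivative_restrictLine]
    apply Polynomial.funext
    intro t
    rw [eval_restrictLine, h, Polynomial.eval_zero]
  have h2 := Polynomial.eq_C_of_derivative_eq_zero h1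
  have h3 := eval_restrictLine z v P t
  have h4 := eval_restrictLine z v P 0
  rw [h2, Polynomial.eval_C] at h3 h4
  rw [← h3, h4, zero_smul, add_zero]

theorem eval_smul_of_isHomogeneous {P : MvPolynomial (Fin 5) L} {n : ℕ} (hP : P.IsHomogeneous n)
    (c : L) (z : Fin 5 → L) : eval (c • z) P = c ^ n * eval z P := by
  rw [eval_eq, eval_eq, Finset.mul_sum]
  refine Finset.sum_congr rfl fun t ht => ?_
  have := degree_eq_of_isHomogeneous hP (mem_support_iff.mp ht)
  simp only [Pi.smul_apply, smul_eq_mul, mul_pow, Finset.prod_mul_distrib]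
  rw [Finset.prod_pow_eq_pow_sum, show ∑ i ∈ t.support, t i = n from this]
  ring

/-- The hypersurface does not contain the line spanned by `x` and `y`. -/
theorem exists_eval_ne_zero (h : PencilSystem F x y s 𝔇 Θ P₀ P₁) :
    ∃ a b : L, eval (a • x + b • y) F ≠ 0 := by
  by_contra! hcon
  obtain ⟨r, hrx, hry⟩ := h.exists_dual
  let ρ := restrictLine x y
  have hF : ∀ t : L, eval (x + t • y) F = 0 := fun t => by simpa using hcon 1 t
  have hv : ∀ a b t : L, eval (x + t • y) (dirDeriv (a • x + b • y) F) = 0 := by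
    intro a b t
    have h0 : restrictLine (x + t • y) (a • x + b • y) F = 0 := by
      apply Polynomial.funext
      intro u
      rw [eval_restrictLine, Polynomial.eval_zero]
      have := hcon (1 + u * a) (t + u * b)
      rw [← this]; congr 2; ext i; simp; ring
    have h1 := derivative_restrictLine (x + t • y) (a • x + b • y) F
    rw [h0, Polynomial.derivative_zero] at h1
    have h2 := eval_restrictLine (x + t • y) (a • x + b • y) (dirDeriv (a • x + b • y) F) 0
    rw [← h1, Polynomial.eval_zero, zero_smul, add_zero] at h2
    exact h2.symm
  obtain ⟨Φ, hΦ'⟩ : ∃ Φ : (Fin 5 → L) × (Fin 5 → L) →ₗ[L] Polynomial L, ∀ w, Φ w =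
      ∑ i, (w.1 i • ρ (pderiv i F) + w.2 i • (Polynomial.X * ρ (pderiv i F))) := by
    refine ⟨{ toFun := fun w =>
                ∑ i, (w.1 i • ρ (pderiv i F) + w.2 i • (Polynomial.X * ρ (pderiv i F)))
              map_add' := ?_, map_smul' := ?_ }, fun w => rfl⟩
    · intro a b
      simp only [Prod.fst_add, Prod.snd_add, Pi.add_apply, add_smul, ← Finset.sum_add_distrib]
      refine Finset.sum_congr rfl fun i _ => by abel
    · intro c a
      simp only [Prod.smul_fst, Prod.smul_snd, Pi.smul_apply, smul_assoc, Finset.smul_sum,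
        smul_add, RingHom.id_apply]
  have hΦ : ∀ w t, (Φ w).eval t = eval (x + t • y) (dirDeriv (w.1 + t • w.2) F) := by
    intro w t
    rw [eval_dirDeriv, hΦ', Polynomial.eval_finsetSum]
    refine Finset.sum_congr rfl fun i _ => ?_
    simp only [Polynomial.eval_add, Polynomial.eval_smul, Polynomial.eval_mul, Polynomial.eval_X,
      Pi.add_apply, Pi.smul_apply, smul_eq_mul, ρ, eval_restrictLine]
    ring
  have hker : 4 ≤ Module.finrank L (LinearMap.ker Φ) := by
    have hk : ∀ i : Fin 4, (![(x, 0), (y, 0), (0, x), (0, y)] i : (Fin 5 → L) × (Fin 5 → L)) ∈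
        LinearMap.ker Φ := by
      intro i
      rw [LinearMap.mem_ker]
      apply Polynomial.funext
      intro t
      rw [hΦ, Polynomial.eval_zero]
      fin_cases i
      · simpa using hv 1 0 t
      · simpa using hv 0 1 t
      · simpa using hv t 0 t
      · simpa using hv 0 t t
    let κ : Fin 4 → LinearMap.ker Φ := fun i => ⟨_, hk i⟩
    have : LinearIndependent L κ := by
      have h1 : LinearIndependent L (fun i => ((κ i : (Fin 5 → L) × (Fin 5 → L)))) := by
        rw [Fintype.linearIndependent_iff]
        intro g hg
        have e1 : g 0 • x + g 1 • y = 0 := by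
          have := congrArg Prod.fst hg
          simpa [Fin.sum_univ_four, κ] using this
        have e2 : g 2 • x + g 3 • y = 0 := by
          have := congrArg Prod.snd hg
          simpa [Fin.sum_univ_four, κ] using this
        have key : ∀ a b : L, a • x + b • y = 0 → a = 0 ∧ b = 0 := by
          intro a b hab
          have h1 := congrArg (fun v => r ⬝ᵥ v) hab
          have h2 := congrArg (fun v => s ⬝ᵥ v) hab
          simp [dotProduct_add, hrx, hry, h.s_x, h.s_y] at h1 h2
          exact ⟨h1, h2⟩
        intro i
        fin_cases i
        · exact (key _ _ e1).1
        · exact (key _ _ e1).2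
        · exact (key _ _ e2).1
        · exact (key _ _ e2).2
      exact LinearIndependent.of_comp (LinearMap.ker Φ).subtype h1
    simpa using this.fintype_card_le_finrank
  have hran : 7 ≤ Module.finrank L (LinearMap.range Φ) := by
    have hmem : ∀ k : Fin 7, (Polynomial.X ^ (k : ℕ) : Polynomial L) ∈ LinearMap.range Φ := by
      intro k
      obtain ⟨δ, -, hδ⟩ := h.lift (linForm r ^ (6 - k : ℕ) * linForm s ^ (k : ℕ)) (by
        have h1 := ((linForm_isHomogeneous r).pow (6 - k)).mul
          ((linForm_isHomogeneous s).pow (k : ℕ))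
        rwa [one_mul, one_mul, show 6 - (k : ℕ) + k = 6 by omega] at h1)
      refine ⟨(fun i => -δ (x i), fun i => -δ (y i)), ?_⟩
      apply Polynomial.funext
      intro t
      rw [hΦ]
      have h1 := derivation_eval δ (x + t • y) F
      rw [hF, map_zero, hδ, map_mul, map_pow, map_pow, eval_linForm, eval_linForm, dotProduct_add,
        dotProduct_add, dotProduct_smul, dotProduct_smul, hrx, hry, h.s_x, h.s_y] at h1
      have h2 := hv 0 1 t
      rw [eval_dirDeriv] at h2 ⊢
      simp only [smul_eq_mul, mul_zero, add_zero, one_pow, one_mul, mul_one, zero_add, zero_smul,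
        one_smul, Pi.add_apply, Pi.smul_apply, Pi.zero_apply, map_add,
        Derivation.leibniz] at h1 h2 ⊢
      rw [Polynomial.eval_pow, Polynomial.eval_X]
      have h3 : ∑ i, eval (x + t • y) (pderiv i F) * (δ (x i) + (t * δ (y i) + y i * δ t)) =
          - ∑ i, eval (x + t • y) (pderiv i F) * (-δ (x i) + t * -δ (y i)) +
          (∑ i, eval (x + t • y) (pderiv i F) * y i) * δ t := by
        rw [Finset.sum_mul, ← Finset.sum_neg_distrib, ← Finset.sum_add_distrib]
        exact Finset.sum_congr rfl fun i _ => by ring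
      rw [h3, h2] at h1
      linear_combination h1
    have hli : LinearIndependent L
        (fun k : Fin 7 => (⟨Polynomial.X ^ (k : ℕ), hmem k⟩ : LinearMap.range Φ)) := by
      apply LinearIndependent.of_comp (LinearMap.range Φ).subtype
      have := (Polynomial.basisMonomials L).linearIndependent.comp (fun k : Fin 7 => (k : ℕ))
        Fin.val_injective
      convert this using 1
      ext1 k
      simp [Polynomial.X_pow_eq_monomial]
    simpa using hli.fintype_card_le_finrank
  have := LinearMap.finrank_range_add_finrank_ker Φ
  simp at this
  omega

/-- The form does not vanish at `y`, and it is constant along the line through `y` in the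
direction of `x`. -/
theorem eval_ne_zero_and_eval_eq (h : PencilSystem F x y s 𝔇 Θ P₀ P₁) :
    eval y F ≠ 0 ∧ ∀ t : L, eval (y + t • x) F = eval y F := by
  obtain ⟨v, hv0, hv⟩ := h.exists_dirDeriv_mem
  obtain ⟨a, b, hab⟩ := h.mem_line_of_dirDeriv_mem hv
  obtain ⟨α, β, hne⟩ := h.exists_eval_ne_zero
  have hz : ∀ c e : L, ∀ t : L, eval (c • x + e • y + t • v) F = eval (c • x + e • y) F := by
    intro c e
    refine eval_add_smul_eq fun t => ?_
    have := eval_of_mem_lineIdeal hv (c + t * a) (e + t * b)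
    rw [← this]; congr 2; rw [hab]; ext i; simp; ring
  by_cases hb : b = 0
  · have ha : a ≠ 0 := by
      rintro rfl
      apply hv0; rw [hab, hb]; simp
    have hc : ∀ t : L, eval (y + t • x) F = eval y F := by
      intro t
      have := hz 0 1 (t / a)
      rw [hab, hb] at this
      simp only [zero_smul, one_smul, zero_add, add_zero, smul_smul, div_mul_cancel₀ _ ha] at this
      exact this
    refine ⟨fun h0 => hne ?_, hc⟩
    by_cases hβ : β = 0
    · rw [hβ, zero_smul, add_zero, eval_smul_of_isHomogeneous h.homF, h.eval_x, mul_zero]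
    · have : α • x + β • y = β • (y + (α / β) • x) := by
        rw [smul_add, smul_smul, mul_div_cancel₀ _ hβ, add_comm]
      rw [this, eval_smul_of_isHomogeneous h.homF, hc, h0, mul_zero]
  · exfalso
    apply hne
    have := hz (α - β * a / b) 0 (β / b)
    rw [zero_smul, add_zero, eval_smul_of_isHomogeneous h.homF, h.eval_x, mul_zero] at this
    rw [← this, hab]
    congr 2; ext i; simp; field_simp; ring

end PencilSystem
end PencilSystem

section PolyLE

variable (K : Type*) {L : Type*} [Field K] [Field L] [Algebra (Polynomial K) L]

/-- An element of `L` that comes from a polynomial over `K` of degree at most `n`. -/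
def PolyLE (n : ℕ) (c : L) : Prop :=
  ∃ p : Polynomial K, p.natDegree ≤ n ∧ algebraMap (Polynomial K) L p = c

variable {K}

namespace PolyLE

theorem mono {m n : ℕ} {c : L} (h : PolyLE K m c) (hmn : m ≤ n) : PolyLE K n c := by
  obtain ⟨p, hp, rfl⟩ := h
  exact ⟨p, hp.trans hmn, rfl⟩

theorem zero (n : ℕ) : PolyLE K n (0 : L) := ⟨0, by simp, by simp⟩

theorem one (n : ℕ) : PolyLE K n (1 : L) := ⟨1, by simp, by simp⟩

theorem add {n : ℕ} {a b : L} (ha : PolyLE K n a) (hb : PolyLE K n b) : PolyLE K n (a + b) := by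
  obtain ⟨p, hp, rfl⟩ := ha
  obtain ⟨q, hq, rfl⟩ := hb
  exact ⟨p + q, (Polynomial.natDegree_add_le p q).trans (max_le hp hq), map_add _ _ _⟩

theorem neg {n : ℕ} {a : L} (ha : PolyLE K n a) : PolyLE K n (-a) := by
  obtain ⟨p, hp, rfl⟩ := ha
  exact ⟨-p, by rwa [Polynomial.natDegree_neg], map_neg _ _⟩

theorem sub {n : ℕ} {a b : L} (ha : PolyLE K n a) (hb : PolyLE K n b) : PolyLE K n (a - b) := by
  rw [sub_eq_add_neg]; exact ha.add hb.neg

theorem mul {m n : ℕ} {a b : L} (ha : PolyLE K m a) (hb : PolyLE K n b) :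
    PolyLE K (m + n) (a * b) := by
  obtain ⟨p, hp, rfl⟩ := ha
  obtain ⟨q, hq, rfl⟩ := hb
  exact ⟨p * q, Polynomial.natDegree_mul_le.trans (add_le_add hp hq), map_mul _ _ _⟩

theorem sum {ι : Type*} {n : ℕ} {t : Finset ι} {a : ι → L} (h : ∀ i ∈ t, PolyLE K n (a i)) :
    PolyLE K n (∑ i ∈ t, a i) := by
  classical
  induction t using Finset.induction_on with
  | empty => simpa using zero n
  | insert i t hi ih =>
    rw [Finset.sum_insert hi]
    exact (h i (Finset.mem_insert_self i t)).add (ih fun j hj => h j (Finset.mem_insert_of_mem hj))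

theorem prod {ι : Type*} {b : ι → ℕ} {t : Finset ι} {a : ι → L}
    (h : ∀ i ∈ t, PolyLE K (b i) (a i)) : PolyLE K (∑ i ∈ t, b i) (∏ i ∈ t, a i) := by
  classical
  induction t using Finset.induction_on with
  | empty => simpa using one 0
  | insert i t hi ih =>
    rw [Finset.sum_insert hi, Finset.prod_insert hi]
    exact (h i (Finset.mem_insert_self i t)).mul (ih fun j hj => h j (Finset.mem_insert_of_mem hj))

theorem pow {n : ℕ} {a : L} (ha : PolyLE K n a) (k : ℕ) : PolyLE K (k * n) (a ^ k) := by
  simpa using prod (t := Finset.range k) (b := fun _ => n) (a := fun _ => a) fun _ _ => ha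

theorem det {n : ℕ} {M : Matrix (Fin n) (Fin n) L} {b : Fin n → ℕ}
    (h : ∀ i j, PolyLE K (b i) (M i j)) : PolyLE K (∑ i, b i) M.det := by
  rw [← Matrix.det_transpose, Matrix.det_apply]
  refine sum fun σ _ => ?_
  have h1 : PolyLE K (∑ i, b i) (∏ i, M.transpose (σ i) i) :=
    prod fun i _ => h i (σ i)
  rcases Int.units_eq_one_or (Equiv.Perm.sign σ) with hσ | hσ
  · rw [hσ, one_smul]; exact h1
  · rw [hσ, Units.neg_smul, one_smul]; exact h1.neg

theorem eval {σ : Type*} [Fintype σ] {P : MvPolynomial σ L} {n m : ℕ} (hP : P.IsHomogeneous n)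
    (hK : ∀ s, PolyLE K 0 (coeff s P)) {v : σ → L} (hv : ∀ i, PolyLE K m (v i)) :
    PolyLE K (n * m) (MvPolynomial.eval v P) := by
  rw [eval_eq]
  refine sum fun s hs => ?_
  have hdeg := degree_eq_of_isHomogeneous hP (mem_support_iff.mp hs)
  have h1 : PolyLE K (∑ i ∈ s.support, s i * m) (∏ i ∈ s.support, v i ^ s i) :=
    prod fun i _ => (hv i).pow _
  rw [← Finset.sum_mul, show ∑ i ∈ s.support, s i = n from hdeg] at h1
  simpa using (hK s).mul h1

end PolyLE

/-- A derivation of `L` that preserves `K` and kills the variable. -/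
def IsCoeffwise (K : Type*) {L : Type*} [Field K] [Field L] [Algebra (Polynomial K) L]
    (δ : Derivation ℤ L L) : Prop :=
  (∀ c : L, PolyLE K 0 c → PolyLE K 0 (δ c)) ∧
    δ (algebraMap (Polynomial K) L Polynomial.X) = 0

namespace IsCoeffwise

theorem polyLE {δ : Derivation ℤ L L} (h : IsCoeffwise K δ) {n : ℕ} {c : L}
    (hc : PolyLE K n c) : PolyLE K n (δ c) := by
  obtain ⟨p, hp, rfl⟩ := hc
  have h1 : algebraMap (Polynomial K) L p = ∑ i ∈ Finset.range (n + 1),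
      algebraMap (Polynomial K) L (Polynomial.C (p.coeff i)) *
        (algebraMap (Polynomial K) L Polynomial.X) ^ i := by
    conv_lhs => rw [p.as_sum_range' (n + 1) (by omega)]
    rw [map_sum]
    refine Finset.sum_congr rfl fun i _ => ?_
    rw [← map_pow, ← map_mul, Polynomial.C_mul_X_pow_eq_monomial]
  rw [h1, map_sum]
  refine PolyLE.sum fun i hi => ?_
  have hX : PolyLE K 1 (algebraMap (Polynomial K) L Polynomial.X) :=
    ⟨Polynomial.X, Polynomial.natDegree_X_le, rfl⟩
  rw [Derivation.leibniz, Derivation.leibniz_pow, h.2, smul_zero, smul_zero, smul_zero, zero_add,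
    smul_eq_mul, mul_comm]
  have h2 : PolyLE K 0 (δ (algebraMap (Polynomial K) L (Polynomial.C (p.coeff i)))) :=
    h.1 _ ⟨_, by simp, rfl⟩
  refine (h2.mul (hX.pow i)).mono ?_
  rw [Finset.mem_range] at hi
  omega

theorem lie {δ₁ δ₂ : Derivation ℤ L L} (h₁ : IsCoeffwise K δ₁) (h₂ : IsCoeffwise K δ₂) :
    IsCoeffwise K ⁅δ₁, δ₂⁆ := by
  refine ⟨fun c hc => ?_, ?_⟩
  · rw [Derivation.commutator_apply]
    exact (h₁.1 _ (h₂.1 _ hc)).sub (h₂.1 _ (h₁.1 _ hc))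
  · rw [Derivation.commutator_apply, h₁.2, h₂.2, map_zero, map_zero, sub_zero]

end IsCoeffwise

theorem lie_derivative_isCoeffwise {δ D : Derivation ℤ L L} (h : IsCoeffwise K δ)
    (hD : ∀ p : Polynomial K, D (algebraMap (Polynomial K) L p) =
      algebraMap (Polynomial K) L (Polynomial.derivative p)) :
    IsCoeffwise K ⁅δ, D⁆ := by
  have h0 : ∀ c : L, PolyLE K 0 c → D c = 0 := by
    rintro _ ⟨p, hp, rfl⟩
    rw [hD, Polynomial.eq_C_of_natDegree_le_zero hp]; simp
  refine ⟨fun c hc => ?_, ?_⟩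
  · rw [Derivation.commutator_apply, h0 c hc, h0 _ (h.1 c hc), map_zero, sub_zero]
    exact PolyLE.zero 0
  · rw [Derivation.commutator_apply, h.2, hD]; simp

end PolyLE

section CrossDet

variable {L : Type*} [Field L]

/-- The determinant of five vectors in five-space. -/
noncomputable def det5 (x x' a b v : Fin 5 → L) : L := Matrix.det (Matrix.of ![x, x', a, b, v])

section

variable (x x' : Fin 5 → L)

theorem det5_row2 (a b v a₀ : Fin 5 → L) :
    Matrix.of ![x, x', a, b, v] = (Matrix.of ![x, x', a₀, b, v]).updateRow 2 a := by
  ext i j; fin_cases i <;> simp [Matrix.updateRow_apply]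

theorem det5_row3 (a b v b₀ : Fin 5 → L) :
    Matrix.of ![x, x', a, b, v] = (Matrix.of ![x, x', a, b₀, v]).updateRow 3 b := by
  ext i j; fin_cases i <;> simp [Matrix.updateRow_apply]

theorem det5_row4 (a b v v₀ : Fin 5 → L) :
    Matrix.of ![x, x', a, b, v] = (Matrix.of ![x, x', a, b, v₀]).updateRow 4 v := by
  ext i j; fin_cases i <;> simp [Matrix.updateRow_apply]

theorem det5_add_left (a a' b v : Fin 5 → L) :
    det5 x x' (a + a') b v = det5 x x' a b v + det5 x x' a' b v := by
  rw [det5, det5, det5, det5_row2 x x' (a + a') b v 0, Matrix.det_updateRow_add,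
    ← det5_row2, ← det5_row2]

theorem det5_smul_left (c : L) (a b v : Fin 5 → L) :
    det5 x x' (c • a) b v = c * det5 x x' a b v := by
  rw [det5, det5, det5_row2 x x' (c • a) b v 0, Matrix.det_updateRow_smul, ← det5_row2]

theorem det5_add_right (a b b' v : Fin 5 → L) :
    det5 x x' a (b + b') v = det5 x x' a b v + det5 x x' a b' v := by
  rw [det5, det5, det5, det5_row3 x x' a (b + b') v 0, Matrix.det_updateRow_add,
    ← det5_row3, ← det5_row3]

theorem det5_smul_right (c : L) (a b v : Fin 5 → L) :
    det5 x x' a (c • b) v = c * det5 x x' a b v := by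
  rw [det5, det5, det5_row3 x x' a (c • b) v 0, Matrix.det_updateRow_smul, ← det5_row3]

theorem det5_add_last (a b v v' : Fin 5 → L) :
    det5 x x' a b (v + v') = det5 x x' a b v + det5 x x' a b v' := by
  rw [det5, det5, det5, det5_row4 x x' a b (v + v') 0, Matrix.det_updateRow_add,
    ← det5_row4, ← det5_row4]

theorem det5_smul_last (c : L) (a b v : Fin 5 → L) :
    det5 x x' a b (c • v) = c * det5 x x' a b v := by
  rw [det5, det5, det5_row4 x x' a b (c • v) 0, Matrix.det_updateRow_smul, ← det5_row4]

theorem det5_self (a v : Fin 5 → L) : det5 x x' a a v = 0 :=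
  Matrix.det_zero_of_row_eq (i := 2) (j := 3) (by decide) rfl

theorem det5_left_fst (b v : Fin 5 → L) : det5 x x' x b v = 0 :=
  Matrix.det_zero_of_row_eq (i := 0) (j := 2) (by decide) rfl

theorem det5_left_snd (b v : Fin 5 → L) : det5 x x' x' b v = 0 :=
  Matrix.det_zero_of_row_eq (i := 1) (j := 2) (by decide) rfl

theorem det5_right_fst (a v : Fin 5 → L) : det5 x x' a x v = 0 :=
  Matrix.det_zero_of_row_eq (i := 0) (j := 3) (by decide) rfl

theorem det5_right_snd (a v : Fin 5 → L) : det5 x x' a x' v = 0 :=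
  Matrix.det_zero_of_row_eq (i := 1) (j := 3) (by decide) rfl

end

theorem det5_last_eq_zero {x x' a b : Fin 5 → L} (h : ∀ r, det5 x x' a b (Pi.single r 1) = 0)
    (v : Fin 5 → L) : det5 x x' a b v = 0 := by
  let φ : (Fin 5 → L) →ₗ[L] L :=
    { toFun := det5 x x' a b
      map_add' := det5_add_last x x' a b
      map_smul' := fun c v => by simp [det5_smul_last] }
  have : φ = 0 := by
    refine LinearMap.pi_ext' fun r => ?_
    ext
    simpa [φ] using h r
  exact LinearMap.congr_fun this v

theorem not_linearIndependent_of_det5_eq_zero {x x' a b : Fin 5 → L}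
    (h : ∀ r, det5 x x' a b (Pi.single r 1) = 0) : ¬ LinearIndependent L ![x, x', a, b] := by
  intro hli
  obtain ⟨v, hv⟩ : ∃ v, v ∉ Submodule.span L (Set.range ![x, x', a, b]) := by
    by_contra! hcon
    have h1 : Submodule.span L (Set.range ![x, x', a, b]) = ⊤ := by
      rw [eq_top_iff]; intro v _; exact hcon v
    have h2 := finrank_span_eq_card hli
    rw [h1] at h2
    simp at h2
  have h3 : LinearIndependent L (Matrix.of ![x, x', a, b, v]).row := by
    have h4 := linearIndependent_finSnoc.mpr ⟨hli, hv⟩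
    have h6 : (Matrix.of ![x, x', a, b, v]).row = (Fin.snoc ![x, x', a, b] v : Fin 5 → Fin 5 → L) := by
      ext i j
      fin_cases i <;> rfl
    rw [h6]; exact h4
  have h5 := Matrix.linearIndependent_rows_iff_isUnit.mp h3
  rw [Matrix.isUnit_iff_isUnit_det, isUnit_iff_ne_zero] at h5
  exact h5 (det5_last_eq_zero h v)

/-- Four vectors annihilated by `g` have all their maximal minors proportional to `g`. -/
theorem det5_eq_smul {g x x' a b : Fin 5 → L} (hg : g ≠ 0) (hx : g ⬝ᵥ x = 0) (hx' : g ⬝ᵥ x' = 0)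
    (ha : g ⬝ᵥ a = 0) (hb : g ⬝ᵥ b = 0) :
    ∃ μ : L, ∀ r, det5 x x' a b (Pi.single r 1) = μ * g r := by
  have key : ∀ v, g ⬝ᵥ v = 0 → det5 x x' a b v = 0 := by
    intro v hv
    apply Matrix.exists_mulVec_eq_zero_iff.mp
    refine ⟨g, hg, ?_⟩
    ext i
    rw [Matrix.mulVec, dotProduct_comm]
    fin_cases i
    · exact hx
    · exact hx'
    · exact ha
    · exact hb
    · exact hv
  obtain ⟨k, hk⟩ := Function.ne_iff.mp hg
  refine ⟨det5 x x' a b (Pi.single k 1) / g k, fun r => ?_⟩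
  have h1 := key (g k • Pi.single r 1 + (-g r) • Pi.single k 1) (by
    rw [dotProduct_add, dotProduct_smul, dotProduct_smul, dotProduct_single, dotProduct_single]
    simp; ring)
  rw [det5_add_last, det5_smul_last, det5_smul_last] at h1
  have hk' : g k ≠ 0 := hk
  field_simp
  linear_combination h1

end CrossDet

section RankOne

variable {L U E M : Type*} [Field L] [AddCommGroup U] [AddCommGroup E] [Module L E]
  [AddCommGroup M] [Module L M]

/-- An additive family of linear maps of rank at most one either has all its values in one line,
or consists of multiples of a single linear form. -/
theorem rankOne_dichotomy (β : U →+ (E →ₗ[L] M))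
    (h : ∀ u e e', β u e ≠ 0 → ∃ c : L, β u e' = c • β u e) :
    (∃ n, ∀ u e, β u e ∈ Submodule.span L {n}) ∨
    ∃ (ε : E →ₗ[L] L) (e₀ : E) (u₀ u₁ : U), ε e₀ = 1 ∧ (∀ u e, β u e = ε e • β u e₀) ∧
      LinearIndependent L ![β u₀ e₀, β u₁ e₀] := by
  by_cases h0 : ∀ u e, β u e = 0
  · left
    exact ⟨0, fun u e => by rw [h0]; exact Submodule.zero_mem _⟩
  push Not at h0
  obtain ⟨u₀, e₀, hn⟩ := h0
  -- every value on a vector killed by the reference form lies in the reference line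
  have key : ∀ (u₀ : U) (e₀ : E), β u₀ e₀ ≠ 0 → ∀ e, β u₀ e = 0 → ∀ u,
      ∃ c : L, β u e = c • β u₀ e₀ := by
    intro u₀ e₀ hn e he u
    by_cases hm : β u e = 0
    · exact ⟨0, by rw [hm, zero_smul]⟩
    obtain ⟨a, ha⟩ := h u e e₀ hm
    obtain ⟨b, hb⟩ := h (u + u₀) e e₀ (by simpa [he] using hm)
    simp only [map_add, LinearMap.add_apply, he, add_zero, ha] at hb
    have h1 : β u₀ e₀ = (b - a) • β u e := by rw [sub_smul, ← hb]; abel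
    have h2 : b - a ≠ 0 := by
      intro h3; apply hn; rw [h1, h3, zero_smul]
    exact ⟨(b - a)⁻¹, by rw [h1, smul_smul, inv_mul_cancel₀ h2, one_smul]⟩
  obtain ⟨φ, hφ⟩ : ∃ φ : Module.Dual L M, φ (β u₀ e₀) ≠ 0 := by
    by_contra! hcon
    exact hn ((Module.forall_dual_apply_eq_zero_iff L _).mp hcon)
  let ε : E →ₗ[L] L := (φ (β u₀ e₀))⁻¹ • (φ ∘ₗ β u₀)
  have hε₀ : ε e₀ = 1 := inv_mul_cancel₀ hφ
  have hε : ∀ e, β u₀ e = ε e • β u₀ e₀ := by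
    intro e
    obtain ⟨c, hc⟩ := h u₀ e₀ e hn
    have : ε e = c := by
      change (φ (β u₀ e₀))⁻¹ * φ (β u₀ e) = c
      rw [hc, map_smul, smul_eq_mul]; field_simp
    rw [this, hc]
  by_cases halt : ∀ u, ∃ c : L, β u e₀ = c • β u₀ e₀
  · left
    refine ⟨β u₀ e₀, fun u e => ?_⟩
    obtain ⟨c, hc⟩ := halt u
    obtain ⟨c', hc'⟩ := key u₀ e₀ hn (e - ε e • e₀) (by
      rw [map_sub, map_smul, hε e, sub_self]) u
    rw [map_sub, map_smul, hc, sub_eq_iff_eq_add, smul_smul, ← add_smul] at hc'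
    rw [hc']
    exact Submodule.smul_mem _ _ (Submodule.mem_span_singleton_self _)
  · right
    push Not at halt
    obtain ⟨u₁, hu₁⟩ := halt
    have hn₁ : β u₁ e₀ ≠ 0 := fun h0 => hu₁ 0 (by rw [h0, zero_smul])
    have hind : LinearIndependent L ![β u₀ e₀, β u₁ e₀] := by
      rw [LinearIndependent.pair_iff' hn]
      intro a ha
      exact hu₁ a ha.symm
    have hzero : ∀ m : M, (∃ c : L, m = c • β u₀ e₀) → (∃ c : L, m = c • β u₁ e₀) → m = 0 := by
      rintro m ⟨c, rfl⟩ ⟨c', hc'⟩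
      have := (LinearIndependent.pair_iff.mp hind) c (-c') (by rw [hc', neg_smul, add_neg_cancel])
      rw [this.1, zero_smul]
    refine ⟨ε, e₀, u₀, u₁, hε₀, ?_, hind⟩
    have hker : ∀ e, ε e = 0 → ∀ u, β u e = 0 := by
      intro e he u
      have he₀ : β u₀ e = 0 := by rw [hε, he, zero_smul]
      have he₁ : β u₁ e = 0 := hzero _ (key u₀ e₀ hn e he₀ u₁) (h u₁ e₀ e hn₁)
      exact hzero _ (key u₀ e₀ hn e he₀ u) (key u₁ e₀ hn₁ e he₁ u)
    intro u e
    have := hker (e - ε e • e₀) (by rw [map_sub, map_smul, hε₀]; simp) u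
    rw [map_sub, map_smul, sub_eq_zero] at this
    exact this

end RankOne

section CurveSystem

variable {K L : Type*} [Field K] [CharZero K] [Field L] [CharZero L] [Algebra (Polynomial K) L]

theorem exists_algebraMap_eq_of_span_eq_top {ι : Type*} [Finite ι] {p : ι → Polynomial K}
    (hp : Ideal.span (Set.range p) = ⊤) {c : L}
    (h : ∀ i, ∃ m : Polynomial K, algebraMap (Polynomial K) L m =
      algebraMap (Polynomial K) L (p i) * c) :
    ∃ m : Polynomial K, algebraMap (Polynomial K) L m = c := by
  have := Fintype.ofFinite ι
  choose m hm using h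
  have h1 : (1 : Polynomial K) ∈ Ideal.span (Set.range p) := by rw [hp]; trivial
  rw [Ideal.span, Submodule.mem_span_range_iff_exists_fun] at h1
  obtain ⟨a, ha⟩ := h1
  refine ⟨∑ i, a i * m i, ?_⟩
  have h2 := congrArg (algebraMap (Polynomial K) L) ha
  rw [map_sum, map_one] at h2
  rw [map_sum]
  calc _ = ∑ i, algebraMap (Polynomial K) L (a i • p i) * c := by
        refine Finset.sum_congr rfl fun i _ => ?_
        rw [map_mul, hm, smul_eq_mul, map_mul, mul_assoc]
    _ = c := by rw [← Finset.sum_mul, h2, one_mul]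

variable (L) in
/-- The vector over `L` of a tuple of polynomials. -/
noncomputable def polyVec (f : Fin 5 → Polynomial K) : Fin 5 → L := fun i => algebraMap (Polynomial K) L (f i)

/-- The gradient of a polynomial at a point. -/
noncomputable def gradAt (F : MvPolynomial (Fin 5) L) (x : Fin 5 → L) : Fin 5 → L :=
  fun r => eval x (pderiv r F)

/-- A rational curve on a hypersurface whose coefficients, together with the parameters of
projective transformations, have enough derivations. -/
structure CurveSystem (d e : ℕ) (F : MvPolynomial (Fin 5) L) (f : Fin 5 → Polynomial K)
    (D : Derivation ℤ L L) : Prop where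
  hd : 6 ≤ d
  he : 1 ≤ e
  homF : F.IsHomogeneous d
  coeffF : ∀ s, PolyLE K 0 (coeff s F)
  span_f : Ideal.span (Set.range f) = ⊤
  deg_f : ∀ i, (f i).natDegree ≤ e
  exists_deg : ∃ i, (f i).natDegree = e
  eval_f : eval (polyVec L f) F = 0
  D_apply : ∀ p : Polynomial K, D (algebraMap (Polynomial K) L p) =
    algebraMap (Polynomial K) L (Polynomial.derivative p)
  monomial_lift : ∀ s : Fin 5 →₀ ℕ, s.degree = d →
    ∃ δ : Derivation ℤ L L, IsCoeffwise K δ ∧ coeffDer δ F = monomial s 1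
  linear_lift : ∀ i j, ∃ δ : Derivation ℤ L L, IsCoeffwise K δ ∧
    coeffDer δ F = -(X j * pderiv i F) ∧
    ∀ k, δ (polyVec L f k) = if k = i then polyVec L f j else 0

namespace CurveSystem

variable {d e : ℕ} {F : MvPolynomial (Fin 5) L} {f : Fin 5 → Polynomial K} {D : Derivation ℤ L L}

theorem polyLE_f (h : CurveSystem d e F f D) (i : Fin 5) : PolyLE K e (polyVec L f i) :=
  ⟨f i, h.deg_f i, rfl⟩

theorem eval_add_dot (h : CurveSystem d e F f D) (δ : Derivation ℤ L L) :
    eval (polyVec L f) (coeffDer δ F) + gradAt F (polyVec L f) ⬝ᵥ (fun i => δ (polyVec L f i)) = 0 := by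
  have := derivation_eval δ (polyVec L f) F
  rw [h.eval_f, map_zero] at this
  exact this.symm

theorem polyLE_grad (h : CurveSystem d e F f D) (r : Fin 5) :
    PolyLE K ((d - 1) * e) (gradAt F (polyVec L f) r) := by
  refine PolyLE.eval h.homF.pderiv (fun s => ?_) h.polyLE_f
  rw [coeff_pderiv]
  have h1 : PolyLE K 0 (((s r + 1 : ℕ)) : L) := ⟨((s r + 1 : ℕ) : Polynomial K), (Polynomial.natDegree_natCast _).le, by simp⟩
  have h2 := (h.coeffF (s + Finsupp.single r 1)).mul h1
  simpa using h2

theorem exists_grad_poly [IsFractionRing (Polynomial K) L] (h : CurveSystem d e F f D) :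
    ∃ p : Fin 5 → Polynomial K, (∀ r, algebraMap (Polynomial K) L (p r) = gradAt F (polyVec L f) r) ∧
      Ideal.span (Set.range p) = ⊤ ∧ ∃ r, (d - 1) * e ≤ (p r).natDegree := by
  have hinj := IsFractionRing.injective (Polynomial K) L
  choose p hp1 hp using h.polyLE_grad
  have key : ∀ i, ∃ q : Fin 5 → Polynomial K, (∀ r, (q r).natDegree ≤ e) ∧
      f i ^ d = - ∑ r, p r * q r := by
    intro i
    obtain ⟨δ, hδ, hF⟩ := h.monomial_lift (Finsupp.single i d) (by simp)
    choose q hq1 hq using fun r => hδ.polyLE (h.polyLE_f r)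
    refine ⟨q, hq1, hinj ?_⟩
    have h1 := h.eval_add_dot δ
    rw [hF, eval_monomial, Finsupp.prod_single_index (h := fun n e => polyVec L f n ^ e) (pow_zero _),
      one_mul] at h1
    rw [map_neg, map_sum, map_pow]
    simp only [map_mul, hp, hq]
    exact eq_neg_of_add_eq_zero_left h1
  refine ⟨p, hp, ?_, ?_⟩
  · have h1 := Ideal.span_pow_eq_top (Set.range f) h.span_f d
    rw [eq_top_iff, ← h1, Ideal.span_le]
    rintro _ ⟨_, ⟨i, rfl⟩, rfl⟩
    obtain ⟨q, -, hq⟩ := key i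
    simp only [hq, SetLike.mem_coe]
    refine neg_mem (sum_mem fun r _ => Ideal.mul_mem_right _ _ (Ideal.subset_span ⟨r, rfl⟩))
  · by_contra! hcon
    obtain ⟨i, hi⟩ := h.exists_deg
    obtain ⟨q, hq1, hq⟩ := key i
    have h1 : (f i ^ d).natDegree = d * e := by rw [Polynomial.natDegree_pow, hi]
    have hd := h.hd
    have he := h.he
    have h2 : (f i ^ d).natDegree ≤ (d - 1) * e - 1 + e := by
      rw [hq, Polynomial.natDegree_neg]
      refine Polynomial.natDegree_sum_le_of_forall_le _ _ fun r _ => ?_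
      refine Polynomial.natDegree_mul_le.trans (add_le_add ?_ (hq1 r))
      have := hcon r; omega
    obtain ⟨k, rfl⟩ : ∃ k, d = k + 1 := ⟨d - 1, by omega⟩
    simp only [Nat.add_sub_cancel] at h2
    rw [h1, add_mul, one_mul] at h2
    have : 1 ≤ k * e := Nat.mul_pos (by omega) he
    omega

theorem grad_ne_zero [IsFractionRing (Polynomial K) L] (h : CurveSystem d e F f D) :
    gradAt F (polyVec L f) ≠ 0 := by
  obtain ⟨p, hp, -, r, hr⟩ := h.exists_grad_poly
  intro h0
  have h1 := hp r
  rw [h0, Pi.zero_apply, FaithfulSMul.algebraMap_eq_zero_iff] at h1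
  rw [h1, Polynomial.natDegree_zero] at hr
  have := Nat.mul_pos (show 0 < d - 1 by have := h.hd; omega) h.he
  omega

/-- A multiple of the gradient with polynomial entries is a polynomial multiple. -/
theorem exists_poly_of_mul_grad [IsFractionRing (Polynomial K) L] (h : CurveSystem d e F f D) {n : ℕ}
    {μ : L} (hμ : ∀ r, PolyLE K n (μ * gradAt F (polyVec L f) r)) :
    ∃ m : Polynomial K, algebraMap (Polynomial K) L m = μ ∧
      (m ≠ 0 → m.natDegree + (d - 1) * e ≤ n) := by
  obtain ⟨p, hp, hspan, r, hr⟩ := h.exists_grad_poly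
  have hinj := IsFractionRing.injective (Polynomial K) L
  obtain ⟨m, hm⟩ := exists_algebraMap_eq_of_span_eq_top (L := L) hspan (c := μ) (fun r => by
    obtain ⟨q, -, hq⟩ := hμ r
    exact ⟨q, by rw [hq, hp, mul_comm]⟩)
  refine ⟨m, hm, fun hm0 => ?_⟩
  obtain ⟨q, hq1, hq⟩ := hμ r
  rw [← hm, ← hp, ← map_mul] at hq
  have h1 := hinj hq
  have hp0 : p r ≠ 0 := by
    intro h0
    rw [h0, Polynomial.natDegree_zero] at hr
    have := Nat.mul_pos (show 0 < d - 1 by have := h.hd; omega) h.he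
    omega
  rw [h1, Polynomial.natDegree_mul hm0 hp0] at hq1
  omega

theorem eq_zero_of_mul_grad [IsFractionRing (Polynomial K) L] (h : CurveSystem d e F f D) {n : ℕ}
    (hn : n < (d - 1) * e) {μ : L} (hμ : ∀ r, PolyLE K n (μ * gradAt F (polyVec L f) r)) : μ = 0 := by
  obtain ⟨m, rfl, hm⟩ := h.exists_poly_of_mul_grad hμ
  by_contra h0
  have := hm (fun h1 => h0 (by rw [h1, map_zero]))
  omega

/-- The tangent vector of the curve. -/
theorem D_polyVec (h : CurveSystem d e F f D) (i : Fin 5) :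
    D (polyVec L f i) = polyVec L (fun i => Polynomial.derivative (f i)) i := h.D_apply _

theorem polyLE_derivative (f : Fin 5 → Polynomial K) {e : ℕ} (he : ∀ i, (f i).natDegree ≤ e) (i : Fin 5) :
    PolyLE K (e - 1) (polyVec L (fun i => Polynomial.derivative (f i)) i) :=
  ⟨_, (Polynomial.natDegree_derivative_le _).trans (Nat.sub_le_sub_right (he i) 1), rfl⟩

theorem coeffDer_D (h : CurveSystem d e F f D) : coeffDer D F = 0 := by
  ext s
  rw [coeff_coeffDer, coeff_zero]
  obtain ⟨p, hp, hps⟩ := h.coeffF s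
  rw [← hps, h.D_apply, Polynomial.eq_C_of_natDegree_le_zero hp]; simp

theorem grad_dot_derivative (h : CurveSystem d e F f D) : gradAt F (polyVec L f) ⬝ᵥ
    polyVec L (fun i => Polynomial.derivative (f i)) = 0 := by
  have := h.eval_add_dot D
  rw [h.coeffDer_D, map_zero, zero_add] at this
  rw [← this]
  congr 1
  ext i
  exact (h.D_polyVec i).symm

theorem grad_dot_self (h : CurveSystem d e F f D) :
    gradAt F (polyVec L f) ⬝ᵥ polyVec L f = 0 := by
  have h1 := congrArg (eval (polyVec L f)) h.homF.sum_X_mul_pderiv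
  rw [map_sum, map_nsmul, h.eval_f, smul_zero] at h1
  rw [← h1]
  refine Finset.sum_congr rfl fun i _ => ?_
  rw [map_mul, eval_X, mul_comm]; rfl

theorem exists_ne_zero (h : CurveSystem d e F f D) : ∃ k, f k ≠ 0 := by
  obtain ⟨i, hi⟩ := h.exists_deg
  refine ⟨i, fun h0 => ?_⟩
  rw [h0, Polynomial.natDegree_zero] at hi
  have := h.he; omega

theorem linearIndependent_tangent [IsFractionRing (Polynomial K) L] (h : CurveSystem d e F f D) :
    LinearIndependent L ![polyVec L f, polyVec L (fun i => Polynomial.derivative (f i))] := by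
  have hinj := IsFractionRing.injective (Polynomial K) L
  obtain ⟨i, hi⟩ := h.exists_deg
  have hi0 : f i ≠ 0 := by
    intro h0; rw [h0, Polynomial.natDegree_zero] at hi
    have := h.he; omega
  have hx : polyVec L f ≠ 0 := by
    intro h0
    have := congrFun h0 i
    exact hi0 ((FaithfulSMul.algebraMap_eq_zero_iff _ L).mp this)
  rw [LinearIndependent.pair_iff' hx]
  intro a ha
  have hc : ∀ j, a * algebraMap (Polynomial K) L (f j) =
      algebraMap (Polynomial K) L (Polynomial.derivative (f j)) := fun j => congrFun ha j
  obtain ⟨m, rfl⟩ := exists_algebraMap_eq_of_span_eq_top (L := L) h.span_f (c := a)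
    (fun j => ⟨_, by rw [← hc j, mul_comm]⟩)
  have h1 := hinj ((map_mul _ _ _).trans (hc i))
  have h2 : Polynomial.derivative (f i) ≠ 0 := by
    intro h3
    have := Polynomial.natDegree_eq_zero_of_derivative_eq_zero h3
    have := h.he; omega
  have h3 : (f i) ∣ Polynomial.derivative (f i) := ⟨m, by rw [← h1, mul_comm]⟩
  have h4 := Polynomial.natDegree_le_of_dvd h3 h2
  have h5 := Polynomial.natDegree_derivative_le (f i)
  have := h.he
  omega

/-- The degree bound for the minors of the curve, its tangent and two further vectors. -/
theorem polyLE_det5 (h : CurveSystem d e F f D) {m n : ℕ} {a b : Fin 5 → L}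
    (ha : ∀ i, PolyLE K m (a i)) (hb : ∀ i, PolyLE K n (b i)) (r : Fin 5) :
    PolyLE K (2 * e - 1 + m + n) (det5 (polyVec L f)
      (polyVec L (fun i => Polynomial.derivative (f i))) a b (Pi.single r 1)) := by
  have h1 : PolyLE K (∑ i, ![e, e - 1, m, n, 0] i) (det5 (polyVec L f)
      (polyVec L (fun i => Polynomial.derivative (f i))) a b (Pi.single r 1)) := by
    refine PolyLE.det fun i j => ?_
    fin_cases i
    · exact h.polyLE_f j
    · exact polyLE_derivative f h.deg_f j
    · exact ha j
    · exact hb j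
    · change PolyLE K 0 ((Pi.single r 1 : Fin 5 → L) j)
      rw [Pi.single_apply]
      split_ifs
      · exact PolyLE.one 0
      · exact PolyLE.zero 0
  refine h1.mono ?_
  have := h.he
  simp [Fin.sum_univ_five]
  omega

end CurveSystem
end CurveSystem

section PointIdeal

variable {L : Type*} [Field L]

/-- The degree `n` part of the ideal of the point `x`. -/
noncomputable def pointIdeal (x : Fin 5 → L) (n : ℕ) : Submodule L (MvPolynomial (Fin 5) L) :=
  Submodule.span L {P | ∃ (w : Fin 5 → L) (t : Fin 5 →₀ ℕ),
    w ⬝ᵥ x = 0 ∧ t.degree + 1 = n ∧ P = monomial t 1 * linForm w}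

theorem eval_of_mem_pointIdeal {x : Fin 5 → L} {n : ℕ} {P : MvPolynomial (Fin 5) L}
    (hP : P ∈ pointIdeal x n) : eval x P = 0 := by
  rw [pointIdeal] at hP
  induction hP using Submodule.span_induction with
  | mem P hP =>
    obtain ⟨w, t, hx, -, rfl⟩ := hP
    simp [hx]
  | zero => simp
  | add P Q _ _ hP hQ => rw [map_add, hP, hQ, add_zero]
  | smul a P _ hP => rw [smul_eval, hP, mul_zero]

theorem pointIdeal_mul_X {x : Fin 5 → L} {n : ℕ} {P : MvPolynomial (Fin 5) L}
    (hP : P ∈ pointIdeal x n) (j : Fin 5) : P * X j ∈ pointIdeal x (n + 1) := by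
  rw [pointIdeal] at hP
  induction hP using Submodule.span_induction with
  | mem P hP =>
    obtain ⟨w, t, hx, ht, rfl⟩ := hP
    refine Submodule.subset_span ⟨w, t + Finsupp.single j 1, hx, by simp [ht], ?_⟩
    rw [mul_right_comm, X, monomial_mul, one_mul]
  | zero => simp
  | add P Q _ _ hP hQ => rw [add_mul]; exact add_mem hP hQ
  | smul a P _ hP => rw [smul_mul_assoc]; exact Submodule.smul_mem _ _ hP

theorem monomial_mem_pointIdeal_sup {x : Fin 5 → L} {k : Fin 5} (hk : x k ≠ 0) (n : ℕ)
    (t : Fin 5 →₀ ℕ) (ht : t.degree = n) :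
    monomial t 1 ∈ pointIdeal x n ⊔ Submodule.span L {X k ^ n} := by
  induction n generalizing t with
  | zero =>
    rw [Finsupp.degree_eq_zero_iff] at ht
    subst ht
    refine Submodule.mem_sup_right (Submodule.subset_span ?_)
    simp
  | succ n ih =>
    obtain ⟨j, hj⟩ : ∃ j, t j ≠ 0 := by
      by_contra! hcon
      have : t = 0 := by ext j; exact hcon j
      subst this; simp at ht
    have hle : Finsupp.single j 1 ≤ t := by
      rw [Finsupp.single_le_iff]; omega
    have hdeg : (t - Finsupp.single j 1).degree = n := by
      have h1 : (t - Finsupp.single j 1 + Finsupp.single j 1).degree = n + 1 := by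
        rw [tsub_add_cancel_of_le hle, ht]
      rw [map_add, Finsupp.degree_single] at h1
      omega
    have h3 : monomial t (1 : L) = monomial (t - Finsupp.single j 1) 1 * X j := by
      rw [X, monomial_mul, tsub_add_cancel_of_le hle, one_mul]
    rw [h3]
    obtain ⟨P, hP, Q, hQ, hPQ⟩ := Submodule.mem_sup.mp (ih _ hdeg)
    obtain ⟨c, rfl⟩ := Submodule.mem_span_singleton.mp hQ
    rw [← hPQ, add_mul]
    refine add_mem (Submodule.mem_sup_left (pointIdeal_mul_X hP j)) ?_
    rw [smul_mul_assoc]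
    refine Submodule.smul_mem _ _ ?_
    have hX : (X j : MvPolynomial (Fin 5) L) =
        linForm (Pi.single j 1 - (x j / x k) • Pi.single k 1) + (x j / x k) • X k := by
      rw [sub_eq_add_neg, ← neg_smul, linForm_add, linForm_smul, linForm_single, linForm_single,
        neg_smul, neg_add_cancel_right]
    rw [hX, mul_add, mul_smul_comm]
    refine add_mem (Submodule.mem_sup_left (Submodule.subset_span
      ⟨Pi.single j 1 - (x j / x k) • Pi.single k 1, Finsupp.single k n, ?_, by simp, ?_⟩))
      (Submodule.mem_sup_right (Submodule.smul_mem _ _ (Submodule.subset_span ?_)))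
    · rw [sub_dotProduct, smul_dotProduct, single_dotProduct, single_dotProduct]
      simp; field_simp; simp
    · rw [X_pow_eq_monomial]
    · rw [pow_succ]; rfl

theorem mem_pointIdeal {x : Fin 5 → L} (hx : x ≠ 0) {n : ℕ} {G : MvPolynomial (Fin 5) L}
    (hG : G.IsHomogeneous n) (h0 : eval x G = 0) : G ∈ pointIdeal x n := by
  obtain ⟨k, hk⟩ := Function.ne_iff.mp hx
  have h1 : G ∈ pointIdeal x n ⊔ Submodule.span L {X k ^ n} := by
    rw [G.as_sum]
    refine Submodule.sum_mem _ fun t ht => ?_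
    have h1 : monomial t (coeff t G) = coeff t G • monomial t 1 := by
      rw [smul_monomial, smul_eq_mul, mul_one]
    rw [h1]
    exact Submodule.smul_mem _ _ (monomial_mem_pointIdeal_sup hk n t
      (degree_eq_of_isHomogeneous hG (mem_support_iff.mp ht)))
  obtain ⟨P, hP, Q, hQ, hPQ⟩ := Submodule.mem_sup.mp h1
  obtain ⟨c, rfl⟩ := Submodule.mem_span_singleton.mp hQ
  have h2 := congrArg (eval x) hPQ
  rw [map_add, eval_of_mem_pointIdeal hP, smul_eval, map_pow, eval_X, h0, zero_add] at h2
  have hc : c = 0 := (mul_eq_zero.mp h2).resolve_right (pow_ne_zero _ hk)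
  rw [← hPQ, hc, zero_smul, add_zero]
  exact hP

end PointIdeal

section Det5Sum

variable {L : Type*} [Field L]

theorem det5_sum_left {ι : Type*} (t : Finset ι) (x x' : Fin 5 → L) (a : ι → Fin 5 → L)
    (b v : Fin 5 → L) : det5 x x' (∑ i ∈ t, a i) b v = ∑ i ∈ t, det5 x x' (a i) b v := by
  classical
  induction t using Finset.induction_on with
  | empty => simpa using det5_smul_left x x' 0 0 b v
  | insert i t hi ih => rw [Finset.sum_insert hi, Finset.sum_insert hi, det5_add_left, ih]

theorem det5_sum_right {ι : Type*} (t : Finset ι) (x x' a : Fin 5 → L) (b : ι → Fin 5 → L)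
    (v : Fin 5 → L) : det5 x x' a (∑ i ∈ t, b i) v = ∑ i ∈ t, det5 x x' a (b i) v := by
  classical
  induction t using Finset.induction_on with
  | empty => simpa using det5_smul_right x x' 0 a 0 v
  | insert i t hi ih => rw [Finset.sum_insert hi, Finset.sum_insert hi, det5_add_right, ih]

theorem mem_span_of_det5_eq_zero {x x' a b : Fin 5 → L} (hli : LinearIndependent L ![x, x'])
    (ha : a ∉ Submodule.span L {x, x'}) (h : ∀ r, det5 x x' a b (Pi.single r 1) = 0) :
    b ∈ Submodule.span L {x, x', a} := by
  have h1 : LinearIndependent L ![x, x', a] := by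
    have h4 := linearIndependent_finSnoc.mpr ⟨hli, (by
      rwa [Matrix.range_cons, Matrix.range_cons, Matrix.range_empty, Set.union_empty,
        Set.singleton_union] : a ∉ Submodule.span L (Set.range ![x, x']))⟩
    have h6 : ![x, x', a] = (Fin.snoc ![x, x'] a : Fin 3 → Fin 5 → L) := by
      ext i j; fin_cases i <;> rfl
    rw [h6]; exact h4
  by_contra hb
  refine not_linearIndependent_of_det5_eq_zero h ?_
  have h4 := linearIndependent_finSnoc.mpr ⟨h1, (by
      rwa [Matrix.range_cons, Matrix.range_cons, Matrix.range_cons, Matrix.range_empty,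
        Set.union_empty, Set.singleton_union, Set.singleton_union] :
          b ∉ Submodule.span L (Set.range ![x, x', a]))⟩
  have h6 : ![x, x', a, b] = (Fin.snoc ![x, x', a] b : Fin 4 → Fin 5 → L) := by
    ext i j; fin_cases i <;> rfl
  rw [h6]; exact h4

theorem not_forall_mem_span_triple {g : Fin 5 → L} (hg : g ≠ 0) (x x' a : Fin 5 → L) :
    ¬ ∀ v, g ⬝ᵥ v = 0 → v ∈ Submodule.span L {x, x', a} := by
  intro hall
  obtain ⟨φ, hφ⟩ : ∃ φ : Module.Dual L (Fin 5 → L), ∀ v, φ v = g ⬝ᵥ v :=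
    ⟨dotProductBilin L L g, fun v => rfl⟩
  have hφ0 : φ ≠ 0 := by
    intro h0
    apply hg
    ext i
    have := hφ (Pi.single i 1)
    rw [h0, dotProduct_single] at this
    simpa using this.symm
  have h1 := Module.Dual.finrank_ker_add_one_of_ne_zero hφ0
  have h2 : LinearMap.ker φ ≤ Submodule.span L {x, x', a} := fun v hv =>
    hall v (by rw [← hφ]; exact hv)
  have h3 := Submodule.finrank_mono h2
  classical
  have h5 := finrank_span_finset_le_card (R := L) ({x, x', a} : Finset (Fin 5 → L))
  have h6 : ({x, x', a} : Finset (Fin 5 → L)).card ≤ 3 := Finset.card_le_three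
  simp only [Finset.coe_insert, Finset.coe_singleton] at h5
  simp [Set.finrank] at h1 h5
  omega

end Det5Sum

section TangentLift

variable {K L : Type*} [Field K] [CharZero K] [Field L] [CharZero L] [Algebra (Polynomial K) L]

/-- A linear map sending a form of degree `d` to a first order deformation of the curve. -/
structure IsTangentLift (K : Type*) {L : Type*} [Field K] [Field L] [Algebra (Polynomial K) L]
    (d e : ℕ) (g x : Fin 5 → L)
    (H : MvPolynomial (Fin 5) L →ₗ[L] (Fin 5 → L)) : Prop where
  eval_add : ∀ G : MvPolynomial (Fin 5) L, G.IsHomogeneous d → eval x G + g ⬝ᵥ H G = 0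
  polyLE : ∀ G : MvPolynomial (Fin 5) L, G.IsHomogeneous d → (∀ s, PolyLE K 0 (coeff s G)) →
    ∀ i, PolyLE K e (H G i)

namespace CurveSystem

variable {d e : ℕ} {F : MvPolynomial (Fin 5) L} {f : Fin 5 → Polynomial K} {D : Derivation ℤ L L}

theorem exists_isTangentLift (h : CurveSystem d e F f D) :
    ∃ H, IsTangentLift K d e (gradAt F (polyVec L f)) (polyVec L f) H := by
  classical
  choose δ hδ hF using h.monomial_lift
  let b : (Fin 5 →₀ ℕ) → (Fin 5 → L) := fun s =>
    if hs : s.degree = d then fun i => δ s hs (polyVec L f i) else 0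
  obtain ⟨H, hH⟩ : ∃ H : MvPolynomial (Fin 5) L →ₗ[L] (Fin 5 → L),
      ∀ s, H (monomial s 1) = b s := by
    refine ⟨(basisMonomials (Fin 5) L).constr L b, fun s => ?_⟩
    have h1 := (basisMonomials (Fin 5) L).constr_basis L b s
    rwa [coe_basisMonomials] at h1
  have hsum : ∀ G : MvPolynomial (Fin 5) L, G = ∑ s ∈ G.support, coeff s G • monomial s 1 := by
    intro G
    conv_lhs => rw [G.as_sum]
    refine Finset.sum_congr rfl fun s _ => ?_
    rw [smul_monomial, smul_eq_mul, mul_one]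
  refine ⟨H, ⟨fun G hG => ?_, fun G hG hK i => ?_⟩⟩
  · rw [hsum G, map_sum, map_sum, dotProduct_sum, ← Finset.sum_add_distrib]
    refine Finset.sum_eq_zero fun s hs => ?_
    have hd := degree_eq_of_isHomogeneous hG (mem_support_iff.mp hs)
    rw [smul_eval, map_smul, dotProduct_smul, smul_eq_mul, ← mul_add, hH]
    have h1 := h.eval_add_dot (δ s hd)
    rw [hF] at h1
    simp only [b, dif_pos hd]
    rw [h1, mul_zero]
  · rw [hsum G, map_sum, Finset.sum_apply]
    refine PolyLE.sum fun s hs => ?_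
    have hd := degree_eq_of_isHomogeneous hG (mem_support_iff.mp hs)
    rw [map_smul, hH, Pi.smul_apply, smul_eq_mul]
    simp only [b, dif_pos hd]
    simpa using (hK s).mul ((hδ s hd).polyLE (h.polyLE_f i))

variable {H : MvPolynomial (Fin 5) L →ₗ[L] (Fin 5 → L)}

theorem exists_polyVec_ne_zero [IsFractionRing (Polynomial K) L] (h : CurveSystem d e F f D) :
    ∃ k, polyVec L f k ≠ 0 := by
  obtain ⟨k, hk⟩ := h.exists_ne_zero
  exact ⟨k, fun h0 => hk ((FaithfulSMul.algebraMap_eq_zero_iff _ L).mp h0)⟩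

/-- The lift of a product with a linear form through the curve, in terms of lifts of products
with variables. -/
theorem lift_mul_linForm {x w : Fin 5 → L} (hw : w ⬝ᵥ x = 0) (P : MvPolynomial (Fin 5) L)
    (k : Fin 5) : x k • H (P * linForm w) = ∑ i, w i • (x k • H (P * X i) - x i • H (P * X k)) := by
  have h1 : P * linForm w = ∑ i, w i • (P * X i) := by
    rw [linForm, Finset.mul_sum]
    refine Finset.sum_congr rfl fun i _ => ?_
    rw [← mul_smul_comm, C_mul']
  have h2 : ∑ i, w i • x i • H (P * X k) = 0 := by
    simp only [smul_smul]
    rw [← Finset.sum_smul]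
    change (w ⬝ᵥ x) • _ = _
    rw [hw, zero_smul]
  simp only [smul_sub, Finset.sum_sub_distrib]
  rw [h2, sub_zero, h1, map_sum, Finset.smul_sum]
  refine Finset.sum_congr rfl fun i _ => ?_
  rw [map_smul, smul_comm]

theorem coeff_mul_X_polyLE {P : MvPolynomial (Fin 5) L} (hK : ∀ s, PolyLE K 0 (coeff s P))
    (i : Fin 5) (s : Fin 5 →₀ ℕ) : PolyLE K 0 (coeff s (P * X i)) := by
  classical
  rw [coeff_mul_X']
  split_ifs
  · exact hK _
  · exact PolyLE.zero 0

theorem isHomogeneous_mul_X (h : CurveSystem d e F f D)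
    {P : MvPolynomial (Fin 5) L} (hP : P.IsHomogeneous (d - 1))
    (i : Fin 5) : (P * X i).IsHomogeneous d := by
  have := hP.mul (isHomogeneous_X L i)
  rwa [Nat.sub_add_cancel (by have := h.hd; omega)] at this

theorem isHomogeneous_mul_linForm (h : CurveSystem d e F f D)
    {P : MvPolynomial (Fin 5) L} (hP : P.IsHomogeneous (d - 1))
    (w : Fin 5 → L) : (P * linForm w).IsHomogeneous d := by
  have := hP.mul (linForm_isHomogeneous w)
  rwa [Nat.sub_add_cancel (by have := h.hd; omega)] at this

theorem grad_dot_lift_mul_linForm (h : CurveSystem d e F f D)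
    (hH : IsTangentLift K d e (gradAt F (polyVec L f)) (polyVec L f) H)
    {P : MvPolynomial (Fin 5) L} (hP : P.IsHomogeneous (d - 1))
    {w : Fin 5 → L} (hw : w ⬝ᵥ polyVec L f = 0) :
    gradAt F (polyVec L f) ⬝ᵥ H (P * linForm w) = 0 := by
  have := hH.eval_add _ (isHomogeneous_mul_linForm h hP w)
  rwa [map_mul, eval_linForm, hw, mul_zero, zero_add] at this

theorem grad_dot_minor (h : CurveSystem d e F f D)
    (hH : IsTangentLift K d e (gradAt F (polyVec L f)) (polyVec L f) H)
    {P : MvPolynomial (Fin 5) L} (hP : P.IsHomogeneous (d - 1)) (i k : Fin 5) :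
    gradAt F (polyVec L f) ⬝ᵥ
      (polyVec L f k • H (P * X i) - polyVec L f i • H (P * X k)) = 0 := by
  have h1 := hH.eval_add _ (isHomogeneous_mul_X h hP i)
  have h2 := hH.eval_add _ (isHomogeneous_mul_X h hP k)
  rw [map_mul, eval_X] at h1 h2
  rw [dotProduct_sub, dotProduct_smul, dotProduct_smul, smul_eq_mul, smul_eq_mul]
  linear_combination (polyVec L f k) * h1 - (polyVec L f i) * h2

theorem polyLE_minor (h : CurveSystem d e F f D)
    (hH : IsTangentLift K d e (gradAt F (polyVec L f)) (polyVec L f) H)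
    {P : MvPolynomial (Fin 5) L} (hP : P.IsHomogeneous (d - 1))
    (hK : ∀ s, PolyLE K 0 (coeff s P)) (i k r : Fin 5) :
    PolyLE K (2 * e) ((polyVec L f k • H (P * X i) - polyVec L f i • H (P * X k)) r) := by
  have h1 : ∀ i, PolyLE K e (H (P * X i) r) := fun i =>
    hH.polyLE _ (isHomogeneous_mul_X h hP i) (coeff_mul_X_polyLE hK i) r
  rw [two_mul]
  exact ((h.polyLE_f k).mul (h1 i)).sub ((h.polyLE_f i).mul (h1 k))

theorem det5_lift_eq_zero (h : CurveSystem d e F f D)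
    (hH : IsTangentLift K d e (gradAt F (polyVec L f)) (polyVec L f) H)
    [IsFractionRing (Polynomial K) L] {P : MvPolynomial (Fin 5) L}
    (hP : P.IsHomogeneous (d - 1)) (hK : ∀ s, PolyLE K 0 (coeff s P)) {w w' : Fin 5 → L}
    (hw : w ⬝ᵥ polyVec L f = 0) (hw' : w' ⬝ᵥ polyVec L f = 0) (r : Fin 5) :
    det5 (polyVec L f) (polyVec L (fun i => Polynomial.derivative (f i)))
      (H (P * linForm w)) (H (P * linForm w')) (Pi.single r 1) = 0 := by
  obtain ⟨k, hk⟩ := h.exists_polyVec_ne_zero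
  set x := polyVec L f with hx
  set x' := polyVec L (fun i => Polynomial.derivative (f i)) with hx'
  have hA : ∀ i r, PolyLE K e (H (P * X i) r) := fun i r =>
    hH.polyLE _ (isHomogeneous_mul_X h hP i) (coeff_mul_X_polyLE hK i) r
  have key : ∀ i j r, det5 x x' (x k • H (P * X i) - x i • H (P * X k))
      (x k • H (P * X j) - x j • H (P * X k)) (Pi.single r 1) = 0 := by
    intro i j
    obtain ⟨μ, hμ⟩ := det5_eq_smul (x := x) (x' := x') h.grad_ne_zero h.grad_dot_self h.grad_dot_derivative
      (grad_dot_minor h hH hP i k) (grad_dot_minor h hH hP j k)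
    have hexp : ∀ r, det5 x x' (x k • H (P * X i) - x i • H (P * X k))
        (x k • H (P * X j) - x j • H (P * X k)) (Pi.single r 1) =
        x k * (x k * det5 x x' (H (P * X i)) (H (P * X j)) (Pi.single r 1)
          - x j * det5 x x' (H (P * X i)) (H (P * X k)) (Pi.single r 1)
          - x i * det5 x x' (H (P * X k)) (H (P * X j)) (Pi.single r 1)) := by
      intro r
      simp only [sub_eq_add_neg, ← neg_smul, det5_add_left, det5_add_right, det5_smul_left,
        det5_smul_right, det5_self]
      ring
    have h0 : μ / x k = 0 := by
      refine h.eq_zero_of_mul_grad (n := e + (2 * e - 1 + e + e)) ?_ fun r => ?_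
      · have h1 := h.hd
        have h2 := h.he
        have : 5 * e ≤ (d - 1) * e := Nat.mul_le_mul_right e (by omega)
        omega
      · have h1 : μ / x k * gradAt F x r =
            x k * det5 x x' (H (P * X i)) (H (P * X j)) (Pi.single r 1)
          - x j * det5 x x' (H (P * X i)) (H (P * X k)) (Pi.single r 1)
          - x i * det5 x x' (H (P * X k)) (H (P * X j)) (Pi.single r 1) := by
          have h2 := (hexp r).symm.trans (hμ r)
          field_simp
          rw [← h2]
        rw [h1]
        exact (((h.polyLE_f k).mul (h.polyLE_det5 (hA i) (hA j) r)).sub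
          ((h.polyLE_f j).mul (h.polyLE_det5 (hA i) (hA k) r))).sub
          ((h.polyLE_f i).mul (h.polyLE_det5 (hA k) (hA j) r))
    have hμ0 : μ = 0 := by
      rcases div_eq_zero_iff.mp h0 with h1 | h1
      · exact h1
      · exact absurd h1 hk
    intro r
    rw [hμ r, hμ0, zero_mul]
  have h1 : x k * (x k * det5 x x' (H (P * linForm w)) (H (P * linForm w')) (Pi.single r 1)) = 0 := by
    rw [← det5_smul_right, ← det5_smul_left, lift_mul_linForm hw P k, lift_mul_linForm hw' P k,
      det5_sum_left]
    refine Finset.sum_eq_zero fun i _ => ?_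
    rw [det5_sum_right]
    refine Finset.sum_eq_zero fun j _ => ?_
    rw [det5_smul_left, det5_smul_right, key, mul_zero, mul_zero]
  exact (mul_eq_zero.mp ((mul_eq_zero.mp h1).resolve_left hk)).resolve_left hk

/-- Every vector tangent to the hypersurface is a combination of low degree tangent fields and lifts
of forms vanishing on the curve. -/
theorem mem_of_grad_dot_eq_zero (h : CurveSystem d e F f D)
    (hH : IsTangentLift K d e (gradAt F (polyVec L f)) (polyVec L f) H)
    [IsFractionRing (Polynomial K) L] {W : Submodule L (Fin 5 → L)}
    (hW₁ : ∀ z : Fin 5 → L, gradAt F (polyVec L f) ⬝ᵥ z = 0 → (∀ i, PolyLE K e (z i)) → z ∈ W)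
    (hW₂ : ∀ (t : Fin 5 →₀ ℕ) (w : Fin 5 → L), t.degree = d - 1 → w ⬝ᵥ polyVec L f = 0 →
      H (monomial t 1 * linForm w) ∈ W)
    {v : Fin 5 → L} (hv : gradAt F (polyVec L f) ⬝ᵥ v = 0) : v ∈ W := by
  obtain ⟨k, hk⟩ := h.exists_polyVec_ne_zero
  set x := polyVec L f with hx
  have hdF : ∀ i, (pderiv i F * X k).IsHomogeneous d := fun i =>
    isHomogeneous_mul_X h h.homF.pderiv k
  have hG : H (dirDeriv v F * X k) ∈ W := by
    have h1 : dirDeriv v F * X k ∈ pointIdeal x d := by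
      refine mem_pointIdeal (fun h0 => hk (congrFun h0 k))
        (isHomogeneous_mul_X h (dirDeriv_isHomogeneous v h.homF) k) ?_
      rw [map_mul, eval_dirDeriv]
      change (gradAt F x ⬝ᵥ v) * _ = 0
      rw [hv, zero_mul]
    have h2 : pointIdeal x d ≤ W.comap H := by
      rw [pointIdeal, Submodule.span_le]
      rintro _ ⟨w, t, hw, ht, rfl⟩
      exact hW₂ t w (by omega) hw
    exact h2 h1
  have hz : ∀ i, x k • (Pi.single i 1 : Fin 5 → L) + H (pderiv i F * X k) ∈ W := by
    intro i
    refine hW₁ _ ?_ fun r => ?_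
    · have h1 := hH.eval_add _ (hdF i)
      rw [map_mul, eval_X] at h1
      rw [dotProduct_add, dotProduct_smul, dotProduct_single, mul_one, smul_eq_mul, mul_comm]
      exact h1
    · refine PolyLE.add ?_ (hH.polyLE _ (hdF i) (coeff_mul_X_polyLE (fun s => ?_) k) r)
      · rw [Pi.smul_apply, Pi.single_apply, smul_eq_mul]
        split_ifs
        · rw [mul_one]; exact h.polyLE_f k
        · rw [mul_zero]; exact PolyLE.zero e
      · rw [coeff_pderiv]
        have h1 : PolyLE K 0 (((s i + 1 : ℕ)) : L) :=
          ⟨((s i + 1 : ℕ) : Polynomial K), (Polynomial.natDegree_natCast _).le, by simp⟩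
        simpa using (h.coeffF (s + Finsupp.single i 1)).mul h1
  have h3 : x k • v = ∑ i, v i • (x k • (Pi.single i 1 : Fin 5 → L) + H (pderiv i F * X k))
      - H (dirDeriv v F * X k) := by
    have h4 : dirDeriv v F * X k = ∑ i, v i • (pderiv i F * X k) := by
      rw [dirDeriv_apply, Finset.sum_mul]
      refine Finset.sum_congr rfl fun i _ => ?_
      rw [mul_assoc, C_mul']
    rw [h4, map_sum]
    simp only [smul_add, Finset.sum_add_distrib, map_smul, add_sub_cancel_right]
    ext r
    simp [Finset.sum_apply, Pi.single_apply, mul_comm]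
  have h5 : x k • v ∈ W := by
    rw [h3]
    exact sub_mem (sum_mem fun i _ => W.smul_mem _ (hz i)) hG
  have := W.smul_mem (x k)⁻¹ h5
  rwa [smul_smul, inv_mul_cancel₀ hk, one_smul] at this

/-- Low degree vector fields along the curve that are tangent to the hypersurface are tangent to
the cone over the curve. -/
theorem mem_span_of_polyLE (h : CurveSystem d e F f D)
    (hH : IsTangentLift K d e (gradAt F (polyVec L f)) (polyVec L f) H)
    [IsFractionRing (Polynomial K) L] {z : Fin 5 → L}
    (hz : gradAt F (polyVec L f) ⬝ᵥ z = 0) (hzK : ∀ i, PolyLE K e (z i)) :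
    z ∈ Submodule.span L {polyVec L f, polyVec L (fun i => Polynomial.derivative (f i))} := by
  by_contra hzV
  obtain ⟨k, hk⟩ := h.exists_polyVec_ne_zero
  set x := polyVec L f with hx
  set x' := polyVec L (fun i => Polynomial.derivative (f i)) with hx'
  have key : ∀ u : Fin 5 → L, gradAt F x ⬝ᵥ u = 0 → (∀ i, PolyLE K (2 * e) (u i)) →
      u ∈ Submodule.span L {x, x', z} := by
    intro u hu huK
    refine mem_span_of_det5_eq_zero h.linearIndependent_tangent hzV ?_
    obtain ⟨μ, hμ⟩ := det5_eq_smul (x := x) (x' := x') h.grad_ne_zero h.grad_dot_self h.grad_dot_derivative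
      hz hu
    have h0 : μ = 0 := by
      refine h.eq_zero_of_mul_grad (n := 2 * e - 1 + e + 2 * e) ?_ fun r => ?_
      · have h1 := h.hd
        have h2 := h.he
        have : 5 * e ≤ (d - 1) * e := Nat.mul_le_mul_right e (by omega)
        omega
      · rw [← hμ r]
        exact h.polyLE_det5 hzK huK r
    intro r
    rw [hμ r, h0, zero_mul]
  refine not_forall_mem_span_triple h.grad_ne_zero x x' z fun v hv =>
    mem_of_grad_dot_eq_zero h hH (fun z hz hzK => key z hz fun i => (hzK i).mono (by omega))
      (fun t w ht hw => ?_) hv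
  have hP : (monomial t (1 : L)).IsHomogeneous (d - 1) := isHomogeneous_monomial _ ht
  have hK : ∀ s, PolyLE K 0 (coeff s (monomial t (1 : L))) := by
    classical
    intro s
    rw [coeff_monomial]
    split_ifs
    · exact PolyLE.one 0
    · exact PolyLE.zero 0
  have h5 : x k • H (monomial t 1 * linForm w) ∈ Submodule.span L {x, x', z} := by
    rw [lift_mul_linForm hw _ k]
    exact sum_mem fun i _ => Submodule.smul_mem _ _
      (key _ (grad_dot_minor h hH hP i k) (polyLE_minor h hH hP hK i k))
  have := Submodule.smul_mem _ (x k)⁻¹ h5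
  rwa [smul_smul, inv_mul_cancel₀ hk, one_smul] at this

end CurveSystem
end TangentLift

section SpanDerivations

variable {L : Type*} [Field L]

theorem lie_mem_span_of_forall {S : Set (Derivation ℤ L L)}
    (hS : ∀ δ₁ ∈ S, ∀ δ₂ ∈ S, ⁅δ₁, δ₂⁆ ∈ Submodule.span L S)
    {δ₁ δ₂ : Derivation ℤ L L} (h₁ : δ₁ ∈ Submodule.span L S) (h₂ : δ₂ ∈ Submodule.span L S) :
    ⁅δ₁, δ₂⁆ ∈ Submodule.span L S := by
  have hsmul : ∀ (a : L) (δ δ' : Derivation ℤ L L), ⁅a • δ, δ'⁆ = a • ⁅δ, δ'⁆ - (δ' a) • δ := by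
    intro a δ δ'
    ext c
    simp only [Derivation.commutator_apply, Derivation.smul_apply, Derivation.sub_apply,
      smul_eq_mul, Derivation.leibniz]
    ring
  have hstep : ∀ δ ∈ S, ∀ δ' ∈ Submodule.span L S, ⁅δ', δ⁆ ∈ Submodule.span L S := by
    intro δ hδ δ' hδ'
    induction hδ' using Submodule.span_induction with
    | mem δ' hδ' => exact hS _ hδ' _ hδ
    | zero => rw [zero_lie]; exact Submodule.zero_mem _
    | add δ' δ'' _ _ h h' => rw [add_lie]; exact add_mem h h'
    | smul a δ' hmem h =>
      rw [hsmul]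
      exact sub_mem (Submodule.smul_mem _ _ h) (Submodule.smul_mem _ _ hmem)
  induction h₁ using Submodule.span_induction with
  | mem δ hδ => rw [← lie_skew]; exact neg_mem (hstep δ hδ _ h₂)
  | zero => rw [zero_lie]; exact Submodule.zero_mem _
  | add δ' δ'' _ _ h h' => rw [add_lie]; exact add_mem h h'
  | smul a δ' hmem h =>
    rw [hsmul]
    exact sub_mem (Submodule.smul_mem _ _ h) (Submodule.smul_mem _ _ hmem)

end SpanDerivations

section Pencil

variable {K L : Type*} [Field K] [CharZero K] [Field L] [CharZero L] [Algebra (Polynomial K) L]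

theorem polyLE_coeff_monomial (t s : Fin 5 →₀ ℕ) : PolyLE K 0 (coeff s (monomial t (1 : L))) := by
  classical
  rw [coeff_monomial]
  split_ifs
  · exact PolyLE.one 0
  · exact PolyLE.zero 0

/-- The `L`-span of the coefficientwise derivations and the derivation along the parameter. -/
noncomputable def curveDer (K : Type*) {L : Type*} [Field K] [Field L] [Algebra (Polynomial K) L]
    (D : Derivation ℤ L L) : Submodule L (Derivation ℤ L L) :=
  Submodule.span L ({δ | IsCoeffwise K δ} ∪ {D})

namespace CurveSystem

variable {d e : ℕ} {F : MvPolynomial (Fin 5) L} {f : Fin 5 → Polynomial K} {D : Derivation ℤ L L}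
  {H : MvPolynomial (Fin 5) L →ₗ[L] (Fin 5 → L)}

/-- The tangent plane of the cone over the curve. -/
noncomputable def tangentPlane (L : Type*) [Field L] [Algebra (Polynomial K) L]
    (f : Fin 5 → Polynomial K) : Submodule L (Fin 5 → L) :=
  Submodule.span L {polyVec L f, polyVec L (fun i => Polynomial.derivative (f i))}

theorem lie_mem_curveDer (h : CurveSystem d e F f D) {δ₁ δ₂ : Derivation ℤ L L}
    (h₁ : δ₁ ∈ curveDer K D) (h₂ : δ₂ ∈ curveDer K D) : ⁅δ₁, δ₂⁆ ∈ curveDer K D := by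
  refine lie_mem_span_of_forall ?_ h₁ h₂
  rintro δ (hδ | rfl) δ' (hδ' | rfl)
  · exact Submodule.subset_span (Or.inl (hδ.lie hδ'))
  · exact Submodule.subset_span (Or.inl (lie_derivative_isCoeffwise hδ h.D_apply))
  · rw [← lie_skew]
    exact neg_mem (Submodule.subset_span (Or.inl (lie_derivative_isCoeffwise hδ' h.D_apply)))
  · rw [lie_self]; exact Submodule.zero_mem _

theorem exists_mem_curveDer (h : CurveSystem d e F f D) {G : MvPolynomial (Fin 5) L}
    (hG : G.IsHomogeneous d) : ∃ δ ∈ curveDer K D, coeffDer δ F = G := by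
  let R : Submodule L (MvPolynomial (Fin 5) L) :=
    { carrier := {G | ∃ δ ∈ curveDer K D, coeffDer δ F = G}
      zero_mem' := ⟨0, Submodule.zero_mem _, by
        have := coeffDer_smul_left (0 : L) (0 : Derivation ℤ L L) F
        rwa [zero_smul, zero_smul] at this⟩
      add_mem' := by
        rintro _ _ ⟨δ, hδ, rfl⟩ ⟨δ', hδ', rfl⟩
        exact ⟨δ + δ', add_mem hδ hδ', coeffDer_add_left _ _ _⟩
      smul_mem' := by
        rintro a _ ⟨δ, hδ, rfl⟩
        exact ⟨a • δ, Submodule.smul_mem _ _ hδ, coeffDer_smul_left _ _ _⟩ }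
  change G ∈ R
  rw [G.as_sum]
  refine Submodule.sum_mem _ fun t ht => ?_
  have h1 : monomial t (coeff t G) = coeff t G • monomial t 1 := by
    rw [smul_monomial, smul_eq_mul, mul_one]
  rw [h1]
  refine Submodule.smul_mem _ _ ?_
  obtain ⟨δ, hδ, hF⟩ := h.monomial_lift t (degree_eq_of_isHomogeneous hG (mem_support_iff.mp ht))
  exact ⟨δ, Submodule.subset_span (Or.inl hδ), hF⟩

theorem exists_shear (h : CurveSystem d e F f D) (v w : Fin 5 → L) (hw : w ⬝ᵥ polyVec L f = 0) :
    ∃ δ ∈ curveDer K D, coeffDer δ F = -(linForm w * dirDeriv v F) ∧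
      ∀ i, δ (polyVec L f i) = 0 := by
  choose δ hδ hF hx using h.linear_lift
  have hsum : ∀ (t : Finset (Fin 5 × Fin 5)) (a : Fin 5 × Fin 5 → Derivation ℤ L L),
      coeffDer (∑ p ∈ t, a p) F = ∑ p ∈ t, coeffDer (a p) F := by
    classical
    intro t a
    induction t using Finset.induction_on with
    | empty =>
      have := coeffDer_smul_left (0 : L) (0 : Derivation ℤ L L) F
      rw [zero_smul, zero_smul] at this
      simpa using this
    | insert i t hi ih => rw [Finset.sum_insert hi, Finset.sum_insert hi, coeffDer_add_left, ih]
  have hsum' : ∀ (t : Finset (Fin 5 × Fin 5)) (a : Fin 5 × Fin 5 → Derivation ℤ L L) (c : L),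
      (∑ p ∈ t, a p) c = ∑ p ∈ t, a p c := by
    classical
    intro t a c
    induction t using Finset.induction_on with
    | empty => simp
    | insert i t hi ih => rw [Finset.sum_insert hi, Finset.sum_insert hi, Derivation.add_apply, ih]
  refine ⟨∑ p : Fin 5 × Fin 5, (v p.1 * w p.2) • δ p.1 p.2,
    sum_mem fun p _ => Submodule.smul_mem _ _ (Submodule.subset_span (Or.inl (hδ _ _))), ?_, ?_⟩
  · rw [hsum, Fintype.sum_prod_type, linForm, dirDeriv_apply, Finset.sum_mul_sum,
      Finset.sum_comm, ← Finset.sum_neg_distrib]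
    refine Finset.sum_congr rfl fun j _ => ?_
    rw [← Finset.sum_neg_distrib]
    refine Finset.sum_congr rfl fun i _ => ?_
    rw [coeffDer_smul_left, hF, smul_eq_C_mul, C_mul]
    ring
  · intro k
    rw [hsum', Fintype.sum_prod_type]
    simp only [Derivation.smul_apply, hx, smul_eq_mul, mul_ite, mul_zero]
    rw [Finset.sum_eq_single k]
    · simp only [if_true, mul_assoc]
      rw [← Finset.mul_sum]
      change v k * (w ⬝ᵥ polyVec L f) = 0
      rw [hw, mul_zero]
    · intro i _ hik
      exact Finset.sum_eq_zero fun j _ => if_neg (Ne.symm hik)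
    · simp

theorem mkQ_lift_coeffDer (h : CurveSystem d e F f D)
    (hH : IsTangentLift K d e (gradAt F (polyVec L f)) (polyVec L f) H)
    [IsFractionRing (Polynomial K) L] {δ : Derivation ℤ L L}
    (hδ : δ ∈ curveDer K D) : (tangentPlane L f).mkQ (H (coeffDer δ F)) =
      (tangentPlane L f).mkQ (fun i => δ (polyVec L f i)) := by
  rw [curveDer] at hδ
  induction hδ using Submodule.span_induction with
  | mem δ hδ =>
    rw [← sub_eq_zero, ← map_sub, ← LinearMap.mem_ker, Submodule.ker_mkQ]
    rcases hδ with hδ | rfl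
    · have hhom := coeffDer_isHomogeneous δ h.homF
      refine mem_span_of_polyLE h hH ?_ fun i => ?_
      · rw [dotProduct_sub, ← sub_eq_zero.mpr ((hH.eval_add _ hhom).trans (h.eval_add_dot δ).symm)]
        ring
      · exact (hH.polyLE _ hhom (fun s => by rw [coeff_coeffDer]; exact hδ.1 _ (h.coeffF s)) i).sub
          (hδ.polyLE (h.polyLE_f i))
    · rw [h.coeffDer_D, map_zero, zero_sub]
      refine neg_mem (Submodule.subset_span (Or.inr ?_))
      ext i
      exact h.D_polyVec i
  | zero =>
    have := coeffDer_smul_left (0 : L) (0 : Derivation ℤ L L) F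
    rw [zero_smul, zero_smul] at this
    rw [this, map_zero, map_zero]
    exact (map_zero _).symm
  | add δ δ' _ _ h1 h2 =>
    rw [coeffDer_add_left, map_add, map_add, h1, h2, ← map_add]; rfl
  | smul a δ _ h1 =>
    rw [coeffDer_smul_left, map_smul, map_smul, h1, ← map_smul]; rfl

theorem exists_smul_of_mkQ_ne_zero (h : CurveSystem d e F f D)
    (hH : IsTangentLift K d e (gradAt F (polyVec L f)) (polyVec L f) H)
    [IsFractionRing (Polynomial K) L] {P : MvPolynomial (Fin 5) L}
    (hP : P.IsHomogeneous (d - 1)) (hK : ∀ s, PolyLE K 0 (coeff s P)) {w w' : Fin 5 → L}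
    (hw : w ⬝ᵥ polyVec L f = 0) (hw' : w' ⬝ᵥ polyVec L f = 0)
    (h0 : (tangentPlane L f).mkQ (H (P * linForm w)) ≠ 0) :
    ∃ c : L, (tangentPlane L f).mkQ (H (P * linForm w')) =
      c • (tangentPlane L f).mkQ (H (P * linForm w)) := by
  have h1 := mem_span_of_det5_eq_zero h.linearIndependent_tangent
    (a := H (P * linForm w)) (b := H (P * linForm w'))
    (fun hmem => h0 (by rw [← LinearMap.mem_ker, Submodule.ker_mkQ]; exact hmem))
    (det5_lift_eq_zero h hH hP hK hw hw')
  obtain ⟨a, b, c, habc⟩ := Submodule.mem_span_triple.mp h1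
  refine ⟨c, ?_⟩
  rw [← map_smul, ← sub_eq_zero, ← map_sub, ← LinearMap.mem_ker, Submodule.ker_mkQ, ← habc,
    add_sub_cancel_right]
  exact Submodule.mem_span_pair.mpr ⟨a, b, rfl⟩

/-- Modulo the tangent plane, lifts of products with linear forms through the curve depend on the
linear form only through its value at a single point `y`. -/
theorem exists_pencil (h : CurveSystem d e F f D)
    (hH : IsTangentLift K d e (gradAt F (polyVec L f)) (polyVec L f) H)
    [IsFractionRing (Polynomial K) L] :
    ∃ (y s : Fin 5 → L) (P₀ P₁ : MvPolynomial (Fin 5) L), s ⬝ᵥ polyVec L f = 0 ∧ s ⬝ᵥ y = 1 ∧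
      P₀.IsHomogeneous (d - 1) ∧ P₁.IsHomogeneous (d - 1) ∧
      (∀ t, PolyLE K 0 (coeff t P₀)) ∧ (∀ t, PolyLE K 0 (coeff t P₁)) ∧
      (∀ P : MvPolynomial (Fin 5) L, P.IsHomogeneous (d - 1) → ∀ w : Fin 5 → L,
        w ⬝ᵥ polyVec L f = 0 → (tangentPlane L f).mkQ (H (P * linForm w)) =
          (w ⬝ᵥ y) • (tangentPlane L f).mkQ (H (P * linForm s))) ∧
      LinearIndependent L ![(tangentPlane L f).mkQ (H (P₀ * linForm s)),
        (tangentPlane L f).mkQ (H (P₁ * linForm s))] := by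
  obtain ⟨q, hq⟩ : ∃ q : (Fin 5 → L) →ₗ[L] L, ∀ w, q w = w ⬝ᵥ polyVec L f :=
    ⟨dotProductBilin L L (polyVec L f), fun w => dotProduct_comm (polyVec L f) w⟩
  let U : AddSubgroup (MvPolynomial (Fin 5) L) :=
    { carrier := {P | P.IsHomogeneous (d - 1) ∧ ∀ s, PolyLE K 0 (coeff s P)}
      zero_mem' := ⟨isHomogeneous_zero _ _ _, fun s => by rw [coeff_zero]; exact PolyLE.zero 0⟩
      add_mem' := fun ha hb => ⟨ha.1.add hb.1, fun s => by rw [coeff_add]; exact (ha.2 s).add (hb.2 s)⟩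
      neg_mem' := fun ha => ⟨(homogeneousSubmodule (Fin 5) L (d - 1)).neg_mem ha.1,
        fun s => by rw [coeff_neg]; exact (ha.2 s).neg⟩ }
  obtain ⟨B, hB⟩ : ∃ B : MvPolynomial (Fin 5) L →+
      ((Fin 5 → L) →ₗ[L] ((Fin 5 → L) ⧸ tangentPlane L f)),
      ∀ P w, B P w = (tangentPlane L f).mkQ (H (P * linForm w)) := by
    refine ⟨AddMonoidHom.mk' (fun P =>
      { toFun := fun w => (tangentPlane L f).mkQ (H (P * linForm w))
        map_add' := fun w w' => by rw [linForm_add, mul_add, map_add, map_add]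
        map_smul' := fun a w => by
          rw [linForm_smul, mul_smul_comm, map_smul, map_smul, RingHom.id_apply] }) ?_,
      fun P w => rfl⟩
    intro P Q
    refine LinearMap.ext fun w => ?_
    change (tangentPlane L f).mkQ (H ((P + Q) * linForm w)) = _
    rw [add_mul, map_add, map_add]; rfl
  obtain ⟨β, hβ⟩ : ∃ β : U →+ (LinearMap.ker q →ₗ[L] ((Fin 5 → L) ⧸ tangentPlane L f)),
      ∀ P w, β P w = (tangentPlane L f).mkQ (H (P.1 * linForm w.1)) := by
    refine ⟨AddMonoidHom.mk' (fun P => (B P.1).comp (LinearMap.ker q).subtype) ?_, fun P w => hB _ _⟩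
    intro P Q
    ext1 w
    change B (P.1 + Q.1) w.1 = B P.1 w.1 + B Q.1 w.1
    rw [map_add, LinearMap.add_apply]
  have hmemU : ∀ t : Fin 5 →₀ ℕ, t.degree = d - 1 → monomial t (1 : L) ∈ U := fun t ht =>
    ⟨isHomogeneous_monomial _ ht, polyLE_coeff_monomial t⟩
  have hker : ∀ w : Fin 5 → L, w ⬝ᵥ polyVec L f = 0 → w ∈ LinearMap.ker q := fun w hw => by
    rw [LinearMap.mem_ker, hq, hw]
  have hker' : ∀ w : LinearMap.ker q, w.1 ⬝ᵥ polyVec L f = 0 := fun w => by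
    rw [← hq]; exact w.2
  rcases rankOne_dichotomy β (fun u a b hne => by
    rw [hβ] at hne
    rw [hβ, hβ]
    exact exists_smul_of_mkQ_ne_zero h hH u.2.1 u.2.2 (hker' a) (hker' b) hne) with
    ⟨n, hn⟩ | ⟨ε, e₀, u₀, u₁, hε₀, hε, hind⟩
  · exfalso
    obtain ⟨n, rfl⟩ := (tangentPlane L f).mkQ_surjective n
    refine not_forall_mem_span_triple h.grad_ne_zero (polyVec L f)
      (polyVec L (fun i => Polynomial.derivative (f i))) n fun v hv =>
      mem_of_grad_dot_eq_zero h hH (fun z hz hzK => ?_) (fun t w ht hw => ?_) hv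
    · refine Submodule.span_mono ?_ (mem_span_of_polyLE h hH hz hzK)
      intro a ha
      rcases ha with rfl | rfl <;> simp
    · have h1 := hn ⟨_, hmemU t ht⟩ ⟨w, hker w hw⟩
      rw [hβ] at h1
      obtain ⟨c, hc⟩ := Submodule.mem_span_singleton.mp h1
      rw [← map_smul, eq_comm, ← sub_eq_zero, ← map_sub, ← LinearMap.mem_ker, Submodule.ker_mkQ] at hc
      obtain ⟨a, b, hab⟩ := Submodule.mem_span_pair.mp hc
      refine Submodule.mem_span_triple.mpr ⟨a, b, c, ?_⟩
      rw [hab, sub_add_cancel]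
  · obtain ⟨ε', hε'⟩ := LinearMap.exists_extend ε
    have hy : ∀ w, ε' w = w ⬝ᵥ (fun i => ε' (Pi.single i 1)) := by
      intro w
      rw [LinearMap.pi_apply_eq_sum_univ ε' w]
      refine Finset.sum_congr rfl fun i _ => ?_
      rw [smul_eq_mul]
      congr 2
      ext j
      simp [Pi.single_apply, eq_comm]
    have hεε : ∀ w : LinearMap.ker q, ε w = w.1 ⬝ᵥ (fun i => ε' (Pi.single i 1)) := fun w => by
      rw [← hy, ← hε']; rfl
    refine ⟨fun i => ε' (Pi.single i 1), e₀.1, u₀.1, u₁.1, hker' e₀, ?_, u₀.2.1, u₁.2.1, u₀.2.2,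
      u₁.2.2, fun P hP w hw => ?_, ?_⟩
    · rw [← hεε, hε₀]
    · have hmono : ∀ t : Fin 5 →₀ ℕ, t.degree = d - 1 →
          (tangentPlane L f).mkQ (H (monomial t 1 * linForm w)) =
          (w ⬝ᵥ fun i => ε' (Pi.single i 1)) •
            (tangentPlane L f).mkQ (H (monomial t 1 * linForm e₀.1)) := by
        intro t ht
        have := hε ⟨_, hmemU t ht⟩ ⟨w, hker w hw⟩
        rwa [hβ, hβ, hεε] at this
      rw [P.as_sum, Finset.sum_mul, Finset.sum_mul, map_sum, map_sum, map_sum, map_sum,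
        Finset.smul_sum]
      refine Finset.sum_congr rfl fun t ht => ?_
      have h1 : monomial t (coeff t P) = coeff t P • monomial t 1 := by
        rw [smul_monomial, smul_eq_mul, mul_one]
      rw [h1, smul_mul_assoc, smul_mul_assoc, map_smul, map_smul, map_smul, map_smul,
        hmono t (degree_eq_of_isHomogeneous hP (mem_support_iff.mp ht)), smul_comm]
    · rwa [hβ, hβ] at hind

end CurveSystem
end Pencil

section Primitive

/-- A nonzero vector over the fraction field of a principal ideal domain can be scaled to a vector
with coprime integral entries. -/
theorem exists_smul_eq_algebraMap_of_ne_zero {R L ι : Type*} [CommRing R] [IsDomain R]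
    [IsPrincipalIdealRing R] [Field L] [Algebra R L] [IsFractionRing R L] [Finite ι] {p : ι → L}
    (hp : p ≠ 0) : ∃ (c : L) (q : ι → R), c ≠ 0 ∧ (∀ i, algebraMap R L (q i) = c * p i) ∧
      Ideal.span (Set.range q) = ⊤ := by
  have := Fintype.ofFinite ι
  obtain ⟨b, hb⟩ := IsLocalization.exist_integer_multiples_of_finite (nonZeroDivisors R) p
  choose a ha using hb
  have hb0 : algebraMap R L b ≠ 0 := IsFractionRing.to_map_ne_zero_of_mem_nonZeroDivisors b.2
  simp only [Algebra.smul_def] at ha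
  obtain ⟨g, hg⟩ := IsPrincipalIdealRing.principal (Ideal.span (Set.range a))
  rw [Ideal.submodule_span_eq] at hg
  have hdvd : ∀ i, ∃ r, a i = g * r := fun i => by
    have : a i ∈ Ideal.span {g} := hg ▸ Ideal.subset_span ⟨i, rfl⟩
    exact Ideal.mem_span_singleton.mp this
  choose q hq using hdvd
  have hg0 : g ≠ 0 := by
    rintro rfl
    apply hp
    ext i
    have h1 := ha i
    rw [hq i, zero_mul, map_zero] at h1
    exact (mul_eq_zero.mp h1.symm).resolve_left hb0
  have hg0' : algebraMap R L g ≠ 0 := fun h0 => hg0 ((FaithfulSMul.algebraMap_eq_zero_iff R L).mp h0)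
  refine ⟨algebraMap R L b / algebraMap R L g, q, div_ne_zero hb0 hg0', fun i => ?_, ?_⟩
  · have h1 := ha i
    rw [hq i, map_mul] at h1
    field_simp
    rw [← h1, mul_comm]
  · have h1 : g ∈ Ideal.span (Set.range a) := hg ▸ Ideal.mem_span_singleton_self g
    rw [Ideal.span, Submodule.mem_span_range_iff_exists_fun] at h1
    obtain ⟨r, hr⟩ := h1
    rw [Ideal.eq_top_iff_one]
    have h2 : (1 : R) = ∑ i, r i * q i := by
      apply mul_left_cancel₀ hg0
      rw [mul_one, Finset.mul_sum]
      conv_lhs => rw [← hr]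
      refine Finset.sum_congr rfl fun i _ => ?_
      rw [smul_eq_mul, hq i]; ring
    rw [h2]
    exact sum_mem fun i _ => Ideal.mul_mem_left _ _ (Ideal.subset_span ⟨i, rfl⟩)

end Primitive

section Contradiction

variable {K L : Type*} [Field K] [CharZero K] [Field L] [CharZero L] [Algebra (Polynomial K) L]
  [IsFractionRing (Polynomial K) L]

namespace CurveSystem

variable {d e : ℕ} {F : MvPolynomial (Fin 5) L} {f : Fin 5 → Polynomial K} {D : Derivation ℤ L L}
  {H : MvPolynomial (Fin 5) L →ₗ[L] (Fin 5 → L)}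

theorem pencilSystem (h : CurveSystem 6 e F f D)
    (hH : IsTangentLift K 6 e (gradAt F (polyVec L f)) (polyVec L f) H)
    {y s : Fin 5 → L} {P₀ P₁ : MvPolynomial (Fin 5) L} (hsx : s ⬝ᵥ polyVec L f = 0)
    (hsy : s ⬝ᵥ y = 1) (hP₀ : P₀.IsHomogeneous 5) (hP₁ : P₁.IsHomogeneous 5)
    (hmul : ∀ P : MvPolynomial (Fin 5) L, P.IsHomogeneous 5 → ∀ w : Fin 5 → L,
        w ⬝ᵥ polyVec L f = 0 → (tangentPlane L f).mkQ (H (P * linForm w)) =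
          (w ⬝ᵥ y) • (tangentPlane L f).mkQ (H (P * linForm s)))
    (hind : LinearIndependent L ![(tangentPlane L f).mkQ (H (P₀ * linForm s)),
        (tangentPlane L f).mkQ (H (P₁ * linForm s))]) :
    PencilSystem F (polyVec L f) y s (curveDer K D) ((tangentPlane L f).mkQ ∘ₗ H) P₀ P₁ where
  homF := h.homF
  lie_mem := fun _ h₁ _ h₂ => h.lie_mem_curveDer h₁ h₂
  eval_x := h.eval_f
  x_ne := by
    obtain ⟨k, hk⟩ := h.exists_polyVec_ne_zero
    exact fun h0 => hk (congrFun h0 k)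
  s_x := hsx
  s_y := hsy
  theta_zero := fun δ hδ c hc => by
    rw [LinearMap.comp_apply, mkQ_lift_coeffDer h hH hδ, ← LinearMap.mem_ker, Submodule.ker_mkQ]
    have h1 : (fun i => δ (polyVec L f i)) = c • polyVec L f := by
      ext i; exact hc i
    rw [h1]
    exact Submodule.smul_mem _ _ (Submodule.subset_span (Or.inl rfl))
  lift := fun _ hG => h.exists_mem_curveDer hG
  lift_zero := fun G hG h0 => by
    obtain ⟨δ, hδ, rfl⟩ := h.exists_mem_curveDer hG
    rw [LinearMap.comp_apply, mkQ_lift_coeffDer h hH hδ, ← LinearMap.mem_ker,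
      Submodule.ker_mkQ] at h0
    obtain ⟨a, b, hab⟩ := Submodule.mem_span_pair.mp h0
    refine ⟨δ + (-b) • D, add_mem hδ (Submodule.smul_mem _ _ (Submodule.subset_span (Or.inr rfl))),
      ?_, a, fun i => ?_⟩
    · rw [coeffDer_add_left, coeffDer_smul_left, h.coeffDer_D, smul_zero, add_zero]
    · have h1 := congrFun hab i
      rw [Derivation.add_apply, Derivation.smul_apply, h.D_polyVec, ← h1]
      simp
  shear := fun v w hw => h.exists_shear v w hw
  theta_mul := fun P hP w hw => hmul P hP w hw
  homP₀ := hP₀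
  homP₁ := hP₁
  indep := hind

theorem det5_congr_of_mem {x x' a a' b b' : Fin 5 → L} (ha : a - a' ∈ Submodule.span L {x, x'})
    (hb : b - b' ∈ Submodule.span L {x, x'}) (v : Fin 5 → L) :
    det5 x x' a b v = det5 x x' a' b' v := by
  obtain ⟨r, s, hrs⟩ := Submodule.mem_span_pair.mp ha
  obtain ⟨r', s', hrs'⟩ := Submodule.mem_span_pair.mp hb
  rw [eq_sub_iff_add_eq] at hrs hrs'
  rw [← hrs, ← hrs']
  simp only [det5_add_left, det5_add_right, det5_smul_left, det5_smul_right, det5_left_fst,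
    det5_left_snd, det5_right_fst, det5_right_snd]
  ring

theorem le_natDegree (h : CurveSystem 6 e F f D) {y : Fin 5 → L} (hF : eval y F ≠ 0)
    (hline : ∀ t : L, eval (y + t • polyVec L f) F = eval y F)
    {c : L} (hc : c ≠ 0) {q : Fin 5 × Fin 5 → Polynomial K}
    (hq : ∀ i, algebraMap (Polynomial K) L (q i) =
      c * (polyVec L f i.2 * y i.1 - polyVec L f i.1 * y i.2))
    {m : ℕ} (hm : ∀ i, (q i).natDegree ≤ m) : e ≤ m := by
  have hinj := IsFractionRing.injective (Polynomial K) L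
  have hpoly : ∀ k, PolyLE K (6 * m) (polyVec L f k ^ 6 * (c ^ 6 * eval y F)) := by
    intro k
    have h1 : PolyLE K (6 * m) (eval (c • (polyVec L f k • y - y k • polyVec L f)) F) := by
      refine PolyLE.eval h.homF h.coeffF fun i => ⟨q (i, k), hm _, ?_⟩
      rw [hq]
      simp; ring_nf; simp
    rw [PencilSystem.eval_smul_of_isHomogeneous h.homF] at h1
    have h2 : eval (polyVec L f k • y - y k • polyVec L f) F = polyVec L f k ^ 6 * eval y F := by
      by_cases hk : polyVec L f k = 0
      · rw [hk, zero_smul, zero_sub, ← neg_smul, PencilSystem.eval_smul_of_isHomogeneous h.homF,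
          h.eval_f]
        simp
      · rw [← hline (-(y k / polyVec L f k)), ← PencilSystem.eval_smul_of_isHomogeneous h.homF]
        congr 2
        rw [smul_add, smul_smul, sub_eq_add_neg, ← neg_smul]
        congr 2
        field_simp
    rw [h2] at h1
    convert h1 using 1
    ring
  obtain ⟨n, hn⟩ := exists_algebraMap_eq_of_span_eq_top (L := L) (p := fun k => f k ^ 6)
    (c := c ^ 6 * eval y F) (by
      have := Ideal.span_pow_eq_top (Set.range f) h.span_f 6
      rwa [← Set.range_comp] at this) (fun k => by
      obtain ⟨p, -, hp⟩ := hpoly k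
      exact ⟨p, by rw [hp, map_pow]; rfl⟩)
  have hn0 : n ≠ 0 := by
    rintro rfl
    rw [map_zero] at hn
    exact mul_ne_zero (pow_ne_zero _ hc) hF hn.symm
  obtain ⟨k, hk⟩ := h.exists_deg
  have hk0 : f k ≠ 0 := by
    intro h0; rw [h0, Polynomial.natDegree_zero] at hk
    have := h.he; omega
  obtain ⟨p, hp, hpe⟩ := hpoly k
  have h3 : p = f k ^ 6 * n := by
    apply hinj
    rw [hpe, map_mul, map_pow, hn]; rfl
  rw [h3, Polynomial.natDegree_mul (pow_ne_zero _ hk0) hn0, Polynomial.natDegree_pow, hk] at hp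
  omega

theorem false (h : CurveSystem d e F f D) : False := by
  have hinj := IsFractionRing.injective (Polynomial K) L
  obtain ⟨H, hH⟩ := h.exists_isTangentLift
  obtain ⟨y, s, P₀, P₁, hsx, hsy, hP₀, hP₁, hK₀, hK₁, hmul, hind⟩ := exists_pencil h hH
  obtain ⟨k, hk⟩ := h.exists_polyVec_ne_zero
  set x := polyVec L f with hx
  set x' := polyVec L (fun i => Polynomial.derivative (f i)) with hx'
  obtain ⟨p, hpdef⟩ : ∃ p : Fin 5 × Fin 5 → L, ∀ i, p i = x i.2 * y i.1 - x i.1 * y i.2 :=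
    ⟨_, fun _ => rfl⟩
  have hp0 : p ≠ 0 := by
    intro h0
    have h1 : ∀ i, x k * y i = x i * y k := fun i => by
      have := hpdef (i, k)
      rw [h0] at this
      exact (sub_eq_zero.mp this.symm)
    have h2 : x k * (s ⬝ᵥ y) = y k * (s ⬝ᵥ x) := by
      rw [dotProduct, dotProduct, Finset.mul_sum, Finset.mul_sum]
      refine Finset.sum_congr rfl fun i _ => ?_
      linear_combination s i * h1 i
    rw [hsx, hsy, mul_one, mul_zero] at h2
    exact hk h2
  obtain ⟨c, q, hc, hq, hspan⟩ := exists_smul_eq_algebraMap_of_ne_zero (R := Polynomial K) hp0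
  obtain ⟨i₀, hi₀⟩ := Finite.exists_max fun i => (q i).degree
  have hq0 : q i₀ ≠ 0 := by
    intro h0
    rw [h0, Polynomial.degree_zero] at hi₀
    apply hp0
    ext i
    have h1 : q i = 0 := Polynomial.degree_eq_bot.mp (le_bot_iff.mp (hi₀ i))
    have h2 := hq i
    rw [h1, map_zero] at h2
    exact (mul_eq_zero.mp h2.symm).resolve_left hc
  -- the determinant of the two independent lifts
  have ht₀ := grad_dot_lift_mul_linForm h hH hP₀ hsx
  have ht₁ := grad_dot_lift_mul_linForm h hH hP₁ hsx
  obtain ⟨μ, hμ⟩ := det5_eq_smul (x := x) (x' := x') h.grad_ne_zero h.grad_dot_self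
    h.grad_dot_derivative ht₀ ht₁
  have hμ0 : μ ≠ 0 := by
    rintro rfl
    have h1 := mem_span_of_det5_eq_zero h.linearIndependent_tangent
      (a := H (P₀ * linForm s)) (b := H (P₁ * linForm s)) (fun hmem => hind.ne_zero 0 (by
        change (tangentPlane L f).mkQ _ = 0
        rw [← LinearMap.mem_ker, Submodule.ker_mkQ]; exact hmem))
      (fun r => by rw [← hx, ← hx', hμ r, zero_mul])
    obtain ⟨a, b, c, habc⟩ := Submodule.mem_span_triple.mp h1
    have h2 : (tangentPlane L f).mkQ (H (P₁ * linForm s)) =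
        c • (tangentPlane L f).mkQ (H (P₀ * linForm s)) := by
      rw [← map_smul, ← sub_eq_zero, ← map_sub, ← LinearMap.mem_ker, Submodule.ker_mkQ, ← habc,
        add_sub_cancel_right]
      exact Submodule.mem_span_pair.mpr ⟨a, b, rfl⟩
    have h3 := LinearIndependent.pair_iff.mp hind (-c) 1 (by rw [h2, one_smul, neg_smul, neg_add_cancel])
    exact one_ne_zero h3.2
  have hminor : ∀ (P : MvPolynomial (Fin 5) L), P.IsHomogeneous (d - 1) → ∀ i : Fin 5 × Fin 5,
      (x i.2 • H (P * X i.1) - x i.1 • H (P * X i.2)) - p i • H (P * linForm s) ∈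
        Submodule.span L {x, x'} := by
    intro P hP i
    have h1 := hmul P hP (x i.2 • Pi.single i.1 1 - x i.1 • Pi.single i.2 1) (by
      rw [sub_dotProduct, smul_dotProduct, smul_dotProduct, single_dotProduct, single_dotProduct]
      simp; ring)
    have h2 : linForm (x i.2 • Pi.single i.1 1 - x i.1 • Pi.single i.2 1) =
        x i.2 • (X i.1 : MvPolynomial (Fin 5) L) - x i.1 • X i.2 := by
      rw [sub_eq_add_neg, ← neg_smul, linForm_add, linForm_smul, linForm_smul, linForm_single,
        linForm_single, neg_smul, sub_eq_add_neg]
    have h3 : (x i.2 • Pi.single i.1 1 - x i.1 • Pi.single i.2 1) ⬝ᵥ y = p i := by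
      rw [sub_dotProduct, smul_dotProduct, smul_dotProduct, single_dotProduct, single_dotProduct,
        hpdef]
      simp
    rw [h3, h2, mul_sub, mul_smul_comm, mul_smul_comm, map_sub, H.map_smul, H.map_smul,
      ← map_smul (tangentPlane L f).mkQ, ← sub_eq_zero, ← map_sub, ← LinearMap.mem_ker, Submodule.ker_mkQ] at h1
    exact h1
  have hdet : ∀ i r, PolyLE K (6 * e - 1)
      ((algebraMap (Polynomial K) L (q i) ^ 2 * (μ / c ^ 2)) * gradAt F x r) := by
    intro i r
    have h1 := h.polyLE_det5 (polyLE_minor h hH hP₀ hK₀ i.1 i.2) (polyLE_minor h hH hP₁ hK₁ i.1 i.2) r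
    have he := h.he
    rw [show 2 * e - 1 + 2 * e + 2 * e = 6 * e - 1 by omega] at h1
    rw [← hx, ← hx', det5_congr_of_mem (hminor P₀ hP₀ i) (hminor P₁ hP₁ i), det5_smul_left,
      det5_smul_right, hμ] at h1
    convert h1 using 1
    rw [hq]
    field_simp
    rfl
  choose M hM hMdeg using fun i => h.exists_poly_of_mul_grad (hdet i)
  obtain ⟨n, hn⟩ := exists_algebraMap_eq_of_span_eq_top (L := L) (p := fun i => q i ^ 2)
    (c := μ / c ^ 2) (by
      have := Ideal.span_pow_eq_top (Set.range q) hspan 2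
      rwa [← Set.range_comp] at this) (fun i => ⟨M i, by rw [hM, map_pow]⟩)
  have hn0 : n ≠ 0 := by
    rintro rfl
    rw [map_zero] at hn
    exact div_ne_zero hμ0 (pow_ne_zero _ hc) hn.symm
  have hMi : M i₀ = q i₀ ^ 2 * n := by
    apply hinj
    rw [hM, map_mul, map_pow, hn]
  have hdeg := hMdeg i₀ (by rw [hMi]; exact mul_ne_zero (pow_ne_zero _ hq0) hn0)
  rw [hMi, Polynomial.natDegree_mul (pow_ne_zero _ hq0) hn0, Polynomial.natDegree_pow] at hdeg
  have hd := h.hd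
  have he := h.he
  rcases hd.eq_or_lt with hd6 | hd7
  · subst hd6
    have hps := pencilSystem h hH hsx hsy hP₀ hP₁ hmul hind
    obtain ⟨hF, hline⟩ := hps.eval_ne_zero_and_eval_eq
    have hle := h.le_natDegree hF hline hc (fun i => by rw [hq i, hpdef])
      (fun i => Polynomial.natDegree_le_natDegree (hi₀ i))
    omega
  · have : 6 * e ≤ (d - 1) * e := Nat.mul_le_mul_right e (by omega)
    omega

end CurveSystem
end Contradiction

section DerivationExtension

theorem RingHom.exists_lift_of_formallySmooth {A B T : Type*} [CommRing A] [CommRing B] [CommRing T]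
    [Algebra A B] [Algebra.FormallySmooth A B] (f : A →+* T) (g : T →+* B)
    (hg : Function.Surjective g) (hker : RingHom.ker g ^ 2 = ⊥)
    (hgf : ∀ a, g (f a) = algebraMap A B a) :
    ∃ h : B →+* T, (∀ b, g (h b) = b) ∧ ∀ a, h (algebraMap A B a) = f a := by
  let := f.toAlgebra
  let g' : T →ₐ[A] B := { g with commutes' := hgf }
  let h := Algebra.FormallySmooth.liftOfSurjective (AlgHom.id A B) g' hg ⟨2, hker⟩
  exact ⟨h, fun b => Algebra.FormallySmooth.liftOfSurjective_apply (AlgHom.id A B) g' hg ⟨2, hker⟩ b,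
    fun a => h.commutes a⟩

/-- A homomorphism to the dual numbers over `algebraMap A B` extends to a derivation of `B`. -/
theorem Derivation.exists_of_formallySmooth {A B : Type*} [CommRing A] [CommRing B]
    [Algebra A B] [Algebra.FormallySmooth A B] (f : A →+* TrivSqZeroExt B B)
    (hf : ∀ a, (f a).fst = algebraMap A B a) :
    ∃ δ : Derivation ℤ B B, ∀ a, δ (algebraMap A B a) = (f a).snd := by
  have hker : RingHom.ker (TrivSqZeroExt.fstHom B B B).toRingHom ^ 2 = ⊥ :=
    TrivSqZeroExt.kerIdeal_sq B B
  obtain ⟨h, hfst, hh⟩ := RingHom.exists_lift_of_formallySmooth f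
    (TrivSqZeroExt.fstHom B B B).toRingHom TrivSqZeroExt.fst_surjective hker hf
  have hfst' : ∀ b, (h b).fst = b := hfst
  refine ⟨Derivation.mk' (AddMonoidHom.toIntLinearMap
    (AddMonoidHom.mk' (fun b => (h b).snd) fun a b => by rw [map_add, TrivSqZeroExt.snd_add]))
    fun a b => ?_, fun a => ?_⟩
  · change (h (a * b)).snd = a • (h b).snd + b • (h a).snd
    rw [map_mul, TrivSqZeroExt.snd_mul, hfst', hfst', op_smul_eq_smul]
  · change (h (algebraMap A B a)).snd = _
    rw [hh]

open scoped IntermediateField.algebraAdjoinAdjoin in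
/-- In characteristic zero, derivations can be prescribed on algebraically independent elements. -/
theorem AlgebraicIndependent.exists_derivation {k K ι : Type*} [Field k] [CharZero k] [Field K]
    [Algebra k K] {a : ι → K} (ha : AlgebraicIndependent k a) (g : ι → K) :
    ∃ δ : Derivation ℤ K K, (∀ c : k, δ (algebraMap k K c) = 0) ∧ ∀ i, δ (a i) = g i := by
  obtain ⟨s, has, hs⟩ := exists_isTranscendenceBasis_superset ha.coe_range
  have hv : AlgebraicIndependent k ((↑) : s → K) := hs.1
  let A := Algebra.adjoin k (Set.range ((↑) : s → K))
  let E := IntermediateField.adjoin k (Set.range ((↑) : s → K))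
  have h1 : Algebra.FormallySmooth A E := .of_isLocalization (nonZeroDivisors _)
  have halg : Algebra.IsAlgebraic E K := hs.isAlgebraic_field
  have : CharZero E := charZero_of_injective_algebraMap (algebraMap k E).injective
  have h2 : Algebra.FormallyEtale E K := Algebra.FormallyEtale.of_isSeparable _ K
  have h3 : Algebra.FormallySmooth A K := .comp _ E _
  let F₀ : MvPolynomial s k →ₐ[k] TrivSqZeroExt K K :=
    aeval fun x => TrivSqZeroExt.inl (x : K) + TrivSqZeroExt.inr (Function.extend a g 0 x)
  let F : A →ₐ[k] TrivSqZeroExt K K := F₀.comp hv.aevalEquiv.symm.toAlgHom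
  have hfst : ∀ p, (F₀ p).fst = aeval ((↑) : s → K) p := by
    intro p
    have : (TrivSqZeroExt.fstHom k K K).comp F₀ = aeval ((↑) : s → K) := by
      ext x
      simp [F₀]
    exact DFunLike.congr_fun this p
  obtain ⟨δ, hδ⟩ := Derivation.exists_of_formallySmooth F.toRingHom (fun x => by
    obtain ⟨p, rfl⟩ := hv.aevalEquiv.surjective x
    change (F₀ (hv.aevalEquiv.symm (hv.aevalEquiv p))).fst = _
    rw [AlgEquiv.symm_apply_apply, hfst]
    exact (hv.algebraMap_aevalEquiv p).symm)
  have key : ∀ p : MvPolynomial s k, δ (aeval ((↑) : s → K) p) = (F₀ p).snd := by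
    intro p
    have := hδ (hv.aevalEquiv p)
    rw [hv.algebraMap_aevalEquiv] at this
    rw [this]
    change (F₀ (hv.aevalEquiv.symm (hv.aevalEquiv p))).snd = _
    rw [AlgEquiv.symm_apply_apply]
  refine ⟨δ, fun c => ?_, fun i => ?_⟩
  · have := key (C c)
    rw [aeval_C] at this
    rw [this]
    simp [F₀, TrivSqZeroExt.algebraMap_eq_inl']
  · have := key (X ⟨a i, has ⟨i, rfl⟩⟩)
    rw [aeval_X] at this
    rw [this]
    simp [F₀, ha.injective.extend_apply]

section Polynomial
variable {K L : Type*} [Field K] [Field L] [Algebra (Polynomial K) L] [IsFractionRing (Polynomial K) L]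

theorem Derivation.exists_of_polynomial (δ : Derivation ℤ K K) (c : L) :
    ∃ δ' : Derivation ℤ L L, (∀ a, δ' (algebraMap (Polynomial K) L (.C a)) =
      algebraMap (Polynomial K) L (.C (δ a))) ∧ δ' (algebraMap (Polynomial K) L .X) = c := by
  have : Algebra.FormallySmooth (Polynomial K) L := .of_isLocalization (nonZeroDivisors _)
  let j : K →+* L := (algebraMap (Polynomial K) L).comp Polynomial.C
  let f₀ : K →+* TrivSqZeroExt L L :=
    { toFun := fun a => TrivSqZeroExt.inl (j a) + TrivSqZeroExt.inr (j (δ a))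
      map_one' := by ext <;> simp
      map_mul' := fun a b => by
        ext
        · simp
        · simp only [TrivSqZeroExt.snd_add, TrivSqZeroExt.snd_inl, TrivSqZeroExt.snd_inr, zero_add,
            TrivSqZeroExt.snd_mul, TrivSqZeroExt.fst_add, TrivSqZeroExt.fst_inl,
            TrivSqZeroExt.fst_inr, add_zero, δ.leibniz, map_add, smul_eq_mul, map_mul,
            MulOpposite.smul_eq_mul_unop, MulOpposite.unop_op]
          ring
      map_zero' := by ext <;> simp
      map_add' := fun a b => by ext <;> simp }
  let x : TrivSqZeroExt L L := TrivSqZeroExt.inl (algebraMap (Polynomial K) L .X) + TrivSqZeroExt.inr c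
  obtain ⟨δ', hδ'⟩ := Derivation.exists_of_formallySmooth (Polynomial.eval₂RingHom f₀ x) (fun p => by
    have : ((TrivSqZeroExt.fstHom L L L).toRingHom.comp (Polynomial.eval₂RingHom f₀ x)) =
        algebraMap (Polynomial K) L := by
      ext a
      · simp [f₀, j]
      · simp [x]
    exact DFunLike.congr_fun this p)
  refine ⟨δ', fun a => ?_, ?_⟩
  · rw [hδ', Polynomial.coe_eval₂RingHom, Polynomial.eval₂_C]
    change (TrivSqZeroExt.inl (j a) + TrivSqZeroExt.inr (j (δ a)) : TrivSqZeroExt L L).snd = _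
    rw [TrivSqZeroExt.snd_add, TrivSqZeroExt.snd_inl, TrivSqZeroExt.snd_inr, zero_add]
    rfl
  · rw [hδ']
    simp [x]

theorem Derivation.exists_isCoeffwise [CharZero K] [CharZero L] (δ : Derivation ℤ K K) :
    ∃ δ' : Derivation ℤ L L, IsCoeffwise K δ' ∧ ∀ a, δ' (algebraMap (Polynomial K) L (.C a)) =
      algebraMap (Polynomial K) L (.C (δ a)) := by
  obtain ⟨δ', h1, h2⟩ := Derivation.exists_of_polynomial δ (0 : L)
  refine ⟨δ', ⟨?_, h2⟩, h1⟩
  rintro c ⟨p, hp, rfl⟩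
  rw [Polynomial.eq_C_of_natDegree_le_zero hp, h1]
  exact ⟨_, by simp, rfl⟩

theorem Derivation.exists_extends_derivative :
    ∃ D : Derivation ℤ L L, ∀ p : Polynomial K, D (algebraMap (Polynomial K) L p) =
      algebraMap (Polynomial K) L (Polynomial.derivative p) := by
  obtain ⟨D, h1, h2⟩ := Derivation.exists_of_polynomial (0 : Derivation ℤ K K) (1 : L)
  refine ⟨D, fun p => ?_⟩
  induction p using Polynomial.induction_on' with
  | add p q hp hq => simp [hp, hq]
  | monomial n a =>
    rw [← Polynomial.C_mul_X_pow_eq_monomial, map_mul, D.leibniz, map_pow, D.leibniz_pow, h1, h2]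
    simp [Polynomial.derivative_X_pow]
end Polynomial
end DerivationExtension

section LinearSubstitution

variable {K : Type*} [CommRing K]

/-- The linear change of variables attached to a matrix. -/
noncomputable def linSubst (B : Matrix (Fin 5) (Fin 5) K) :
    MvPolynomial (Fin 5) K →ₐ[K] MvPolynomial (Fin 5) K :=
  bind₁ fun i => ∑ j, C (B i j) * X j

theorem coeffDer_aeval (δ : Derivation ℤ K K) (l : Fin 5 → MvPolynomial (Fin 5) K)
    (G : MvPolynomial (Fin 5) K) :
    coeffDer δ (bind₁ l G) = bind₁ l (coeffDer δ G) +
      ∑ r, bind₁ l (pderiv r G) * coeffDer δ (l r) := by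
  induction G using MvPolynomial.induction_on with
  | C a => simp
  | add p q hp hq => simp only [map_add, coeffDer_add, hp, hq, add_mul, Finset.sum_add_distrib]; ring
  | mul_X p i hp =>
    simp only [map_mul, bind₁_X_right, coeffDer_mul, hp, coeffDer_X, pderiv_mul, pderiv_X, map_add,
      mul_zero, add_zero, add_mul, Finset.sum_add_distrib, Finset.sum_mul]
    rw [add_assoc]
    refine congrArg₂ (· + ·) rfl (congrArg₂ (· + ·) ?_ ?_)
    · exact Finset.sum_congr rfl fun r _ => by ring
    · rw [Finset.sum_eq_single i (fun r _ hr => by rw [Pi.single_eq_of_ne' hr]; simp) (by simp)]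
      simp

theorem pderiv_bind₁ (j : Fin 5) (l : Fin 5 → MvPolynomial (Fin 5) K)
    (G : MvPolynomial (Fin 5) K) :
    pderiv j (bind₁ l G) = ∑ r, bind₁ l (pderiv r G) * pderiv j (l r) := by
  induction G using MvPolynomial.induction_on with
  | C a => simp
  | add p q hp hq => simp only [map_add, hp, hq, add_mul, Finset.sum_add_distrib]
  | mul_X p i hp =>
    simp only [map_mul, bind₁_X_right, hp, pderiv_mul, pderiv_X, map_add,
      add_mul, Finset.sum_add_distrib, Finset.sum_mul]
    congr 1
    · exact Finset.sum_congr rfl fun r _ => by ring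
    · rw [Finset.sum_eq_single i (fun r _ hr => by simp [hr.symm]) (by simp)]
      simp

theorem linSubst_mul (A B : Matrix (Fin 5) (Fin 5) K) (G : MvPolynomial (Fin 5) K) :
    linSubst B (linSubst A G) = linSubst (A * B) G := by
  unfold linSubst
  rw [bind₁_bind₁]
  congr 2
  funext i
  simp only [map_sum, map_mul, bind₁_X_right, algHom_C, algebraMap_eq, Matrix.mul_apply,
    Finset.mul_sum, Finset.sum_mul]
  rw [Finset.sum_comm]
  simp only [mul_assoc]

theorem linSubst_one (G : MvPolynomial (Fin 5) K) : linSubst 1 G = G := by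
  have : (fun i : Fin 5 => ∑ j, C ((1 : Matrix (Fin 5) (Fin 5) K) i j) * X j) =
      (X : Fin 5 → MvPolynomial (Fin 5) K) := by
    funext i
    rw [Finset.sum_eq_single i (fun j _ hj => by simp [Matrix.one_apply_ne hj.symm]) (by simp)]
    simp
  rw [linSubst, this, bind₁_X_left]
  rfl

theorem isHomogeneous_linSubst (B : Matrix (Fin 5) (Fin 5) K) {G : MvPolynomial (Fin 5) K} {d : ℕ}
    (hG : G.IsHomogeneous d) : (linSubst B G).IsHomogeneous d := by
  have := hG.aeval (fun i => ∑ j, C (B i j) * X j) (n := 1) fun i =>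
    IsHomogeneous.sum _ _ _ fun j _ => by
      simpa using (isHomogeneous_C (Fin 5) (B i j)).mul (isHomogeneous_X K j)
  rwa [one_mul] at this

theorem aeval_linSubst {S : Type*} [CommRing S] [Algebra K S] (B : Matrix (Fin 5) (Fin 5) K)
    (v : Fin 5 → S) (G : MvPolynomial (Fin 5) K) :
    aeval v (linSubst B G) = aeval (fun i => ∑ j, algebraMap K S (B i j) * v j) G := by
  rw [linSubst, aeval_bind₁]
  simp

theorem coeffDer_map {L : Type*} [CommRing L] (j : K →+* L) {δ : Derivation ℤ K K}
    {δ' : Derivation ℤ L L} (h : ∀ a, δ' (j a) = j (δ a)) (G : MvPolynomial (Fin 5) K) :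
    coeffDer δ' (map j G) = map j (coeffDer δ G) := by
  ext s
  rw [coeff_coeffDer, coeff_map, coeff_map, coeff_coeffDer, h]

theorem coeffDer_linSubst_of_eq_zero {δ : Derivation ℤ K K} {B : Matrix (Fin 5) (Fin 5) K}
    (h : ∀ i j, δ (B i j) = 0) (G : MvPolynomial (Fin 5) K) :
    coeffDer δ (linSubst B G) = linSubst B (coeffDer δ G) := by
  rw [linSubst, coeffDer_aeval, add_eq_left]
  refine Finset.sum_eq_zero fun r _ => ?_
  rw [coeffDer_sum, Finset.sum_eq_zero, mul_zero]
  intro j _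
  rw [coeffDer_mul, coeffDer_C, h, coeffDer_X, C_0]
  ring

theorem coeffDer_linSubst_of_eq_neg {δ : Derivation ℤ K K} {B : Matrix (Fin 5) (Fin 5) K}
    {i j : Fin 5} (h : ∀ r m, δ (B r m) = if m = j then - B r i else 0) {G : MvPolynomial (Fin 5) K}
    (hG : coeffDer δ G = 0) :
    coeffDer δ (linSubst B G) = -(X j * pderiv i (linSubst B G)) := by
  rw [linSubst, coeffDer_aeval, hG, map_zero, zero_add, pderiv_bind₁, Finset.mul_sum,
    ← Finset.sum_neg_distrib]
  refine Finset.sum_congr rfl fun r _ => ?_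
  have h1 : coeffDer δ (∑ m, C (B r m) * X m) = -(C (B r i) * X j) := by
    rw [coeffDer_sum, Finset.sum_eq_single j]
    · simp [coeffDer_mul, h]
    · intro m _ hm
      simp [coeffDer_mul, h, hm]
    · simp
  have h2 : pderiv i (∑ m, C (B r m) * X m) = C (B r i) := by
    rw [map_sum, Finset.sum_eq_single i]
    · simp
    · intro m _ hm
      simp [pderiv_X, hm]
    · simp
  rw [h1, h2]
  ring

theorem Derivation.map_inv_matrix {n : Type*} [Fintype n] [DecidableEq n] (δ : Derivation ℤ K K)
    {B C : Matrix n n K} (h : C * B = 1) : C.map δ = -(C * B.map δ * C) := by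
  have h' : B * C = 1 := mul_eq_one_comm.mp h
  have h1 : C.map δ * B + C * B.map δ = 0 := by
    ext i j
    have := congrArg δ (congrFun (congrFun h i) j)
    rw [Matrix.mul_apply, map_sum] at this
    simp only [Derivation.leibniz, smul_eq_mul, Finset.sum_add_distrib] at this
    rw [Matrix.add_apply, Matrix.mul_apply, Matrix.mul_apply, add_comm]
    simp only [Matrix.map_apply, Matrix.zero_apply]
    rw [Finset.sum_congr rfl (fun m _ => mul_comm (δ (C i m)) (B m j)), this, Matrix.one_apply]
    split_ifs <;> simp
  calc C.map δ = C.map δ * B * C := by rw [Matrix.mul_assoc, h', Matrix.mul_one]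
    _ = -(C * B.map δ * C) := by rw [eq_neg_of_add_eq_zero_left h1, Matrix.neg_mul]

end LinearSubstitution

section NoCurve

theorem exists_derivation_linSubst_eq_monomial {k K : Type*} [Field k] [CharZero k] [Field K]
    [Algebra k K] {d : ℕ} {F : MvPolynomial (Fin 5) k} (hF : F.IsHomogeneous d)
    (hind : AlgebraicIndependent ℚ fun s : {s : Fin 5 →₀ ℕ // s.degree = d} => coeff s.1 F)
    {b : Fin 5 × Fin 5 → K} (hb : AlgebraicIndependent k b)
    {B' : Matrix (Fin 5) (Fin 5) K} (hB : B' * Matrix.of (fun i j => b (i, j)) = 1)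
    {s : Fin 5 →₀ ℕ} (hs : s.degree = d) :
    ∃ δ : Derivation ℤ K K, coeffDer δ (linSubst (Matrix.of fun i j => b (i, j))
      (map (algebraMap k K) F)) = monomial s 1 := by
  have : CharZero K := charZero_of_injective_algebraMap (algebraMap k K).injective
  have hG : (linSubst B' (monomial s (1 : K))).IsHomogeneous d :=
    isHomogeneous_linSubst B' (isHomogeneous_monomial 1 hs)
  obtain ⟨δ, -, hδ⟩ := (hind.sumElim_comp hb).exists_derivation
    (Sum.elim (fun _ => (0 : K)) fun t => coeff t.1 (linSubst B' (monomial s (1 : K))))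
  refine ⟨δ, ?_⟩
  have hcd : coeffDer δ (map (algebraMap k K) F) = linSubst B' (monomial s (1 : K)) := by
    ext t
    rw [coeff_coeffDer, coeff_map]
    by_cases ht : t.degree = d
    · exact hδ (Sum.inr ⟨t, ht⟩)
    · rw [hF.coeff_eq_zero ht, hG.coeff_eq_zero ht, map_zero, map_zero]
  have hz : ∀ i j, δ (Matrix.of (fun i j => b (i, j)) i j) = 0 := fun i j => hδ (Sum.inl (i, j))
  rw [coeffDer_linSubst_of_eq_zero hz, hcd, linSubst_mul, hB,
    linSubst_one]

theorem exists_derivation_linSubst_eq_neg {k K : Type*} [Field k] [CharZero k] [Field K]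
    [Algebra k K] (F : MvPolynomial (Fin 5) k)
    {b : Fin 5 × Fin 5 → K} (hb : AlgebraicIndependent k b)
    {B' : Matrix (Fin 5) (Fin 5) K} (hB : B' * Matrix.of (fun i j => b (i, j)) = 1)
    (i j : Fin 5) :
    ∃ δ : Derivation ℤ K K, (∀ c : k, δ (algebraMap k K c) = 0) ∧
      coeffDer δ (linSubst (Matrix.of fun i j => b (i, j)) (map (algebraMap k K) F)) =
        -(X j * pderiv i (linSubst (Matrix.of fun i j => b (i, j)) (map (algebraMap k K) F))) ∧
      ∀ r m, δ (B' r m) = if r = i then B' j m else 0 := by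
  obtain ⟨δ, hk, hδ⟩ := hb.exists_derivation fun p => if p.2 = j then - b (p.1, i) else 0
  refine ⟨δ, hk, ?_, fun r m => ?_⟩
  · refine coeffDer_linSubst_of_eq_neg (fun r m => hδ (r, m)) ?_
    ext s
    rw [coeff_coeffDer, coeff_map, hk, coeff_zero]
  · have h1 : (Matrix.of fun i j => b (i, j)).map δ =
        -(Matrix.of (fun i j => b (i, j)) * Matrix.single i j 1) := by
      ext r m
      rw [Matrix.map_apply, Matrix.of_apply, hδ, Matrix.neg_apply]
      by_cases hm : m = j
      · subst hm
        simp
      · rw [Matrix.mul_single_apply_of_ne _ _ _ _ _ hm]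
        simp [hm]
    have h2 := congrFun (congrFun (Derivation.map_inv_matrix δ hB) r) m
    rw [h1, Matrix.mul_neg, Matrix.neg_mul, neg_neg, ← Matrix.mul_assoc, hB, Matrix.one_mul] at h2
    rw [Matrix.map_apply] at h2
    rw [h2]
    split_ifs with hr
    · subst hr; simp
    · rw [Matrix.single_mul_apply_of_ne _ _ _ _ _ hr]

theorem natDegree_sum_C_mul_le {K : Type*} [Field K] {n : ℕ} (c : Fin 5 → K)
    {f : Fin 5 → Polynomial K} (hf : ∀ i, (f i).natDegree ≤ n) :
    (∑ j, Polynomial.C (c j) * f j).natDegree ≤ n :=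
  Polynomial.natDegree_sum_le_of_forall_le _ _ fun j _ =>
    (Polynomial.natDegree_C_mul_le _ _).trans (hf j)

theorem false_of_algebraicIndependent_coeff_of_matrix {k K : Type*} (L : Type*) [Field k] [CharZero k]
    [Field K] [CharZero K] [Algebra k K] [Field L] [CharZero L] [Algebra (Polynomial K) L]
    [IsFractionRing (Polynomial K) L] {d e : ℕ}
    (hd : 6 ≤ d) (he : 1 ≤ e) {F : MvPolynomial (Fin 5) k} (hF : F.IsHomogeneous d)
    (hind : AlgebraicIndependent ℚ fun s : {s : Fin 5 →₀ ℕ // s.degree = d} => coeff s.1 F)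
    {b : Fin 5 × Fin 5 → K} (hb : AlgebraicIndependent k b)
    (hdet : (Matrix.of fun i j => b (i, j)).det ≠ 0)
    {f : Fin 5 → Polynomial k} (hspan : Ideal.span (Set.range f) = ⊤)
    (hdeg : ∀ i, (f i).natDegree ≤ e) (hexists : ∃ i, (f i).natDegree = e)
    (heval : aeval f F = 0) : False := by
  let B : Matrix (Fin 5) (Fin 5) K := Matrix.of fun i j => b (i, j)
  have hB : B⁻¹ * B = 1 := Matrix.nonsing_inv_mul B (isUnit_iff_ne_zero.mpr hdet)
  have hB' : B * B⁻¹ = 1 := Matrix.mul_nonsing_inv B (isUnit_iff_ne_zero.mpr hdet)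
  let j : K →+* L := (algebraMap (Polynomial K) L).comp Polynomial.C
  let G : MvPolynomial (Fin 5) K := linSubst B (map (algebraMap k K) F)
  have hG : G.IsHomogeneous d := isHomogeneous_linSubst B (hF.map _)
  let f₀ : Fin 5 → Polynomial K := fun i => (f i).map (algebraMap k K)
  let g : Fin 5 → Polynomial K := fun i => ∑ m, Polynomial.C (B⁻¹ i m) * f₀ m
  have hf₀ : ∀ i, (f₀ i).natDegree = (f i).natDegree := fun i => Polynomial.natDegree_map _
  have hBg : ∀ i, f₀ i = ∑ m, Polynomial.C (B i m) * g m := by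
    intro i
    simp only [g, Finset.mul_sum]
    rw [Finset.sum_comm]
    simp only [← mul_assoc, ← Polynomial.C_mul]
    simp only [← Finset.sum_mul, ← map_sum, ← Matrix.mul_apply, hB', Matrix.one_apply]
    simp
  have hgdeg : ∀ i, (g i).natDegree ≤ e := fun i =>
    natDegree_sum_C_mul_le _ fun m => (hf₀ m).le.trans (hdeg m)
  obtain ⟨D, hD⟩ := Derivation.exists_extends_derivative (K := K) (L := L)
  have hsys : CurveSystem d e (map j G) g D :=
    { hd := hd
      he := he
      homF := hG.map j
      coeffF := fun s => ⟨Polynomial.C (coeff s G), by simp, by rw [coeff_map]; rfl⟩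
      span_f := by
        rw [eq_top_iff]
        have h1 : Ideal.span (Set.range f₀) = ⊤ := by
          have : Set.range f₀ = Polynomial.mapRingHom (algebraMap k K) '' Set.range f := by
            rw [← Set.range_comp]; rfl
          rw [this, ← Ideal.map_span, hspan, Ideal.map_top]
        rw [← h1, Ideal.span_le]
        rintro _ ⟨i, rfl⟩
        rw [hBg]
        exact Ideal.sum_mem _ fun m _ => Ideal.mul_mem_left _ _ (Ideal.subset_span ⟨m, rfl⟩)
      deg_f := hgdeg
      exists_deg := by
        by_contra! hne
        obtain ⟨i, hi⟩ := hexists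
        have h1 : (f₀ i).natDegree ≤ e - 1 := by
          rw [hBg]
          exact natDegree_sum_C_mul_le _ fun m => by
            have := hgdeg m
            have := hne m
            omega
        rw [hf₀, hi] at h1
        omega
      eval_f := by
        have h1 : aeval g G = 0 := by
          rw [aeval_linSubst, aeval_map_algebraMap]
          have h2 : (fun i => ∑ m, algebraMap K (Polynomial K) (B i m) * g m) = f₀ :=
            funext fun i => (hBg i).symm
          rw [h2]
          have h3 := congrArg (Polynomial.mapAlgHom (Algebra.ofId k K)) heval
          rw [map_zero] at h3
          rw [← h3, ← AlgHom.comp_apply, comp_aeval]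
          rfl
        have h2 := congrArg (algebraMap (Polynomial K) L) h1
        rw [map_zero, aeval_def, eval₂_comp_left] at h2
        rw [MvPolynomial.eval_map]
        exact h2
      D_apply := hD
      monomial_lift := fun s hs => by
        obtain ⟨δ, hδ⟩ := exists_derivation_linSubst_eq_monomial hF hind hb hB hs
        obtain ⟨δ', hc, hδ'⟩ := Derivation.exists_isCoeffwise (L := L) δ
        refine ⟨δ', hc, ?_⟩
        rw [coeffDer_map j hδ', hδ, map_monomial, map_one]
      linear_lift := fun i m => by
        obtain ⟨δ, hk, hδ, hinv⟩ := exists_derivation_linSubst_eq_neg F hb hB i m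
        obtain ⟨δ', hc, hδ'⟩ := Derivation.exists_isCoeffwise (L := L) δ
        refine ⟨δ', hc, ?_, fun r => ?_⟩
        · rw [coeffDer_map j hδ', hδ, map_neg, map_mul, map_X, pderiv_map]
        · have hz : ∀ p : Polynomial k, δ' (algebraMap (Polynomial K) L (p.map (algebraMap k K))) = 0 := by
            intro p
            induction p using Polynomial.induction_on' with
            | add p q hp hq => rw [Polynomial.map_add, map_add, map_add, hp, hq, add_zero]
            | monomial n a =>
              rw [← Polynomial.C_mul_X_pow_eq_monomial, Polynomial.map_mul, Polynomial.map_C,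
                Polynomial.map_pow, Polynomial.map_X, map_mul, map_pow, δ'.leibniz, δ'.leibniz_pow,
                hδ', hk, hc.2]
              simp
          have h1 : δ' (polyVec L g r) =
              ∑ l, algebraMap (Polynomial K) L (Polynomial.C (δ (B⁻¹ r l)) * f₀ l) := by
            simp only [polyVec, g, map_sum]
            refine Finset.sum_congr rfl fun l _ => ?_
            rw [map_mul, δ'.leibniz, hz, hδ', smul_zero, zero_add, map_mul, smul_eq_mul, mul_comm]
          rw [h1]
          split_ifs with hr
          · simp only [hinv, hr, if_true, polyVec, g, map_sum]
          · simp [hinv, hr] }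
  exact hsys.false

/-- A hypersurface of degree at least six in `ℙ⁴` whose coefficients are algebraically independent
contains no rational curve. -/
theorem false_of_algebraicIndependent_coeff {k : Type*} [Field k] [CharZero k] {d e : ℕ}
    (hd : 6 ≤ d) (he : 1 ≤ e) {F : MvPolynomial (Fin 5) k} (hF : F.IsHomogeneous d)
    (hind : AlgebraicIndependent ℚ fun s : {s : Fin 5 →₀ ℕ // s.degree = d} => coeff s.1 F)
    {f : Fin 5 → Polynomial k} (hspan : Ideal.span (Set.range f) = ⊤)
    (hdeg : ∀ i, (f i).natDegree ≤ e) (hexists : ∃ i, (f i).natDegree = e)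
    (heval : aeval f F = 0) : False := by
  let K := FractionRing (MvPolynomial (Fin 5 × Fin 5) k)
  let L := FractionRing (Polynomial K)
  have : CharZero K := charZero_of_injective_algebraMap (algebraMap k K).injective
  have : CharZero L := charZero_of_injective_algebraMap (algebraMap K L).injective
  let b : Fin 5 × Fin 5 → K := fun p => algebraMap (MvPolynomial (Fin 5 × Fin 5) k) K (X p)
  have hb : AlgebraicIndependent k b :=
    (algebraicIndependent_X (Fin 5 × Fin 5) k).map' (f := IsScalarTower.toAlgHom k _ K)
      (IsFractionRing.injective (MvPolynomial (Fin 5 × Fin 5) k) K)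
  let B : Matrix (Fin 5) (Fin 5) K := Matrix.of fun i j => b (i, j)
  have hdet : B.det ≠ 0 := by
    have h1 : B = (algebraMap (MvPolynomial (Fin 5 × Fin 5) k) K).mapMatrix
        (Matrix.mvPolynomialX (Fin 5) (Fin 5) k) := rfl
    rw [h1, ← RingHom.map_det]
    exact (map_ne_zero_iff _ (IsFractionRing.injective _ K)).mpr
      (Matrix.det_mvPolynomialX_ne_zero (Fin 5) k)
  exact false_of_algebraicIndependent_coeff_of_matrix L hd he hF hind hb hdet hspan hdeg hexists heval

end NoCurve

section Family

theorem exists_homogeneous_coeff_eq {d : ℕ} (t : Finset {s : Fin 5 →₀ ℕ // s.degree = d})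
    (v : {s : Fin 5 →₀ ℕ // s.degree = d} → ℂ) :
    ∃ F : homogeneousSubmodule (Fin 5) ℂ d, ∀ s ∈ t, coeff s.1 (F : MvPolynomial (Fin 5) ℂ) = v s := by
  classical
  refine ⟨∑ s ∈ t, ⟨monomial s.1 (v s), isHomogeneous_monomial _ s.2⟩, fun s hs => ?_⟩
  rw [AddSubmonoidClass.coe_finsetSum, coeff_sum, Finset.sum_eq_single s]
  · simp
  · intro r _ hr
    simp [coeff_monomial, Subtype.coe_injective.ne hr]
  · exact fun h => absurd hs h

/-- Countably many nonzero polynomial conditions on a form force its coefficients to be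
algebraically independent over `ℚ`. -/
theorem exists_conditions_algebraicIndependent (d : ℕ) :
    ∃ P : ℕ → MvPolynomial (Fin 5 →₀ ℕ) ℂ,
      (∀ i, ∃ F : ↥(homogeneousSubmodule (Fin 5) ℂ d), coeffPolyEval d (P i) F ≠ 0) ∧
      ∀ F : ↥(homogeneousSubmodule (Fin 5) ℂ d), (∀ i, coeffPolyEval d (P i) F ≠ 0) →
        AlgebraicIndependent ℚ fun s : {s : Fin 5 →₀ ℕ // s.degree = d} =>
          coeff s.1 (F : MvPolynomial (Fin 5) ℂ) := by
  let Q := {q : MvPolynomial {s : Fin 5 →₀ ℕ // s.degree = d} ℚ // q ≠ 0}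
  have : Nonempty Q := ⟨⟨1, one_ne_zero⟩⟩
  have : Countable (MvPolynomial {s : Fin 5 →₀ ℕ // s.degree = d} ℚ) := by
    rw [← Cardinal.mk_le_aleph0_iff]
    exact cardinalMk_le_max.trans (by simp [Cardinal.mk_le_aleph0])
  obtain ⟨q, hq⟩ := exists_surjective_nat Q
  have key : ∀ i (F : ↥(homogeneousSubmodule (Fin 5) ℂ d)),
      coeffPolyEval d (rename Subtype.val (map (algebraMap ℚ ℂ) (q i).1)) F =
        aeval (fun s : {s : Fin 5 →₀ ℕ // s.degree = d} =>
          coeff s.1 (F : MvPolynomial (Fin 5) ℂ)) (q i).1 := by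
    intro i F
    rw [coeffPolyEval, eval_rename, MvPolynomial.eval_map, aeval_def]
    rfl
  refine ⟨fun i => rename Subtype.val (map (algebraMap ℚ ℂ) (q i).1), fun i => ?_, fun F hF => ?_⟩
  · have h1 : map (algebraMap ℚ ℂ) (q i).1 ≠ 0 :=
      (map_ne_zero_iff _ (map_injective _ (algebraMap ℚ ℂ).injective)).mpr (q i).2
    obtain ⟨v, hv⟩ : ∃ v, MvPolynomial.eval v (map (algebraMap ℚ ℂ) (q i).1) ≠ 0 := by
      by_contra! h
      exact h1 (MvPolynomial.funext fun v => by rw [h, map_zero])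
    obtain ⟨F, hF⟩ := exists_homogeneous_coeff_eq (q i).1.vars v
    refine ⟨F, ?_⟩
    rw [key]
    rw [MvPolynomial.eval_map] at hv
    rwa [aeval_def, eval₂_congr _ _ v]
    intro s c hs hc
    exact hF s ((mem_vars_iff_mem_support s).mpr ⟨c, mem_support_iff.mpr hc, hs⟩)
  · rw [algebraicIndependent_iff]
    intro p hp
    by_contra h
    obtain ⟨i, hi⟩ := hq ⟨p, h⟩
    refine hF i ?_
    rw [key, hi, hp]

end Family

instance isPrime_asHomogeneousIdeal {σ : Type} {A : Type} [CommRing A] [SetLike σ A]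
    [AddSubgroupClass σ A] (𝒜 : ℕ → σ) [GradedRing 𝒜] (x : Proj 𝒜) :
    x.asHomogeneousIdeal.toIdeal.IsPrime :=
  x.isPrime

theorem fromSpecStalk_toSpecZero {σ : Type} {A : Type} [CommRing A] [SetLike σ A]
    [AddSubgroupClass σ A] (𝒜 : ℕ → σ) [GradedRing 𝒜] (x : Proj 𝒜) :
    (Proj 𝒜).fromSpecStalk x ≫ Proj.toSpecZero 𝒜 =
      Spec.map (CommRingCat.ofHom (HomogeneousLocalization.fromZeroRingHom 𝒜
        x.asHomogeneousIdeal.toIdeal.primeCompl) ≫ (Proj.stalkIso 𝒜 x).inv) := by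
  have hx : x ∈ Proj.basicOpen 𝒜 1 := by
    rw [Proj.basicOpen_one]; trivial
  have h₁ : (Proj 𝒜).fromSpecStalk x ≫ (Scheme.topIso (Proj 𝒜)).inv ≫
      (Scheme.isoOfEq _ (Proj.basicOpen_one 𝒜)).inv =
      (Proj.basicOpen 𝒜 1).fromSpecStalkOfMem x hx := by
    rw [← cancel_mono (Proj.basicOpen 𝒜 1).ι, Scheme.Opens.fromSpecStalkOfMem_ι]
    simp
  rw [Proj.toSpecZero, Proj.basicOpenToSpec, reassoc_of% h₁,
    Category.assoc, Scheme.Opens.fromSpecStalkOfMem_toSpecΓ_assoc, ← Spec.map_comp,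
    ← Spec.map_comp]
  congr 1

theorem fromSpecStalk_structMap (n : ℕ) (x : ProjSpace n) :
    (ProjSpace n).fromSpecStalk x ≫ ProjSpace.structMap n =
      Spec.map (CommRingCat.ofHom ((HomogeneousLocalization.fromZeroRingHom
        (homogeneousSubmodule (Fin (n + 1)) ℂ) x.asHomogeneousIdeal.toIdeal.primeCompl).comp
        (algebraMap ℂ (homogeneousSubmodule (Fin (n + 1)) ℂ 0))) ≫
        (Proj.stalkIso (homogeneousSubmodule (Fin (n + 1)) ℂ) x).inv) := by
  rw [ProjSpace.structMap, reassoc_of% fromSpecStalk_toSpecZero, ← Spec.map_comp]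
  rfl

/-- A morphism of `ℂ`-schemes between projective spaces induces local `ℂ`-algebra maps
between the degree zero localizations at points. -/
theorem exists_localHom_atPrime {m n : ℕ} (φ : ProjSpace m ⟶ ProjSpace n)
    (hφ : φ ≫ ProjSpace.structMap n = ProjSpace.structMap m) (x : ProjSpace m) :
    ∃ ψ : HomogeneousLocalization.AtPrime (homogeneousSubmodule (Fin (n + 1)) ℂ)
        (φ.base x).asHomogeneousIdeal.toIdeal →+*
        HomogeneousLocalization.AtPrime (homogeneousSubmodule (Fin (m + 1)) ℂ)
        x.asHomogeneousIdeal.toIdeal, IsLocalHom ψ ∧ ∀ c : ℂ,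
        ψ (HomogeneousLocalization.fromZeroRingHom _ _ (algebraMap ℂ _ c)) =
          HomogeneousLocalization.fromZeroRingHom _ _ (algebraMap ℂ _ c) := by
  have h := Scheme.SpecMap_stalkMap_fromSpecStalk φ (x := x)
  have h₁ := congrArg (· ≫ ProjSpace.structMap n) h
  simp only [Category.assoc, hφ] at h₁
  rw [fromSpecStalk_structMap] at h₁
  erw [fromSpecStalk_structMap] at h₁
  rw [← Spec.map_comp] at h₁
  have h₂ := Spec.map_injective h₁
  let e₁ := (Proj.stalkIso (homogeneousSubmodule (Fin (n + 1)) ℂ) (φ.base x)).inv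
  let e₂ := (Proj.stalkIso (homogeneousSubmodule (Fin (m + 1)) ℂ) x).hom
  refine ⟨(e₁ ≫ φ.stalkMap x ≫ e₂).hom, ?_, fun c => ?_⟩
  · have : IsLocalHom (Proj.stalkIso (homogeneousSubmodule (Fin (n + 1)) ℂ) (φ.base x)).inv.hom :=
      isLocalHom_of_isIso _
    have : IsLocalHom (Proj.stalkIso (homogeneousSubmodule (Fin (m + 1)) ℂ) x).hom.hom :=
      isLocalHom_of_isIso _
    refine ⟨fun a ha => ?_⟩
    simp only [CommRingCat.hom_comp, RingHom.coe_comp, Function.comp_apply] at ha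
    exact (isUnit_map_iff e₁.hom a).mp ((isUnit_map_iff (φ.stalkMap x).hom _).mp
      ((isUnit_map_iff e₂.hom _).mp ha))
  · have h₃ := congrArg (fun t => (t ≫ e₂).hom c) h₂
    simp only [e₂, Category.assoc, Iso.inv_hom_id, Category.comp_id] at h₃
    exact h₃

theorem eval₂_const_mul_of_isHomogeneous {σ R S : Type*} [CommRing R] [CommRing S]
    {G : MvPolynomial σ R} {D : ℕ} (hG : G.IsHomogeneous D) (f : R →+* S) (c : S) (v : σ → S) :
    eval₂ f (fun i => c * v i) G = c ^ D * eval₂ f v G := by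
  rw [eval₂_eq, eval₂_eq, Finset.mul_sum]
  refine Finset.sum_congr rfl fun s hs => ?_
  have hs' := degree_eq_of_isHomogeneous hG (mem_support_iff.mp hs)
  simp only [mul_pow, Finset.prod_mul_distrib, Finset.prod_pow_eq_pow_sum]
  rw [← hs', Finsupp.degree_apply]
  ring

/-- Constants in the degree zero localization at a prime. -/
noncomputable abbrev atPrimeConst {σ : Type} (𝔮 : Ideal (MvPolynomial σ ℂ)) [𝔮.IsPrime] :
    ℂ →+* HomogeneousLocalization.AtPrime (homogeneousSubmodule σ ℂ) 𝔮 :=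
  (HomogeneousLocalization.fromZeroRingHom (homogeneousSubmodule σ ℂ) 𝔮.primeCompl).comp
    (algebraMap ℂ (homogeneousSubmodule σ ℂ 0))

theorem pow_mul_val_eval₂ {σ τ : Type} (𝔮 : Ideal (MvPolynomial σ ℂ)) [𝔮.IsPrime]
    {G : MvPolynomial τ ℂ} {D : ℕ} (hG : G.IsHomogeneous D)
    (v : τ → HomogeneousLocalization.AtPrime (homogeneousSubmodule σ ℂ) 𝔮)
    (n : τ → MvPolynomial σ ℂ) (c : MvPolynomial σ ℂ)
    (h : ∀ i, algebraMap _ (Localization 𝔮.primeCompl) c * (v i).val = algebraMap _ _ (n i)) :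
    algebraMap _ (Localization 𝔮.primeCompl) c ^ D * (eval₂ (atPrimeConst 𝔮) v G).val =
      algebraMap _ _ (aeval n G) := by
  have h₁ : (eval₂ (atPrimeConst 𝔮) v G).val =
      eval₂ ((algebraMap (MvPolynomial σ ℂ) (Localization 𝔮.primeCompl)).comp C)
        (fun i => (v i).val) G := by
    rw [← HomogeneousLocalization.algebraMap_apply, hom_eval₂]
    rfl
  rw [h₁, ← eval₂_const_mul_of_isHomogeneous hG]
  simp only [h]
  rw [aeval_def, hom_eval₂]
  rfl

theorem isUnit_mk_atPrime_iff {σ : Type} (𝔮 : Ideal (MvPolynomial σ ℂ)) [𝔮.IsPrime]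
    (a : HomogeneousLocalization.NumDenSameDeg (homogeneousSubmodule σ ℂ) 𝔮.primeCompl) :
    IsUnit (HomogeneousLocalization.mk a) ↔ (a.num : MvPolynomial σ ℂ) ∉ 𝔮 := by
  rw [← HomogeneousLocalization.isUnit_iff_isUnit_val, HomogeneousLocalization.val_mk,
    Localization.mk_eq_mk', IsLocalization.AtPrime.isUnit_mk'_iff _ 𝔮]
  rfl

theorem eq_zero_or_isUnit_atPrime {σ : Type} {𝔟 : Ideal (MvPolynomial σ ℂ)} [𝔟.IsPrime]
    (h𝔟 : 𝔟 = ⊥) (a : HomogeneousLocalization.AtPrime (homogeneousSubmodule σ ℂ) 𝔟) : a = 0 ∨ IsUnit a := by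
  obtain ⟨a, rfl⟩ := a.mk_surjective
  rw [isUnit_mk_atPrime_iff, or_iff_not_imp_right, not_not]
  intro h
  have h : (a.num : MvPolynomial σ ℂ) = 0 := Ideal.mem_bot.mp (h𝔟.le h)
  ext
  rw [HomogeneousLocalization.val_mk, h, Localization.mk_zero, HomogeneousLocalization.val_zero]

/-- A local homomorphism from the degree zero localization at `𝔭` to the one at `0` is given by
homogeneous polynomials of the same degree. -/
theorem exists_homogeneous_of_localHom {σ τ : Type} [Fintype τ] (𝔭 : Ideal (MvPolynomial τ ℂ))
    [𝔭.IsPrime] {k : τ} (hk : X k ∉ 𝔭) {𝔟 : Ideal (MvPolynomial σ ℂ)} [𝔟.IsPrime] (h𝔟 : 𝔟 = ⊥)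
    (ψ : HomogeneousLocalization.AtPrime (homogeneousSubmodule τ ℂ) 𝔭 →+*
      HomogeneousLocalization.AtPrime (homogeneousSubmodule σ ℂ) 𝔟) [IsLocalHom ψ]
    (hψ : ∀ c, ψ (atPrimeConst 𝔭 c) = atPrimeConst 𝔟 c) :
    ∃ (N : ℕ) (n : τ → MvPolynomial σ ℂ), (∀ i, (n i).IsHomogeneous N) ∧
      ∀ {D : ℕ} {G : MvPolynomial τ ℂ}, G.IsHomogeneous D → (G ∈ 𝔭 ↔ aeval n G = 0) := by
  classical
  let u : τ → HomogeneousLocalization.AtPrime (homogeneousSubmodule τ ℂ) 𝔭 := fun i =>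
    .mk ⟨1, ⟨X i, isHomogeneous_X ℂ i⟩, ⟨X k, isHomogeneous_X ℂ k⟩, hk⟩
  have hg : ∀ i, ∃ a, ψ (u i) = HomogeneousLocalization.mk a := fun i => by
    obtain ⟨a, ha⟩ := (ψ (u i)).mk_surjective
    exact ⟨a, ha.symm⟩
  choose a ha using hg
  let m : MvPolynomial σ ℂ := ∏ i, (a i).den
  let n : τ → MvPolynomial σ ℂ := fun i => (a i).num * ∏ j ∈ Finset.univ.erase i, (a j).den
  have hden : ∀ i, ((a i).den : MvPolynomial σ ℂ) ≠ 0 := fun i h =>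
    (a i).den_mem (h ▸ 𝔟.zero_mem)
  have hm : m ≠ 0 := Finset.prod_ne_zero_iff.mpr fun i _ => hden i
  have hmn : ∀ i, algebraMap _ (Localization 𝔟.primeCompl) m * (ψ (u i)).val =
      algebraMap _ _ (n i) := by
    intro i
    rw [ha, HomogeneousLocalization.val_mk, Localization.mk_eq_mk', IsLocalization.mul_mk'_eq_mk'_of_mul,
      IsLocalization.mk'_eq_iff_eq_mul, ← map_mul]
    congr 1
    simp only [m, n]
    rw [← Finset.mul_prod_erase _ _ (Finset.mem_univ i)]
    ring
  refine ⟨∑ i, (a i).deg, n, fun i => ?_, fun {D G} hG => ?_⟩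
  · rw [← Finset.add_sum_erase _ _ (Finset.mem_univ i)]
    exact IsHomogeneous.mul (a i).num.2 (IsHomogeneous.prod _ _ _ fun j _ => (a j).den.2)
  let q : HomogeneousLocalization.AtPrime (homogeneousSubmodule τ ℂ) 𝔭 :=
    .mk ⟨D, ⟨G, hG⟩, ⟨X k ^ D, isHomogeneous_X_pow k D⟩, Submonoid.pow_mem 𝔭.primeCompl hk D⟩
  have hq : q = eval₂ (atPrimeConst 𝔭) u G := by
    have h₁ := pow_mul_val_eval₂ 𝔭 hG u X (X k) fun i => by
      rw [HomogeneousLocalization.val_mk, Localization.mk_eq_mk']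
      exact IsLocalization.mk'_spec' (Localization 𝔭.primeCompl) _ (⟨X k, hk⟩ : 𝔭.primeCompl)
    have hu : IsUnit (algebraMap (MvPolynomial τ ℂ) (Localization 𝔭.primeCompl) (X k) ^ D) :=
      (IsLocalization.map_units (Localization 𝔭.primeCompl) (⟨X k, hk⟩ : 𝔭.primeCompl)).pow D
    ext
    refine hu.mul_left_cancel ?_
    rw [h₁, aeval_X_left_apply, HomogeneousLocalization.val_mk, Localization.mk_eq_mk', ← map_pow]
    exact IsLocalization.mk'_spec' _ _ (⟨X k ^ D, _⟩ : 𝔭.primeCompl)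
  have hψq : ψ q = eval₂ (atPrimeConst 𝔟) (fun i => ψ (u i)) G := by
    rw [hq, hom_eval₂]
    congr 1
    exact RingHom.ext hψ
  have h₂ := pow_mul_val_eval₂ 𝔟 hG (fun i => ψ (u i)) n m hmn
  have hinj : Function.Injective
      (algebraMap (MvPolynomial σ ℂ) (Localization 𝔟.primeCompl)) :=
    IsLocalization.injective (M := 𝔟.primeCompl) _ fun x hx =>
      mem_nonZeroDivisors_of_ne_zero fun h => hx (h ▸ 𝔟.zero_mem)
  have hmu : IsUnit (algebraMap (MvPolynomial σ ℂ) (Localization 𝔟.primeCompl) m ^ D) :=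
    (IsLocalization.map_units (Localization 𝔟.primeCompl) (⟨m, h𝔟 ▸ hm⟩ : 𝔟.primeCompl)).pow D
  have h₃ : G ∈ 𝔭 ↔ ¬ IsUnit q := by
    rw [isUnit_mk_atPrime_iff, not_not]
  rw [h₃, ← isUnit_map_iff ψ]
  have h₄ : ¬ IsUnit (ψ q) ↔ ψ q = 0 :=
    ⟨fun h => (eq_zero_or_isUnit_atPrime h𝔟 _).resolve_right h, fun h h' => by
      rw [h] at h'
      exact not_isUnit_zero h'⟩
  rw [h₄, ← map_eq_zero_iff _ hinj, ← h₂, ← hψq, hmu.mul_right_eq_zero]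
  refine ⟨fun h => by rw [h, HomogeneousLocalization.val_zero], fun h => ?_⟩
  ext
  rw [h, HomogeneousLocalization.val_zero]

theorem eq_zero_of_aeval_dehomogenize {G : MvPolynomial (Fin 2) ℂ} {N : ℕ}
    (hG : G.IsHomogeneous N)
    (h : aeval ![(Polynomial.X : Polynomial ℂ), 1] G = 0) : G = 0 := by
  have h₁ : X 1 * G = 0 := by
    refine MvPolynomial.funext fun v => ?_
    rw [map_mul, eval_X, map_zero, mul_eq_zero, or_iff_not_imp_left]
    intro hv
    have h₂ := congrArg (Polynomial.eval (v 0 / v 1)) h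
    rw [← Polynomial.coe_evalRingHom, aeval_def, hom_eval₂, map_zero] at h₂
    have h₃ := eval₂_const_mul_of_isHomogeneous hG (RingHom.id ℂ) (v 1) ![v 0 / v 1, 1]
    have h₄ : (fun i => v 1 * (![v 0 / v 1, 1] : Fin 2 → ℂ) i) = v := by
      funext i
      fin_cases i
      · exact mul_div_cancel₀ _ hv
      · exact mul_one _
    rw [h₄] at h₃
    have h₅ : eval₂ (RingHom.id ℂ) ![v 0 / v 1, 1] G = 0 := by
      rw [← h₂]
      congr 1
      · ext c
        simp
      · funext i
        fin_cases i <;> simp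
    rw [h₅, mul_zero] at h₃
    exact h₃
  exact (mul_eq_zero.mp h₁).resolve_left (X_ne_zero 1)

/-- Five binary forms of the same degree satisfying a sufficiently general equation of degree at
least six are proportional. -/
theorem exists_proportional_of_aeval_eq_zero {d : ℕ} (hd : 6 ≤ d) {F : MvPolynomial (Fin 5) ℂ}
    (hF : F.IsHomogeneous d)
    (hind : AlgebraicIndependent ℚ fun s : {s : Fin 5 →₀ ℕ // s.degree = d} => coeff s.1 F)
    {N : ℕ} {n : Fin 5 → MvPolynomial (Fin 2) ℂ} (hn : ∀ i, (n i).IsHomogeneous N)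
    (heval : aeval n F = 0) {k : Fin 5} (hk : n k ≠ 0) :
    ∃ c : Fin 5 → ℂ, ∀ i, n i = C (c i) * n k := by
  let f : Fin 5 → Polynomial ℂ := fun i => aeval ![(Polynomial.X : Polynomial ℂ), 1] (n i)
  have hfk : f k ≠ 0 := fun h => hk (eq_zero_of_aeval_dehomogenize (hn k) h)
  have hf : aeval f F = 0 := by
    have := congrArg (aeval ![(Polynomial.X : Polynomial ℂ), 1]) heval
    rwa [map_zero, comp_aeval_apply] at this
  have hinj := IsFractionRing.injective (Polynomial ℂ) (RatFunc ℂ)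
  obtain ⟨c, q, hc, hq, hspan⟩ := exists_smul_eq_algebraMap_of_ne_zero (R := Polynomial ℂ)
    (L := RatFunc ℂ) (p := fun i => algebraMap (Polynomial ℂ) (RatFunc ℂ) (f i)) fun h =>
      hfk ((map_eq_zero_iff _ hinj).mp (congrFun h k))
  have hqF : aeval q F = 0 := by
    apply hinj
    rw [map_zero, aeval_def, hom_eval₂]
    simp only [hq]
    rw [eval₂_const_mul_of_isHomogeneous hF]
    have h₁ := congrArg (algebraMap (Polynomial ℂ) (RatFunc ℂ)) hf
    rw [map_zero, aeval_def, hom_eval₂] at h₁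
    rw [h₁, mul_zero]
  by_cases hdeg : ∃ i, (q i).natDegree ≠ 0
  · obtain ⟨i, hi⟩ := hdeg
    obtain ⟨j, -, hj⟩ := Finset.exists_max_image Finset.univ (fun i => (q i).natDegree) ⟨i, Finset.mem_univ i⟩
    exact (false_of_algebraicIndependent_coeff hd
      ((Nat.one_le_iff_ne_zero.mpr hi).trans (hj i (Finset.mem_univ i))) hF hind hspan
      (fun i => hj i (Finset.mem_univ i)) ⟨j, rfl⟩ hqF).elim
  · push Not at hdeg
    choose a ha using fun i => Polynomial.natDegree_eq_zero.mp (hdeg i)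
    have hak : a k ≠ 0 := by
      intro h
      have := hq k
      rw [← ha k, h, map_zero, map_zero] at this
      exact mul_ne_zero hc ((map_ne_zero_iff _ hinj).mpr hfk) this.symm
    refine ⟨fun i => a i / a k, fun i => sub_eq_zero.mp ?_⟩
    refine eq_zero_of_aeval_dehomogenize (N := N)
      ((hn i).sub (by simpa using (isHomogeneous_C _ (a i / a k)).mul (hn k))) ?_
    rw [map_sub, map_mul, aeval_C, sub_eq_zero]
    apply hinj
    refine mul_left_cancel₀ hc ?_
    rw [map_mul, mul_left_comm, ← hq i, ← hq k, ← ha i, ← ha k, ← map_mul]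
    rw [Polynomial.algebraMap_eq, ← Polynomial.C_mul, div_mul_cancel₀ _ hak]

theorem exists_X_notMem {m : ℕ} (x : ProjSpace m) : ∃ k, X k ∉ x.asHomogeneousIdeal.toIdeal := by
  by_contra! h
  refine x.not_irrelevant_le fun f hf => ?_
  have hle : Ideal.span (X '' (Set.univ : Set (Fin (m + 1)))) ≤ x.asHomogeneousIdeal.toIdeal := by
    rw [Ideal.span_le]
    rintro _ ⟨i, -, rfl⟩
    exact h i
  refine hle (mem_ideal_span_X_image.mpr fun s hs => ?_)
  by_contra! hs0
  have hs0' : s = 0 := Finsupp.ext fun i => hs0 i (Set.mem_univ i)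
  have hf' := (HomogeneousIdeal.mem_irrelevant_iff _ f).mp hf
  have hf'' : homogeneousComponent 0 f = 0 :=
    (decomposition.decompose'_apply f 0).symm.trans hf'
  have := congrArg (coeff 0) hf''
  rw [coeff_homogeneousComponent] at this
  simp at this
  rw [hs0', mem_support_iff] at hs
  exact hs this

/-- The generic point of projective space. -/
noncomputable def ProjSpace.genericPoint (m : ℕ) : ProjSpace m where
  asHomogeneousIdeal := ⊥
  isPrime := by
    rw [HomogeneousIdeal.toIdeal_bot]
    exact Ideal.isPrime_bot
  not_irrelevant_le h := by
    have h₁ : (X 0 : MvPolynomial (Fin (m + 1)) ℂ) ∈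
        HomogeneousIdeal.irrelevant (homogeneousSubmodule (Fin (m + 1)) ℂ) :=
      HomogeneousIdeal.mem_irrelevant_of_mem _ one_pos (isHomogeneous_X ℂ 0)
    exact X_ne_zero (0 : Fin (m + 1)) (h h₁)

theorem map_genericPoint_le {m n : ℕ} (φ : ProjSpace m ⟶ ProjSpace n) (x : ProjSpace m) :
    (φ.base (ProjSpace.genericPoint m)).asHomogeneousIdeal ≤ (φ.base x).asHomogeneousIdeal := by
  have h₁ : ProjSpace.genericPoint m ⤳ x := by
    rw [specializes_iff_mem_closure]
    exact (ProjectiveSpectrum.le_iff_mem_closure _ (ProjSpace.genericPoint m) x).mp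
      (bot_le : (⊥ : HomogeneousIdeal _) ≤ x.asHomogeneousIdeal)
  have h₂ := h₁.map φ.continuous
  rw [specializes_iff_mem_closure] at h₂
  exact (ProjectiveSpectrum.le_iff_mem_closure _ (φ.base (ProjSpace.genericPoint m)) (φ.base x)).mpr h₂

theorem map_eq_map_genericPoint {m n : ℕ} (φ : ProjSpace m ⟶ ProjSpace n) {k : Fin (n + 1)}
    {c : Fin (n + 1) → ℂ}
    (hc : ∀ i, X i - C (c i) * X k ∈ (φ.base (ProjSpace.genericPoint m)).asHomogeneousIdeal)
    (x : ProjSpace m) : φ.base x = φ.base (ProjSpace.genericPoint m) := by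
  set 𝔭 := (φ.base (ProjSpace.genericPoint m)).asHomogeneousIdeal
  set 𝔮 := (φ.base x).asHomogeneousIdeal with h𝔮
  have hle : 𝔭 ≤ 𝔮 := map_genericPoint_le φ x
  have hprime : 𝔮.toIdeal.IsPrime := (φ.base x).isPrime
  have hk : X k ∉ 𝔮.toIdeal := by
    intro hk
    obtain ⟨i, hi⟩ := exists_X_notMem (φ.base x)
    refine hi ?_
    have := 𝔮.toIdeal.add_mem (hle (hc i)) (𝔮.toIdeal.mul_mem_left (C (c i)) hk)
    rwa [sub_add_cancel] at this
  -- Modulo `𝔭`, a form `G` of degree `D` is congruent to `G(c) X_k ^ D`.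
  have hcongr : ∀ {D : ℕ} {G : MvPolynomial (Fin (n + 1)) ℂ}, G.IsHomogeneous D →
      G - C (MvPolynomial.eval c G) * X k ^ D ∈ 𝔭.toIdeal := by
    intro D G hG
    have h₁ : (Ideal.Quotient.mk 𝔭.toIdeal) G =
        eval₂ ((Ideal.Quotient.mk 𝔭.toIdeal).comp C)
          (fun i => Ideal.Quotient.mk 𝔭.toIdeal (X k) * Ideal.Quotient.mk 𝔭.toIdeal (C (c i))) G := by
      conv_lhs => rw [← eval₂_eta G, hom_eval₂]
      congr 1
      funext i
      rw [← map_mul, Ideal.Quotient.eq, mul_comm]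
      exact hc i
    rw [← Ideal.Quotient.eq, h₁, eval₂_const_mul_of_isHomogeneous hG, mul_comm, map_mul, map_pow]
    congr 1
    rw [← RingHom.comp_apply, MvPolynomial.eval, coe_eval₂Hom, hom_eval₂]
    rfl
  have hge : 𝔮 ≤ 𝔭 := by
    intro f hf
    refine (mem_iff_homogeneousComponent_mem 𝔭.isHomogeneous f).mpr fun D => ?_
    have hG := homogeneousComponent_isHomogeneous D f
    set G := homogeneousComponent D f with hGdef
    have hG𝔮 : G ∈ 𝔮.toIdeal := (mem_iff_homogeneousComponent_mem 𝔮.isHomogeneous f).mp hf D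
    have h₁ := 𝔮.toIdeal.sub_mem hG𝔮 (hle (hcongr hG))
    rw [sub_sub_cancel] at h₁
    have h₂ : MvPolynomial.eval c G = 0 := by
      by_contra hne
      refine (hprime.mem_or_mem h₁).elim (fun h => hprime.ne_top ?_)
        fun h => hk (hprime.mem_of_pow_mem D h)
      exact Ideal.eq_top_of_isUnit_mem _ h ((isUnit_iff_ne_zero.mpr hne).map C)
    have h₃ := hcongr hG
    rwa [h₂, map_zero, zero_mul, sub_zero] at h₃
  exact ProjectiveSpectrum.ext (le_antisymm hge hle)

/-- for `d ≥ 6` and a very general degree-`d` form `F` on `ℙ⁴_ℂ` (i.e. a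
countable family of nonzero polynomial functions on `𝓛_d` covers all `F` for which the
conclusion fails), every morphism of `ℂ`-schemes `ℙ¹_ℂ ⟶ ℙ⁴_ℂ` whose set-theoretic
image lies in the hypersurface `V₊(F)` is constant.  Since `ℙ¹` is reduced, morphisms
`ℙ¹ ⟶ V₊(F)` correspond exactly to such morphisms to `ℙ⁴`; so a very general sextic
threefold contains no rational curves. -/
theorem stmt_0 (d : ℕ) (hd : 6 ≤ d) :
    ∃ P : ℕ → MvPolynomial (Fin 5 →₀ ℕ) ℂ,
      (∀ i, ∃ F : ↥(homogeneousSubmodule (Fin 5) ℂ d), coeffPolyEval d (P i) F ≠ 0) ∧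
      ∀ F : ↥(homogeneousSubmodule (Fin 5) ℂ d), (∀ i, coeffPolyEval d (P i) F ≠ 0) →
        ∀ φ : ProjSpace 1 ⟶ ProjSpace 4,
          φ ≫ ProjSpace.structMap 4 = ProjSpace.structMap 1 →
          (∀ x : ↥(ProjSpace 1),
            (F : MvPolynomial (Fin 5) ℂ) ∈ (φ.base x).asHomogeneousIdeal) →
          ∃ pt : ↥(ProjSpace 4), ∀ x : ↥(ProjSpace 1), φ.base x = pt := by
  obtain ⟨P, hP, hPF⟩ := exists_conditions_algebraicIndependent d
  refine ⟨P, hP, fun F hF φ hφ hmem => ⟨φ.base (ProjSpace.genericPoint 1), fun x => ?_⟩⟩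
  obtain ⟨k, hk⟩ := exists_X_notMem (φ.base (ProjSpace.genericPoint 1))
  obtain ⟨ψ, hlocal, hψ⟩ := exists_localHom_atPrime φ hφ (ProjSpace.genericPoint 1)
  have hbot : (ProjSpace.genericPoint 1).asHomogeneousIdeal.toIdeal = ⊥ :=
    HomogeneousIdeal.toIdeal_bot
  obtain ⟨N, n, hn, hiff⟩ := exists_homogeneous_of_localHom
    (φ.base (ProjSpace.genericPoint 1)).asHomogeneousIdeal.toIdeal hk hbot ψ hψ
  have hnk : n k ≠ 0 := fun h => hk ((hiff (isHomogeneous_X ℂ k)).mpr (by rw [aeval_X, h]))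
  obtain ⟨c, hc⟩ := exists_proportional_of_aeval_eq_zero hd F.2 (hPF F hF) hn
    ((hiff F.2).mp (hmem _)) hnk
  refine map_eq_map_genericPoint φ (k := k) (c := c) (fun i => ?_) x
  refine (hiff (D := 1) ((isHomogeneous_X ℂ i).sub ?_)).mpr ?_
  · simpa using (isHomogeneous_C _ (c i)).mul (isHomogeneous_X ℂ k)
  · rw [map_sub, map_mul, aeval_X, aeval_X, aeval_C, hc i, sub_eq_zero]
    rfl
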